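/- arXiv:2102.12977 — 2 statements merged into one kernel-verified Lean document; each statement's English description precedes it below -/
import Mathlib

section
/- Every rational solution (x, y) ∈ ℚ × ℚ of the equation 2y² = x(x + 241)(x + 482) satisfies y = 0; equivalently, the only rational points of the genus 1 curve E₄ : 2y² = x(x + 241)(x + 482) are its points of order at most 2. -/
namespace RationalPointsE4

section General

variable {R : Type*} [CommRing R]

/-- A prime occurs to different parities on both sides of `A * x ^ 2 = q * B * y ^ 2`. -/
theorem eq_zero_of_mul_sq_eq_prime_mul [IsDomain R] [WfDvdMonoid R] {q A B x y : R} (hq : Prime q)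
    (hA : ¬ q ∣ A) (hB : ¬ q ∣ B) (h : A * x ^ 2 = q * B * y ^ 2) : x = 0 := by
  by_contra hx
  have hA0 : A ≠ 0 := fun h0 => hA (h0 ▸ dvd_zero q)
  have hy : y ≠ 0 := by
    rintro rfl
    have : A * x ^ 2 ≠ 0 := mul_ne_zero hA0 (pow_ne_zero 2 hx)
    exact this (by rw [h]; ring)
  have e := congrArg (emultiplicity q) h
  have fx : FiniteMultiplicity q x := FiniteMultiplicity.of_not_isUnit hq.not_isUnit hx
  have fy : FiniteMultiplicity q y := FiniteMultiplicity.of_not_isUnit hq.not_isUnit hy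
  have fq : FiniteMultiplicity q q := FiniteMultiplicity.of_not_isUnit hq.not_isUnit hq.ne_zero
  rw [emultiplicity_mul hq, emultiplicity_mul hq, emultiplicity_mul hq, emultiplicity_pow hq,
    emultiplicity_pow hq, emultiplicity_eq_zero.mpr hA, emultiplicity_eq_zero.mpr hB,
    fx.emultiplicity_eq_multiplicity, fy.emultiplicity_eq_multiplicity,
    fq.emultiplicity_self] at e
  have e' : 2 * multiplicity q x = 1 + 2 * multiplicity q y := by
    have : ((2 * multiplicity q x : ℕ) : ℕ∞) = ((1 + 2 * multiplicity q y : ℕ) : ℕ∞) := by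
      push_cast
      simpa using e
    exact_mod_cast this
  omega

theorem exists_squarefree_mul_sq [WfDvdMonoid R] {L : R} (hL : L ≠ 0) :
    ∃ d t : R, Squarefree d ∧ L = d * t ^ 2 := by
  induction L using (IsWellFounded.wf : WellFounded (DvdNotUnit (α := R))).induction with
  | _ L ih =>
    by_cases hs : Squarefree L
    · exact ⟨L, 1, hs, by ring⟩
    · unfold Squarefree at hs
      push Not at hs
      obtain ⟨x, ⟨M, hM⟩, hx⟩ := hs
      have hM0 : M ≠ 0 := by
        rintro rfl
        exact hL (by rw [hM, mul_zero])
      obtain ⟨d, t, hd, hdt⟩ := ih M ⟨hM0, x * x, fun hu => hx (isUnit_of_mul_isUnit_left hu),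
        by rw [hM]; ring⟩ hM0
      exact ⟨d, t * x, hd, by rw [hM, hdt]; ring⟩

theorem not_dvd_of_squarefree {q e : R} (hq : Prime q) (h : Squarefree (q * e)) : ¬ q ∣ e := by
  rintro ⟨f, rfl⟩
  exact hq.not_isUnit (h q ⟨f, by ring⟩)

/-- A squarefree element all of whose prime divisors are associated to `π` is a unit or
a unit times `π`. -/
theorem eq_unit_or_unit_mul [UniqueFactorizationMonoid R] {π d : R} (hd : Squarefree d)
    (hd0 : d ≠ 0) (hπ : Prime π)
    (h : ∀ q, Prime q → q ∣ d → π ∣ q) : IsUnit d ∨ ∃ u, IsUnit u ∧ d = π * u := by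
  by_cases hu : IsUnit d
  · exact Or.inl hu
  · right
    have key : ∀ e : R, e ≠ 0 → (∀ q, Prime q → q ∣ e → π ∣ q) → ¬ π ∣ e → IsUnit e := by
      intro e he hq hn
      by_contra hne
      obtain ⟨q, hq1, hq2⟩ := WfDvdMonoid.exists_irreducible_factor hne he
      exact hn ((hq q hq1.prime hq2).trans hq2)
    have hπd : π ∣ d := by
      by_contra hn
      exact hu (key d hd0 h hn)
    obtain ⟨e, rfl⟩ := hπd
    refine ⟨e, key e (right_ne_zero_of_mul hd0) (fun q h1 h2 => h q h1 (h2.mul_left π))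
      (not_dvd_of_squarefree hπ hd), rfl⟩

/-- The tangent line at a point of the conic `a X² + b Y² + c Z² = 0`, evaluated at another
point, has even valuation at every prime not dividing
`2 * a * b * c`; first coordinate version. -/
theorem tangent_even_aux [IsDomain R] [WfDvdMonoid R] {a b c X₀ Y₀ Z₀ X Y Z q e t : R} (hq : Prime q)
    (h2 : ¬ q ∣ 2) (ha : ¬ q ∣ a) (hb : ¬ q ∣ b) (hc : ¬ q ∣ c)
    (h0 : a * X₀ ^ 2 + b * Y₀ ^ 2 + c * Z₀ ^ 2 = 0) (h : a * X ^ 2 + b * Y ^ 2 + c * Z ^ 2 = 0)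
    (hX₀ : ¬ q ∣ X₀) (hp : q ∣ X → q ∣ Y → False) (he : ¬ q ∣ e) (ht : t ≠ 0)
    (hL : a * X₀ * X + b * Y₀ * Y + c * Z₀ * Z = q * e * t ^ 2) : False := by
  set L := a * X₀ * X + b * Y₀ * Y + c * Z₀ * Z with hLdef
  set L' := -a * X₀ * X + b * Y₀ * Y + c * Z₀ * Z with hLdef'
  have hLL : L * L' = -(b * c) * (Y * Z₀ - Z * Y₀) ^ 2 := by
    linear_combination (-a * X ^ 2) * h0 + (b * Y₀ ^ 2 + c * Z₀ ^ 2) * h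
  have hqL : q ∣ L := ⟨e * t ^ 2, by rw [hL]; ring⟩
  by_cases hqL' : q ∣ L'
  · have hX : q ∣ X := by
      have : q ∣ 2 * a * X₀ * X := by
        have h3 : 2 * a * X₀ * X = L - L' := by rw [hLdef, hLdef']; ring
        rw [h3]; exact dvd_sub hqL hqL'
      rcases hq.dvd_or_dvd this with h4 | h4
      · rcases hq.dvd_or_dvd h4 with h5 | h5
        · rcases hq.dvd_or_dvd h5 with h6 | h6 <;> contradiction
        · contradiction
      · exact h4
    have hM : q ∣ Y * Z₀ - Z * Y₀ := by
      have h3 : q ∣ -(b * c) * (Y * Z₀ - Z * Y₀) ^ 2 := hLL ▸ hqL.mul_right L'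
      rcases hq.dvd_or_dvd h3 with h4 | h4
      · rcases hq.dvd_or_dvd ((dvd_neg).mp h4) with h5 | h5 <;> contradiction
      · exact hq.dvd_of_dvd_pow h4
    have hY : q ∣ Y := by
      have h3 : a * (X₀ ^ 2 * Y) = -(Y₀ * (L - a * X₀ * X) + c * Z₀ * (Y * Z₀ - Z * Y₀)) := by
        rw [hLdef]; linear_combination Y * h0
      have h4 : q ∣ a * (X₀ ^ 2 * Y) := by
        rw [h3]
        exact (dvd_neg).mpr (dvd_add ((dvd_sub hqL (hX.mul_left _)).mul_left _) (hM.mul_left _))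
      rcases hq.dvd_or_dvd h4 with h5 | h5
      · contradiction
      · rcases hq.dvd_or_dvd h5 with h6 | h6
        · exact absurd (hq.dvd_of_dvd_pow h6) hX₀
        · exact h6
    exact hp hX hY
  · apply ht
    have hbc : ¬ q ∣ -(b * c) := by
      rw [dvd_neg]
      intro h4
      rcases hq.dvd_or_dvd h4 with h5 | h5 <;> contradiction
    have heL : ¬ q ∣ e * L' := by
      intro h4
      rcases hq.dvd_or_dvd h4 with h5 | h5 <;> contradiction
    have hM := eq_zero_of_mul_sq_eq_prime_mul (y := t) hq hbc heL
      (by rw [← hLL, hL]; ring)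
    have hL'0 : L' ≠ 0 := fun h5 => hqL' (h5 ▸ dvd_zero q)
    rw [hM, hL] at hLL
    have h6 : q * e * t ^ 2 * L' = 0 := by rw [hLL]; ring
    have he0 : e ≠ 0 := fun h5 => he (h5 ▸ dvd_zero q)
    simpa [hq.ne_zero, he0, hL'0] using h6

theorem tangent_even [IsDomain R] [WfDvdMonoid R] {a b c X₀ Y₀ Z₀ X Y Z q e t : R} (hq : Prime q)
    (h2 : ¬ q ∣ 2) (ha : ¬ q ∣ a) (hb : ¬ q ∣ b) (hc : ¬ q ∣ c)
    (h0 : a * X₀ ^ 2 + b * Y₀ ^ 2 + c * Z₀ ^ 2 = 0) (h : a * X ^ 2 + b * Y ^ 2 + c * Z ^ 2 = 0)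
    (hp₀ : q ∣ X₀ → q ∣ Y₀ → q ∣ Z₀ → False) (hp : q ∣ X → q ∣ Y → False)
    (he : ¬ q ∣ e) (ht : t ≠ 0)
    (hL : a * X₀ * X + b * Y₀ * Y + c * Z₀ * Z = q * e * t ^ 2) : False := by
  have hY : q ∣ X → q ∣ Z → q ∣ Y := by
    intro h1 h3
    have : q ∣ b * Y ^ 2 := by
      have h4 : b * Y ^ 2 = -(a * X ^ 2 + c * Z ^ 2) := by linear_combination h
      rw [h4, dvd_neg]
      exact dvd_add ((dvd_pow h1 two_ne_zero).mul_left _) ((dvd_pow h3 two_ne_zero).mul_left _)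
    rcases hq.dvd_or_dvd this with h5 | h5
    · contradiction
    · exact hq.dvd_of_dvd_pow h5
  have hX : q ∣ Y → q ∣ Z → q ∣ X := by
    intro h1 h3
    have : q ∣ a * X ^ 2 := by
      have h4 : a * X ^ 2 = -(b * Y ^ 2 + c * Z ^ 2) := by linear_combination h
      rw [h4, dvd_neg]
      exact dvd_add ((dvd_pow h1 two_ne_zero).mul_left _) ((dvd_pow h3 two_ne_zero).mul_left _)
    rcases hq.dvd_or_dvd this with h5 | h5
    · contradiction
    · exact hq.dvd_of_dvd_pow h5
  by_cases h1 : q ∣ X₀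
  · by_cases h3 : q ∣ Y₀
    · exact tangent_even_aux (a := c) (b := a) (c := b) (X₀ := Z₀) (Y₀ := X₀) (Z₀ := Y₀)
        (X := Z) (Y := X) (Z := Y) hq h2 hc ha hb (by linear_combination h0)
        (by linear_combination h) (fun h4 => hp₀ h1 h3 h4) (fun h5 h6 => hp h6 (hY h6 h5)) he ht
        (by linear_combination hL)
    · exact tangent_even_aux (a := b) (b := c) (c := a) (X₀ := Y₀) (Y₀ := Z₀) (Z₀ := X₀)
        (X := Y) (Y := Z) (Z := X) hq h2 hb hc ha (by linear_combination h0)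
        (by linear_combination h) h3 (fun h5 h6 => hp (hX h5 h6) h5) he ht
        (by linear_combination hL)
  · exact tangent_even_aux hq h2 ha hb hc h0 h h1 hp he ht hL

end General

/-- Totally positive units of `ℤ[√2]` are squares. -/
theorem exists_of_sq_sub_two_mul_sq {A S : ℤ} (hA : 0 < A) (h : A ^ 2 - 2 * S ^ 2 = 1) :
    ∃ e f : ℤ, A = e ^ 2 + 2 * f ^ 2 ∧ S = 2 * (e * f) ∧
      (e ^ 2 - 2 * f ^ 2 = 1 ∨ e ^ 2 - 2 * f ^ 2 = -1) := by
  have hodd : A % 2 = 1 := by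
    rcases Int.emod_two_eq_zero_or_one A with h1 | h1
    · obtain ⟨k, rfl⟩ := Int.dvd_of_emod_eq_zero h1
      exfalso
      have : 2 * (2 * k ^ 2 - S ^ 2) = 1 := by linear_combination h
      omega
    · exact h1
  obtain ⟨k, rfl⟩ : ∃ k, A = 2 * k + 1 := ⟨A / 2, by omega⟩
  have hS2 : S ^ 2 = 2 * (k * (k + 1)) := by linarith [h]
  obtain ⟨s, rfl⟩ : ∃ s, S = 2 * s := by
    have h3 : Even (S ^ 2) := ⟨k * (k + 1), by rw [hS2]; ring⟩
    have h4 : Even S := (Int.even_pow.mp h3).1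
    obtain ⟨s, hs⟩ := h4
    exact ⟨s, by omega⟩
  have hk : 0 ≤ k := by omega
  have hks : k * (k + 1) = 2 * s ^ 2 := by linarith [hS2]
  have fin : ∀ e f e' : ℤ, e' ^ 2 = e ^ 2 → (e' * f) ^ 2 = s ^ 2 →
      (∃ e₁ f₁ : ℤ, e₁ ^ 2 = e ^ 2 ∧ f₁ ^ 2 = f ^ 2 ∧ e₁ * f₁ = s) := by
    intro e f e' h1 h2
    rcases sq_eq_sq_iff_eq_or_eq_neg.mp h2 with h3 | h3
    · exact ⟨e', f, h1, rfl, h3⟩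
    · exact ⟨e', -f, h1, by ring, by linarith⟩
  have key : ∀ u v : ℤ, 0 ≤ u → 0 ≤ v → IsCoprime (2 * u) v → 2 * u * v = 2 * s ^ 2 →
      ∃ e f : ℤ, v = e ^ 2 ∧ u = f ^ 2 ∧ e * f = s := by
    intro u v hu hv hc huv
    have huv' : u * v = s ^ 2 := by linarith
    have hc' : IsCoprime u v := hc.of_mul_left_right
    obtain ⟨f, hf | hf⟩ := Int.sq_of_isCoprime hc' huv'
    · obtain ⟨e, he | he⟩ := Int.sq_of_isCoprime hc'.symm (by rw [mul_comm]; exact huv')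
      · obtain ⟨e₁, f₁, h1, h2, h3⟩ := fin e f e rfl (by rw [← huv', hf, he]; ring)
        exact ⟨e₁, f₁, by rw [he, h1], by rw [hf, h2], h3⟩
      · have : e = 0 := by nlinarith [sq_nonneg e]
        subst this
        obtain ⟨e₁, f₁, h1, h2, h3⟩ := fin 0 f 0 rfl (by rw [← huv', hf, he]; ring)
        exact ⟨e₁, f₁, by rw [he, h1]; ring, by rw [hf, h2], h3⟩
    · have : f = 0 := by nlinarith [sq_nonneg f]
      subst this
      have hu0 : u = 0 := by rw [hf]; ring
      subst hu0
      have hs : s = 0 := by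
        have : s ^ 2 = 0 := by linarith
        exact pow_eq_zero_iff two_ne_zero |>.mp this
      have hv1 : IsUnit v := by
        rw [mul_zero] at hc
        exact isCoprime_zero_left.mp hc
      have : v = 1 := by
        rcases Int.isUnit_iff.mp hv1 with h1 | h1
        · exact h1
        · omega
      exact ⟨1, 0, by rw [this]; norm_num, by norm_num, by rw [hs]; norm_num⟩
  rcases Int.even_or_odd' k with ⟨m, rfl | rfl⟩
  · obtain ⟨e, f, h1, h2, h3⟩ := key m (2 * m + 1) (by omega) (by omega)
      ⟨-1, 1, by ring⟩ hks
    exact ⟨e, f, by linarith, by rw [h3], Or.inl (by linarith)⟩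
  · obtain ⟨e, f, h1, h2, h3⟩ := key (m + 1) (2 * m + 1) (by omega) (by omega)
      ⟨1, -1, by ring⟩ (by linarith)
    exact ⟨e, f, by linarith, by rw [h3], Or.inr (by linarith)⟩

/-- The ring `ℤ[ζ]` with `ζ ^ 4 = -1`; `⟨a, b, c, d⟩` stands for `a + bζ + cζ² + dζ³`. -/
@[ext]
structure Z8 where
  a : ℤ
  b : ℤ
  c : ℤ
  d : ℤ

namespace Z8

instance : DecidableEq Z8 := fun x y =>
  decidable_of_iff (x.a = y.a ∧ x.b = y.b ∧ x.c = y.c ∧ x.d = y.d) Z8.ext_iff.symm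

instance : Zero Z8 := ⟨⟨0, 0, 0, 0⟩⟩
instance : One Z8 := ⟨⟨1, 0, 0, 0⟩⟩
instance : Add Z8 := ⟨fun x y => ⟨x.a + y.a, x.b + y.b, x.c + y.c, x.d + y.d⟩⟩
instance : Neg Z8 := ⟨fun x => ⟨-x.a, -x.b, -x.c, -x.d⟩⟩
instance : Mul Z8 := ⟨fun x y =>
  ⟨x.a * y.a - x.b * y.d - x.c * y.c - x.d * y.b,
   x.a * y.b + x.b * y.a - x.c * y.d - x.d * y.c,
   x.a * y.c + x.b * y.b + x.c * y.a - x.d * y.d,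
   x.a * y.d + x.b * y.c + x.c * y.b + x.d * y.a⟩⟩
instance : IntCast Z8 := ⟨fun n => ⟨n, 0, 0, 0⟩⟩
instance : NatCast Z8 := ⟨fun n => ⟨n, 0, 0, 0⟩⟩

@[simp] theorem zero_a : (0 : Z8).a = 0 := rfl
@[simp] theorem zero_b : (0 : Z8).b = 0 := rfl
@[simp] theorem zero_c : (0 : Z8).c = 0 := rfl
@[simp] theorem zero_d : (0 : Z8).d = 0 := rfl
@[simp] theorem one_a : (1 : Z8).a = 1 := rfl
@[simp] theorem one_b : (1 : Z8).b = 0 := rfl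
@[simp] theorem one_c : (1 : Z8).c = 0 := rfl
@[simp] theorem one_d : (1 : Z8).d = 0 := rfl
@[simp] theorem add_a (x y : Z8) : (x + y).a = x.a + y.a := rfl
@[simp] theorem add_b (x y : Z8) : (x + y).b = x.b + y.b := rfl
@[simp] theorem add_c (x y : Z8) : (x + y).c = x.c + y.c := rfl
@[simp] theorem add_d (x y : Z8) : (x + y).d = x.d + y.d := rfl
@[simp] theorem neg_a (x : Z8) : (-x).a = -x.a := rfl
@[simp] theorem neg_b (x : Z8) : (-x).b = -x.b := rfl
@[simp] theorem neg_c (x : Z8) : (-x).c = -x.c := rfl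
@[simp] theorem neg_d (x : Z8) : (-x).d = -x.d := rfl
@[simp] theorem mul_a (x y : Z8) :
    (x * y).a = x.a * y.a - x.b * y.d - x.c * y.c - x.d * y.b := rfl
@[simp] theorem mul_b (x y : Z8) :
    (x * y).b = x.a * y.b + x.b * y.a - x.c * y.d - x.d * y.c := rfl
@[simp] theorem mul_c (x y : Z8) :
    (x * y).c = x.a * y.c + x.b * y.b + x.c * y.a - x.d * y.d := rfl
@[simp] theorem mul_d (x y : Z8) :
    (x * y).d = x.a * y.d + x.b * y.c + x.c * y.b + x.d * y.a := rfl
@[simp] theorem intCast_a (n : ℤ) : (n : Z8).a = n := rfl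
@[simp] theorem intCast_b (n : ℤ) : (n : Z8).b = 0 := rfl
@[simp] theorem intCast_c (n : ℤ) : (n : Z8).c = 0 := rfl
@[simp] theorem intCast_d (n : ℤ) : (n : Z8).d = 0 := rfl
@[simp] theorem natCast_a (n : ℕ) : (n : Z8).a = n := rfl
@[simp] theorem natCast_b (n : ℕ) : (n : Z8).b = 0 := rfl
@[simp] theorem natCast_c (n : ℕ) : (n : Z8).c = 0 := rfl
@[simp] theorem natCast_d (n : ℕ) : (n : Z8).d = 0 := rfl

instance : CommRing Z8 where
  nsmul := nsmulRec
  zsmul := zsmulRec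
  add_assoc x y z := by ext <;> simp <;> ring
  zero_add x := by ext <;> simp
  add_zero x := by ext <;> simp
  add_comm x y := by ext <;> simp <;> ring
  left_distrib x y z := by ext <;> simp <;> ring
  right_distrib x y z := by ext <;> simp <;> ring
  zero_mul x := by ext <;> simp
  mul_zero x := by ext <;> simp
  mul_assoc x y z := by ext <;> simp <;> ring
  one_mul x := by ext <;> simp
  mul_one x := by ext <;> simp
  neg_add_cancel x := by ext <;> simp
  mul_comm x y := by ext <;> simp <;> ring
  natCast_zero := by ext <;> simp
  natCast_succ n := by ext <;> simp
  intCast_ofNat n := by ext <;> simp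
  intCast_negSucc n := by ext <;> simp [Int.negSucc_eq]

@[simp] theorem sub_a (x y : Z8) : (x - y).a = x.a - y.a := rfl
@[simp] theorem sub_b (x y : Z8) : (x - y).b = x.b - y.b := rfl
@[simp] theorem sub_c (x y : Z8) : (x - y).c = x.c - y.c := rfl
@[simp] theorem sub_d (x y : Z8) : (x - y).d = x.d - y.d := rfl
@[simp] theorem ofNat_a (n : ℕ) [n.AtLeastTwo] : (ofNat(n) : Z8).a = ofNat(n) := rfl
@[simp] theorem ofNat_b (n : ℕ) [n.AtLeastTwo] : (ofNat(n) : Z8).b = 0 := rfl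
@[simp] theorem ofNat_c (n : ℕ) [n.AtLeastTwo] : (ofNat(n) : Z8).c = 0 := rfl
@[simp] theorem ofNat_d (n : ℕ) [n.AtLeastTwo] : (ofNat(n) : Z8).d = 0 := rfl

instance : Nontrivial Z8 := ⟨⟨0, 1, fun h => by simpa using congrArg Z8.a h⟩⟩

/-- The automorphism `ζ ↦ ζ³`. -/
def s3 : Z8 →+* Z8 where
  toFun x := ⟨x.a, x.d, -x.c, x.b⟩
  map_zero' := by ext <;> simp
  map_one' := by ext <;> simp
  map_add' x y := by ext <;> simp; ring
  map_mul' x y := by ext <;> simp <;> ring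

/-- The automorphism `ζ ↦ ζ⁵`. -/
def s5 : Z8 →+* Z8 where
  toFun x := ⟨x.a, -x.b, x.c, -x.d⟩
  map_zero' := by ext <;> simp
  map_one' := by ext <;> simp
  map_add' x y := by ext <;> simp <;> ring
  map_mul' x y := by ext <;> simp <;> ring

/-- The automorphism `ζ ↦ ζ⁷`. -/
def s7 : Z8 →+* Z8 where
  toFun x := ⟨x.a, -x.d, -x.c, -x.b⟩
  map_zero' := by ext <;> simp
  map_one' := by ext <;> simp
  map_add' x y := by ext <;> simp <;> ring
  map_mul' x y := by ext <;> simp <;> ring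

@[simp] theorem s3_mk (a b c d : ℤ) : s3 ⟨a, b, c, d⟩ = ⟨a, d, -c, b⟩ := rfl
@[simp] theorem s5_mk (a b c d : ℤ) : s5 ⟨a, b, c, d⟩ = ⟨a, -b, c, -d⟩ := rfl
@[simp] theorem s7_mk (a b c d : ℤ) : s7 ⟨a, b, c, d⟩ = ⟨a, -d, -c, -b⟩ := rfl

theorem s3_s3 (x : Z8) : s3 (s3 x) = x := by cases x; simp
theorem s3_s7 (x : Z8) : s3 (s7 x) = s5 x := by cases x; simp
theorem s5_s3 (x : Z8) : s5 (s3 x) = s7 x := by cases x; simp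
theorem s7_s3 (x : Z8) : s7 (s3 x) = s5 x := by cases x; simp
theorem s7_s7 (x : Z8) : s7 (s7 x) = x := by cases x; simp

/-- The absolute norm, as the norm from `ℤ[√-2]` of the relative norm. -/
def nrm (x : Z8) : ℤ :=
  (x.a ^ 2 + x.c ^ 2 - x.b ^ 2 - x.d ^ 2) ^ 2 +
    2 * (x.a * (x.b + x.d) - x.c * (x.b - x.d)) ^ 2

theorem nrm_nonneg (x : Z8) : 0 ≤ nrm x := by unfold nrm; positivity

theorem mul_s3 (x : Z8) : x * s3 x =
    ⟨x.a ^ 2 + x.c ^ 2 - x.b ^ 2 - x.d ^ 2, x.a * (x.b + x.d) - x.c * (x.b - x.d), 0,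
      x.a * (x.b + x.d) - x.c * (x.b - x.d)⟩ := by
  cases x; ext <;> simp <;> ring

theorem mul_s7 (x : Z8) : x * s7 x =
    ⟨x.a ^ 2 + x.b ^ 2 + x.c ^ 2 + x.d ^ 2, x.a * x.b + x.b * x.c + x.c * x.d - x.d * x.a, 0,
      -(x.a * x.b + x.b * x.c + x.c * x.d - x.d * x.a)⟩ := by
  cases x; ext <;> simp <;> ring

theorem nrm_eq_sub (x : Z8) : nrm x = (x.a ^ 2 + x.b ^ 2 + x.c ^ 2 + x.d ^ 2) ^ 2 -
    2 * (x.a * x.b + x.b * x.c + x.c * x.d - x.d * x.a) ^ 2 := by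
  unfold nrm; ring

theorem nrm_eq (x : Z8) : (nrm x : Z8) = x * (s3 x * s5 x * s7 x) := by
  have h : x * (s3 x * s5 x * s7 x) = (x * s3 x) * s5 (x * s3 x) := by
    rw [map_mul, s5_s3]; ring
  rw [h, mul_s3, s5_mk, show (nrm x : Z8) = ⟨nrm x, 0, 0, 0⟩ from rfl]
  ext <;> simp only [mul_a, mul_b, mul_c, mul_d, nrm] <;> ring

theorem intCast_inj {m n : ℤ} (h : (m : Z8) = n) : m = n := congrArg Z8.a h

theorem nrm_mul (x y : Z8) : nrm (x * y) = nrm x * nrm y := by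
  apply intCast_inj
  push_cast
  rw [nrm_eq, nrm_eq, nrm_eq]
  simp only [map_mul]
  ring

theorem nrm_s3 (x : Z8) : nrm (s3 x) = nrm x := by cases x; simp [nrm]; ring
theorem nrm_s5 (x : Z8) : nrm (s5 x) = nrm x := by cases x; simp [nrm]; ring
theorem nrm_s7 (x : Z8) : nrm (s7 x) = nrm x := by cases x; simp [nrm]; ring

theorem eq_zero_of_sq_eq_two_mul_sq {m n : ℤ} (h : m ^ 2 = 2 * n ^ 2) : m = 0 := by
  refine eq_zero_of_mul_sq_eq_prime_mul (q := (2 : ℤ)) (A := 1) (B := 1) (y := n)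
    Int.prime_two (by norm_num) (by norm_num) (by linarith)

theorem eq_zero_of_nrm {x : Z8} (h : nrm x = 0) : x = 0 := by
  rw [nrm_eq_sub] at h
  have h1 := eq_zero_of_sq_eq_two_mul_sq (by linarith :
    (x.a ^ 2 + x.b ^ 2 + x.c ^ 2 + x.d ^ 2) ^ 2 =
      2 * (x.a * x.b + x.b * x.c + x.c * x.d - x.d * x.a) ^ 2)
  have ha := sq_nonneg x.a
  have hb := sq_nonneg x.b
  have hc := sq_nonneg x.c
  have hd := sq_nonneg x.d
  ext
  · exact pow_eq_zero_iff two_ne_zero |>.mp (by linarith : x.a ^ 2 = 0)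
  · exact pow_eq_zero_iff two_ne_zero |>.mp (by linarith : x.b ^ 2 = 0)
  · exact pow_eq_zero_iff two_ne_zero |>.mp (by linarith : x.c ^ 2 = 0)
  · exact pow_eq_zero_iff two_ne_zero |>.mp (by linarith : x.d ^ 2 = 0)

/-- The product of the nontrivial conjugates. -/
def cof (x : Z8) : Z8 := s3 x * s5 x * s7 x

theorem mul_cof (x : Z8) : x * cof x = (nrm x : Z8) := (nrm_eq x).symm

theorem nrm_cof (x : Z8) : nrm (cof x) = nrm x ^ 3 := by
  rw [cof, nrm_mul, nrm_mul, nrm_s3, nrm_s5, nrm_s7]; ring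

/-- The quotient `x / y`, each coordinate rounded to a nearest integer. -/
def quo (x y : Z8) : Z8 :=
  let r := fun t : ℤ => (2 * t + nrm y) / (2 * nrm y)
  ⟨r (x * cof y).a, r (x * cof y).b, r (x * cof y).c, r (x * cof y).d⟩

theorem nrm_lt_of_small {n : ℤ} {e : Z8}
    (ha : -n ≤ 2 * e.a ∧ 2 * e.a < n) (hb : -n ≤ 2 * e.b ∧ 2 * e.b < n)
    (hc : -n ≤ 2 * e.c ∧ 2 * e.c < n) (hd : -n ≤ 2 * e.d ∧ 2 * e.d < n) :
    nrm e < n ^ 4 := by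
  have sq : ∀ t : ℤ, -n ≤ 2 * t ∧ 2 * t < n →
      (4 * t ^ 2 ≤ n ^ 2) ∧ (4 * t ^ 2 = n ^ 2 → 2 * t = -n) := by
    rintro t ⟨h1, h2⟩
    refine ⟨by nlinarith, fun h3 => ?_⟩
    by_contra h4
    have h5 : 0 < 2 * t + n := by omega
    nlinarith
  obtain ⟨a1, a2⟩ := sq _ ha
  obtain ⟨b1, b2⟩ := sq _ hb
  obtain ⟨c1, c2⟩ := sq _ hc
  obtain ⟨d1, d2⟩ := sq _ hd
  rw [nrm_eq_sub]
  have hA0 : 0 ≤ e.a ^ 2 + e.b ^ 2 + e.c ^ 2 + e.d ^ 2 := by positivity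
  rcases lt_or_ge (e.a ^ 2 + e.b ^ 2 + e.c ^ 2 + e.d ^ 2) (n ^ 2) with h | h
  · have := sq_nonneg (e.a * e.b + e.b * e.c + e.c * e.d - e.d * e.a)
    nlinarith
  · have ea := a2 (by linarith)
    have eb := b2 (by linarith)
    have ec := c2 (by linarith)
    have ed := d2 (by linarith)
    have hb' : e.b = e.a := by linarith
    have hc' : e.c = e.a := by linarith
    have hd' : e.d = e.a := by linarith
    have hn' : n = -(2 * e.a) := by linarith
    rw [hb', hc', hd', hn']
    have : e.a ≠ 0 := by omega
    have h4 : 0 < e.a ^ 4 := by positivity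
    nlinarith

theorem nrm_mod_lt (x : Z8) {y : Z8} (hy : y ≠ 0) : nrm (x - y * quo x y) < nrm y := by
  have hn : 0 < nrm y := lt_of_le_of_ne (nrm_nonneg y) fun h => hy (eq_zero_of_nrm h.symm)
  have key : (x - y * quo x y) * cof y = x * cof y - (nrm y : Z8) * quo x y := by
    rw [← mul_cof y]; ring
  have r : ∀ t : ℤ, -nrm y ≤ 2 * (t - nrm y * ((2 * t + nrm y) / (2 * nrm y))) ∧
      2 * (t - nrm y * ((2 * t + nrm y) / (2 * nrm y))) < nrm y := by
    intro t
    have h1 := Int.mul_ediv_add_emod (2 * t + nrm y) (2 * nrm y)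
    have h2 := Int.emod_nonneg (2 * t + nrm y) (by omega : 2 * nrm y ≠ 0)
    have h3 := Int.emod_lt_of_pos (2 * t + nrm y) (by omega : 0 < 2 * nrm y)
    constructor <;> linarith
  have h4 : nrm ((x - y * quo x y) * cof y) < nrm y ^ 4 := by
    rw [key]
    apply nrm_lt_of_small
    · simpa [quo] using r (x * cof y).a
    · simpa [quo] using r (x * cof y).b
    · simpa [quo] using r (x * cof y).c
    · simpa [quo] using r (x * cof y).d
  rw [nrm_mul, nrm_cof] at h4
  have h5 : 0 < nrm y ^ 3 := by positivity
  exact lt_of_mul_lt_mul_right (by linarith [h4, pow_succ (nrm y) 3, mul_comm (nrm y ^ 3) (nrm y)] :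
    nrm (x - y * quo x y) * nrm y ^ 3 < nrm y * nrm y ^ 3) h5.le

instance : EuclideanDomain Z8 :=
  { (inferInstance : CommRing Z8), (inferInstance : Nontrivial Z8) with
    quotient := quo
    remainder := fun x y => x - y * quo x y
    quotient_zero := by
      intro x
      have h0 : cof 0 = 0 := by simp [cof]
      simp [quo, h0, nrm]
      rfl
    quotient_mul_add_remainder_eq := fun x y => by ring
    r := fun x y => (nrm x).natAbs < (nrm y).natAbs
    r_wellFounded := (measure fun x : Z8 => (nrm x).natAbs).wf
    remainder_lt := fun x y hy => by
      have h1 := nrm_mod_lt x hy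
      have h2 := nrm_nonneg (x - y * quo x y)
      omega
    mul_left_not_lt := fun x y hy => by
      have h1 : 0 < nrm y := lt_of_le_of_ne (nrm_nonneg y) fun h => hy (eq_zero_of_nrm h.symm)
      have h2 := nrm_nonneg x
      rw [nrm_mul]
      have h3 : nrm x ≤ nrm x * nrm y := le_mul_of_one_le_right h2 h1
      omega }

end Z8

instance fact_prime_241 : Fact (Nat.Prime 241) := ⟨by norm_num⟩

theorem eq_zero_241 : (241 : ZMod 241) = 0 := by rfl

theorem not_isSquare_203 : ¬ IsSquare (203 : ZMod 241) := by
  rintro ⟨r, hr⟩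
  revert r
  set_option maxRecDepth 100000 in decide

namespace Z8

/-- Reduction modulo the prime `W` above `241`, sending `ζ` to `8`. -/
def phi : Z8 →+* ZMod 241 where
  toFun x := x.a + 8 * x.b + 64 * x.c + 30 * x.d
  map_zero' := by simp
  map_one' := by simp
  map_add' x y := by simp; ring
  map_mul' x y := by
    simp only [mul_a, mul_b, mul_c, mul_d]
    push_cast
    linear_combination (-(x.b : ZMod 241) * y.d - x.d * y.b - 17 * x.c * y.c - 8 * x.c * y.d
      - 8 * x.d * y.c - 4 * x.d * y.d - 2 * x.b * y.c - 2 * x.c * y.b) * eq_zero_241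

theorem phi_apply (x : Z8) : phi x = x.a + 8 * x.b + 64 * x.c + 30 * x.d := rfl

/-- A prime above `241`. -/
def W : Z8 := ⟨1, -2, 4, 0⟩

/-- The prime above `2`. -/
def varpi : Z8 := ⟨1, -1, 0, 0⟩

theorem phi_W : phi W = 0 := by rw [phi_apply, W]; decide

theorem W_dvd_iff {x : Z8} : W ∣ x ↔ phi x = 0 := by
  constructor
  · rintro ⟨y, rfl⟩
    rw [map_mul, phi_W, zero_mul]
  · intro h
    have h1 : ((x.a + 8 * x.b + 64 * x.c + 30 * x.d : ℤ) : ZMod 241) = 0 := by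
      push_cast; exact h
    obtain ⟨m, hm⟩ := (ZMod.intCast_zmod_eq_zero_iff_dvd _ 241).mp h1
    have hW : (241 : Z8) = W * cof W := by rw [mul_cof]; ext <;> simp [W, nrm]
    have hz : (⟨-8, 1, 0, 0⟩ : Z8) = W * ⟨0, 1, 2, 0⟩ := by ext <;> simp [W]
    refine ⟨⟨0, 1, 2, 0⟩ * ⟨x.b + 8 * x.c + 64 * x.d, x.c + 8 * x.d, x.d, 0⟩ +
      cof W * ((m + 2 * x.d : ℤ) : Z8), ?_⟩
    rw [mul_add, ← mul_assoc, ← mul_assoc, ← hW, ← hz]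
    have : x.a = 241 * m - 8 * x.b - 64 * x.c - 30 * x.d := by push_cast at hm; linarith
    ext
    · simp; linarith
    all_goals simp; try ring

theorem isUnit_iff {x : Z8} : IsUnit x ↔ nrm x = 1 := by
  constructor
  · rintro ⟨u, rfl⟩
    have h : nrm (u : Z8) * nrm (↑u⁻¹ : Z8) = 1 := by
      rw [← nrm_mul, Units.mul_inv]; simp [nrm]
    exact Int.eq_one_of_mul_eq_one_right (nrm_nonneg _) h
  · intro h
    refine IsUnit.of_mul_eq_one (cof x) ?_
    rw [mul_cof, h]; simp

theorem W_prime : Prime W := by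
  refine ⟨fun h => by simpa [W] using congrArg Z8.a h, fun h => ?_, fun x y h => ?_⟩
  · rw [isUnit_iff] at h; revert h; decide
  · rw [W_dvd_iff, map_mul, mul_eq_zero] at h
    simpa only [W_dvd_iff] using h

theorem W_dvd_of_dvd {q : Z8} (hq : ¬ IsUnit q) (h : q ∣ W) : W ∣ q := by
  obtain ⟨k, hk⟩ := h
  rcases W_prime.irreducible.isUnit_or_isUnit hk with h1 | h1
  · exact absurd h1 hq
  · obtain ⟨v, rfl⟩ := h1
    exact ⟨↑v⁻¹, by rw [hk, mul_assoc, Units.mul_inv, mul_one]⟩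

theorem varpi_dvd_iff {x : Z8} : varpi ∣ x ↔ (x.a + x.b + x.c + x.d) % 2 = 0 := by
  constructor
  · rintro ⟨y, rfl⟩
    simp [varpi]; omega
  · intro h
    obtain ⟨m, hm⟩ := Int.dvd_of_emod_eq_zero h
    refine ⟨⟨x.a - m, x.a + x.b - m, x.a + x.b + x.c - m, m⟩, ?_⟩
    ext <;> simp [varpi]; linarith

theorem varpi_prime : Prime varpi := by
  refine ⟨fun h => by simpa [varpi] using congrArg Z8.a h, fun h => ?_, fun x y h => ?_⟩
  · rw [isUnit_iff] at h; revert h; decide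
  · simp only [varpi_dvd_iff, mul_a, mul_b, mul_c, mul_d] at h ⊢
    by_contra! hc
    have hx : (x.a + x.b + x.c + x.d) % 2 = 1 := by omega
    have hy : (y.a + y.b + y.c + y.d) % 2 = 1 := by omega
    have h1 := Int.mul_emod (x.a + x.b + x.c + x.d) (y.a + y.b + y.c + y.d) 2
    rw [hx, hy] at h1
    have h2 : (x.a + x.b + x.c + x.d) * (y.a + y.b + y.c + y.d) =
      (x.a * y.a - x.b * y.d - x.c * y.c - x.d * y.b +
        (x.a * y.b + x.b * y.a - x.c * y.d - x.d * y.c) +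
        (x.a * y.c + x.b * y.b + x.c * y.a - x.d * y.d) +
        (x.a * y.d + x.b * y.c + x.c * y.b + x.d * y.a)) +
      2 * (x.b * y.d + x.c * y.c + x.d * y.b + x.c * y.d + x.d * y.c + x.d * y.d) := by ring
    rw [h2] at h1
    omega

theorem two_eq_varpi : (2 : Z8) = varpi ^ 4 * ⟨0, -2, -3, -2⟩ := by
  ext <;> simp [varpi, pow_succ]

theorem eq_varpi_cube_mul {x : Z8} (ha : x.a % 2 = 1) (hb : x.b % 2 = 1) (hc : x.c % 2 = 1)
    (hd : x.d % 2 = 1) : ∃ m, x = varpi ^ 3 * m ∧ ¬ varpi ∣ m := by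
  have h : x = varpi ^ 3 + 2 * ⟨(x.a - 1) / 2, (x.b + 3) / 2, (x.c - 3) / 2, (x.d + 1) / 2⟩ := by
    ext <;> simp [varpi, pow_succ] <;> omega
  refine ⟨1 + varpi * (⟨0, -2, -3, -2⟩ *
    ⟨(x.a - 1) / 2, (x.b + 3) / 2, (x.c - 3) / 2, (x.d + 1) / 2⟩), ?_, fun h1 => ?_⟩
  · rw [two_eq_varpi] at h
    linear_combination h
  · exact varpi_prime.not_isUnit (isUnit_of_dvd_one ((dvd_add_left (dvd_mul_right _ _)).mp h1))

theorem phi_mul_phi_s3 {u : Z8} (hu : IsUnit u) :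
    phi u * phi (s3 u) = 1 ∨ phi u * phi (s3 u) = -1 := by
  rw [isUnit_iff] at hu
  have h2 : u.a * (u.b + u.d) - u.c * (u.b - u.d) = 0 := by
    unfold nrm at hu
    by_contra h
    have : 1 ≤ (u.a * (u.b + u.d) - u.c * (u.b - u.d)) ^ 2 := by
      have := sq_nonneg (u.a * (u.b + u.d) - u.c * (u.b - u.d))
      have : (u.a * (u.b + u.d) - u.c * (u.b - u.d)) ^ 2 ≠ 0 := pow_ne_zero 2 h
      omega
    have := sq_nonneg (u.a ^ 2 + u.c ^ 2 - u.b ^ 2 - u.d ^ 2)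
    omega
  have h1 : (u.a ^ 2 + u.c ^ 2 - u.b ^ 2 - u.d ^ 2) ^ 2 = 1 := by
    rw [nrm, h2] at hu; linarith
  rw [← map_mul, mul_s3, h2]
  rcases (sq_eq_sq_iff_eq_or_eq_neg.mp (h1.trans (one_pow 2).symm)) with h | h
  all_goals rw [h]; simp [phi_apply]

theorem W_dvd_of_prime {q u : Z8} (hq : Prime q) (hq2 : ¬ q ∣ 2) (hu : u ∣ 2)
    (h : q ∣ u * W) : W ∣ q := by
  refine W_dvd_of_dvd hq.not_isUnit ((hq.dvd_or_dvd h).resolve_left fun h1 => ?_)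
  exact hq2 (h1.trans hu)

theorem s3_W_dvd {q u : Z8} (hq : Prime q) (hq2 : ¬ q ∣ 2) (hu : u ∣ 2)
    (h : q ∣ u * s3 W) : s3 W ∣ q := by
  have h1 : q ∣ s3 W := (hq.dvd_or_dvd h).resolve_left fun h1 =>
    hq2 (h1.trans hu)
  have h2 : s3 q ∣ W := by simpa [s3_s3] using map_dvd s3 h1
  have h3 : ¬ IsUnit (s3 q) := by
    rw [isUnit_iff, nrm_s3, ← isUnit_iff]; exact hq.not_isUnit
  simpa [s3_s3] using map_dvd s3 (W_dvd_of_dvd h3 h2)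

theorem s7_W_dvd {q u : Z8} (hq : Prime q) (hq2 : ¬ q ∣ 2) (hu : u ∣ 2)
    (h : q ∣ u * s7 W) : s7 W ∣ q := by
  have h1 : q ∣ s7 W := (hq.dvd_or_dvd h).resolve_left fun h1 =>
    hq2 (h1.trans hu)
  have h2 : s7 q ∣ W := by simpa [s7_s7] using map_dvd s7 h1
  have h3 : ¬ IsUnit (s7 q) := by
    rw [isUnit_iff, nrm_s7, ← isUnit_iff]; exact hq.not_isUnit
  simpa [s7_s7] using map_dvd s7 (W_dvd_of_dvd h3 h2)

/-- The value at `(τ, σ₃ τ, σ₇ τ)` of the tangent line to a conic at a known point. -/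
def tangent (a b c X₀ Y₀ Z₀ τ : Z8) : Z8 := a * X₀ * τ + b * Y₀ * s3 τ + c * Z₀ * s7 τ

theorem two_ne_zero_241 : (2 : ZMod 241) ≠ 0 := by decide

theorem isSquare_neg_one_241 : IsSquare (-1 : ZMod 241) := ⟨64, by decide⟩

theorem tangent_core {ua ub uc X₀ Y₀ Z₀ τ : Z8} (hua : ua ∣ 2) (hub : ub ∣ 2)
    (huc : uc ∣ 2)
    (h0 : ua * W * X₀ ^ 2 + ub * s3 W * Y₀ ^ 2 + uc * s7 W * Z₀ ^ 2 = 0)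
    (h : ua * W * τ ^ 2 + ub * s3 W * (s3 τ) ^ 2 + uc * s7 W * (s7 τ) ^ 2 = 0)
    {m n : ℤ} (hcop : nrm X₀ * m + nrm Y₀ * n = 4)
    (hpar : let L := tangent (ua * W) (ub * s3 W) (uc * s7 W) X₀ Y₀ Z₀ τ
      L.a % 2 = 1 ∧ L.b % 2 = 1 ∧ L.c % 2 = 1 ∧ L.d % 2 = 1)
    (hx : phi (s3 (ua * W * X₀)) ≠ 0)
    (hy : phi (ub * s3 W * Y₀) ≠ 0) (hy' : phi (s7 (ub * s3 W * Y₀)) ≠ 0)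
    (hsq : IsSquare (phi (ub * s3 W * Y₀) * phi (s3 (ua * W * X₀))))
    (hrel : phi (s7 (ua * W * X₀)) * phi (ub * s3 W * Y₀) * phi (s3 (uc * s7 W * Z₀)) =
      phi (s7 (ub * s3 W * Y₀)) * phi (s3 (ua * W * X₀)) * phi (uc * s7 W * Z₀))
    (hz' : phi (s3 (uc * s7 W * Z₀)) ≠ 0)
    (hτcop : IsCoprime τ (s3 τ))
    (h3 : phi (s3 τ) ≠ 0) (h5 : phi (s5 τ) ≠ 0)
    (hs1 : phi (ub * s3 W * Y₀ * s3 τ) = phi (uc * s7 W * Z₀ * s7 τ))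
    (hs3 : phi (s3 (ua * W * X₀ * τ)) = phi (s3 (uc * s7 W * Z₀ * s7 τ))) : False := by
  have e1 : phi (tangent (ua * W) (ub * s3 W) (uc * s7 W) X₀ Y₀ Z₀ τ) =
      2 * phi (ub * s3 W * Y₀) * phi (s3 τ) := by
    have : phi (ua * W * X₀ * τ) = 0 := by simp [phi_W]
    rw [tangent, map_add, map_add, this, ← hs1, map_mul]; ring
  have e3 : phi (s3 (tangent (ua * W) (ub * s3 W) (uc * s7 W) X₀ Y₀ Z₀ τ)) =
      2 * phi (s3 (ua * W * X₀)) * phi (s3 τ) := by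
    have : phi (s3 (ub * s3 W * Y₀ * s3 τ)) = 0 := by simp [phi_W, s3_s3]
    rw [tangent, map_add, map_add, map_add, map_add, this, ← hs3, map_mul, map_mul]; ring
  have e7 : phi (s7 (tangent (ua * W) (ub * s3 W) (uc * s7 W) X₀ Y₀ Z₀ τ)) =
      2 * phi (s7 (ub * s3 W * Y₀)) * phi (s5 τ) := by
    have h1 : phi (s7 (uc * s7 W * Z₀ * s7 τ)) = 0 := by simp [phi_W, s7_s7]
    have h2 : phi (s7 (ua * W * X₀ * τ)) = phi (s7 (ub * s3 W * Y₀ * s3 τ)) := by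
      rw [map_mul phi _ (s3 τ), map_mul phi _ (s7 τ)] at hs1
      rw [map_mul s3 _ τ, map_mul s3 _ (s7 τ), map_mul phi _ (s3 τ), s3_s7,
        map_mul phi _ (s5 τ)] at hs3
      rw [map_mul s7 _ τ, map_mul phi _ (s7 τ), map_mul s7 _ (s3 τ), s7_s3,
        map_mul phi _ (s5 τ)]
      have k : phi (s3 τ) * phi (ub * s3 W * Y₀) * phi (s3 (uc * s7 W * Z₀)) ≠ 0 :=
        mul_ne_zero (mul_ne_zero h3 hy) hz'
      apply mul_left_cancel₀ k
      have k2 : phi (ub * s3 W * Y₀) * phi (s3 τ) *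
        (phi (s3 (uc * s7 W * Z₀)) * phi (s5 τ)) = phi (uc * s7 W * Z₀) * phi (s7 τ) *
        (phi (s3 (ua * W * X₀)) * phi (s3 τ)) := by rw [hs1, hs3]
      linear_combination phi (s3 τ) * phi (s7 τ) * hrel -
        phi (s7 (ub * s3 W * Y₀)) * k2
    rw [tangent, map_add, map_add, map_add, map_add, h1, h2, map_mul, map_mul, s7_s3]; ring
  generalize hL : tangent (ua * W) (ub * s3 W) (uc * s7 W) X₀ Y₀ Z₀ τ = L at e1 e3 e7
  have n1 : phi L ≠ 0 := by rw [e1]; exact mul_ne_zero (mul_ne_zero two_ne_zero_241 hy) h3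
  have n3 : phi (s3 L) ≠ 0 := by rw [e3]; exact mul_ne_zero (mul_ne_zero two_ne_zero_241 hx) h3
  have n7 : phi (s7 L) ≠ 0 := by rw [e7]; exact mul_ne_zero (mul_ne_zero two_ne_zero_241 hy') h5
  have hL0 : L ≠ 0 := fun h => n1 (by rw [h, map_zero])
  obtain ⟨d, t, hd, hdt⟩ := exists_squarefree_mul_sq hL0
  have hd0 : d ≠ 0 := fun h => hL0 (by rw [hdt, h, zero_mul])
  have ht0 : t ≠ 0 := by rintro rfl; exact hL0 (by rw [hdt]; ring)
  have hprimes : ∀ q, Prime q → q ∣ d → varpi ∣ q := by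
    intro q hq hqd
    have hqL : q ∣ L := hdt ▸ hqd.mul_right _
    by_contra hnd
    have hq2 : ¬ q ∣ 2 := by
      intro h2
      rw [two_eq_varpi] at h2
      rcases hq.dvd_or_dvd h2 with h4 | h4
      · obtain ⟨k, hk⟩ := hq.dvd_of_dvd_pow h4
        rcases varpi_prime.irreducible.isUnit_or_isUnit hk with h5 | h5
        · exact hq.not_isUnit h5
        · obtain ⟨v, rfl⟩ := h5
          exact hnd ⟨↑v⁻¹, by rw [hk, mul_assoc, Units.mul_inv, mul_one]⟩
      · refine hq.not_isUnit (isUnit_of_dvd_unit h4 ?_)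
        rw [isUnit_iff]; decide
    obtain ⟨e, rfl⟩ := hqd
    have he := not_dvd_of_squarefree hq hd
    refine tangent_even hq hq2 (fun h1 => ?_) (fun h1 => ?_) (fun h1 => ?_) h0 h
      (fun p1 p2 _ => ?_) (fun p1 p2 => ?_) he ht0 (hL.trans hdt)
    · exact n1 (W_dvd_iff.mp ((W_dvd_of_prime hq hq2 hua h1).trans hqL))
    · refine n3 (W_dvd_iff.mp ?_)
      simpa [s3_s3] using map_dvd s3 ((s3_W_dvd hq hq2 hub h1).trans hqL)
    · refine n7 (W_dvd_iff.mp ?_)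
      simpa [s7_s7] using map_dvd s7 ((s7_W_dvd hq hq2 huc h1).trans hqL)
    · have h4 : q ∣ ((nrm X₀ * m + nrm Y₀ * n : ℤ) : Z8) := by
        push_cast
        rw [nrm_eq, nrm_eq]
        exact dvd_add ((p1.mul_right _).mul_right _) ((p2.mul_right _).mul_right _)
      rw [hcop] at h4
      have : ((4 : ℤ) : Z8) = 2 ^ 2 := by push_cast; norm_num
      rw [this] at h4
      exact hq2 (hq.dvd_of_dvd_pow h4)
    · exact hq.not_isUnit (hτcop.isUnit_of_dvd' p1 p2)
  obtain ⟨a1, a2, a3, a4⟩ := hpar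
  rw [hL] at a1 a2 a3 a4
  obtain ⟨k, hk, hvk⟩ := eq_varpi_cube_mul a1 a2 a3 a4
  rcases eq_unit_or_unit_mul hd hd0 varpi_prime hprimes with hu | ⟨u, hu, rfl⟩
  · have hh : varpi ^ 3 * k = d * t ^ 2 := by rw [← hk, hdt]
    have c1 : varpi ∣ d * t ^ 2 := hh ▸ ⟨varpi ^ 2 * k, by ring⟩
    have c2 : ∀ s, varpi ∣ d * s ^ 2 → varpi ∣ s := fun s hs =>
      varpi_prime.dvd_of_dvd_pow ((varpi_prime.dvd_or_dvd hs).resolve_left fun h4 =>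
        varpi_prime.not_isUnit (isUnit_of_dvd_unit h4 hu))
    obtain ⟨t1, rfl⟩ := c2 t c1
    have hh2 : varpi * k = d * t1 ^ 2 := by
      apply mul_left_cancel₀ (pow_ne_zero 2 varpi_prime.ne_zero)
      linear_combination hh
    obtain ⟨t2, rfl⟩ := c2 t1 (hh2 ▸ dvd_mul_right _ _)
    apply hvk
    refine ⟨d * t2 ^ 2, ?_⟩
    apply mul_left_cancel₀ varpi_prime.ne_zero
    linear_combination hh2
  · apply not_isSquare_203
    have hpi : phi varpi * phi (s3 varpi) = 203 := by
      simp only [phi_apply, varpi, s3_mk]; decide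
    have key : (2 * phi (s3 τ)) ^ 2 * (phi (ub * s3 W * Y₀) * phi (s3 (ua * W * X₀))) =
        203 * (phi u * phi (s3 u)) * (phi t * phi (s3 t)) ^ 2 := by
      have : phi L * phi (s3 L) = phi (varpi * u * t ^ 2) * phi (s3 (varpi * u * t ^ 2)) := by
        rw [hdt]
      rw [e1, e3] at this
      simp only [map_mul, map_pow] at this hpi ⊢
      linear_combination this + phi u * phi (s3 u) * phi t ^ 2 * phi (s3 t) ^ 2 * hpi
    have hne : phi t * phi (s3 t) ≠ 0 := by
      intro h4
      have : phi L * phi (s3 L) = 0 := by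
        rw [hdt]; simp only [map_mul, map_pow]
        linear_combination phi varpi * phi u * phi t * phi (s3 varpi) * phi (s3 u) *
          phi (s3 t) * h4
      exact mul_ne_zero n1 n3 this
    obtain ⟨r, hr⟩ := hsq
    have h203 : IsSquare (203 * (phi u * phi (s3 u))) := by
      refine ⟨2 * phi (s3 τ) * r / (phi t * phi (s3 t)), ?_⟩
      rw [hr] at key
      rw [div_mul_div_comm, eq_div_iff (mul_ne_zero hne hne)]
      linear_combination -key
    rcases phi_mul_phi_s3 hu with h4 | h4
    · simpa [h4] using h203
    · rw [h4] at h203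
      simpa using h203.mul isSquare_neg_one_241

theorem nrm_neg (x : Z8) : nrm (-x) = nrm x := by simp [nrm]; ring

theorem sq_emod_two (x : Z8) : (x ^ 2).a % 2 = (x.a + x.c) % 2 ∧ (x ^ 2).b % 2 = 0 ∧
    (x ^ 2).c % 2 = (x.b + x.d) % 2 ∧ (x ^ 2).d % 2 = 0 := by
  have key : ∀ t : ℤ, t ^ 2 % 2 = t % 2 := fun t => by
    rcases Int.emod_two_eq_zero_or_one t with h | h <;> simp [pow_two, Int.mul_emod, h]
  have ka := key x.a
  have kb := key x.b
  have kc := key x.c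
  have kd := key x.d
  have ea : (x ^ 2).a = x.a ^ 2 - x.c ^ 2 - 2 * (x.b * x.d) := by rw [pow_two, mul_a]; ring
  have eb : (x ^ 2).b = 2 * (x.a * x.b - x.c * x.d) := by rw [pow_two, mul_b]; ring
  have ec : (x ^ 2).c = x.b ^ 2 - x.d ^ 2 + 2 * (x.a * x.c) := by rw [pow_two, mul_c]; ring
  have ed : (x ^ 2).d = 2 * (x.a * x.d + x.b * x.c) := by rw [pow_two, mul_d]; ring
  omega

theorem tangent_impossible {ua ub uc X₀ Y₀ Z₀ τ : Z8} (hua : ua ∣ 2) (hub : ub ∣ 2)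
    (huc : uc ∣ 2)
    (h0 : ua * W * X₀ ^ 2 + ub * s3 W * Y₀ ^ 2 + uc * s7 W * Z₀ ^ 2 = 0)
    (h : ua * W * τ ^ 2 + ub * s3 W * (s3 τ) ^ 2 + uc * s7 W * (s7 τ) ^ 2 = 0)
    {m n : ℤ} (hcop : nrm X₀ * m + nrm Y₀ * n = 4)
    (hpar : let L := tangent (ua * W) (ub * s3 W) (uc * s7 W) X₀ Y₀ Z₀ τ
      L.a % 2 = 1 ∧ L.b % 2 = 1 ∧ L.c % 2 = 1 ∧ L.d % 2 = 1)
    (hx : phi (s3 (ua * W * X₀)) ≠ 0)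
    (hy : phi (ub * s3 W * Y₀) ≠ 0) (hy' : phi (s7 (ub * s3 W * Y₀)) ≠ 0)
    (hsq : IsSquare (phi (ub * s3 W * Y₀) * phi (s3 (ua * W * X₀))))
    (hrel : phi (s7 (ua * W * X₀)) * phi (ub * s3 W * Y₀) * phi (s3 (uc * s7 W * Z₀)) =
      phi (s7 (ub * s3 W * Y₀)) * phi (s3 (ua * W * X₀)) * phi (uc * s7 W * Z₀))
    (hz' : phi (s3 (uc * s7 W * Z₀)) ≠ 0)
    (hτcop : IsCoprime τ (s3 τ))
    (h3 : phi (s3 τ) ≠ 0) (h5 : phi (s5 τ) ≠ 0) : False := by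
  have hs1 : phi (ub * s3 W * Y₀ * s3 τ) = phi (uc * s7 W * Z₀ * s7 τ) ∨
      phi (ub * s3 W * Y₀ * s3 τ) = -phi (uc * s7 W * Z₀ * s7 τ) := by
    have i0 := congrArg phi h0
    have i1 := congrArg phi h
    simp only [map_add, map_mul, map_pow, phi_W, map_zero, mul_zero, zero_mul, zero_add] at i0 i1 ⊢
    rw [← sq_eq_sq_iff_eq_or_eq_neg]
    linear_combination phi ub * phi (s3 W) * phi (s3 τ) ^ 2 * i0 -
      phi uc * phi (s7 W) * phi Z₀ ^ 2 * i1
  have hs3 : phi (s3 (ua * W * X₀ * τ)) = phi (s3 (uc * s7 W * Z₀ * s7 τ)) ∨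
      phi (s3 (ua * W * X₀ * τ)) = -phi (s3 (uc * s7 W * Z₀ * s7 τ)) := by
    have i0 := congrArg (fun x => phi (s3 x)) h0
    have i1 := congrArg (fun x => phi (s3 x)) h
    simp only [map_add, map_mul, map_pow, s3_s3, phi_W, map_zero, mul_zero, zero_mul,
      add_zero] at i0 i1 ⊢
    rw [← sq_eq_sq_iff_eq_or_eq_neg]
    linear_combination phi (s3 ua) * phi (s3 W) * phi (s3 τ) ^ 2 * i0 -
      phi (s3 uc) * phi (s3 (s7 W)) * phi (s3 Z₀) ^ 2 * i1
  rcases hs1 with hs1 | hs1 <;> rcases hs3 with hs3 | hs3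
  · exact tangent_core hua hub huc h0 h hcop hpar hx hy hy' hsq hrel hz' hτcop h3 h5 hs1 hs3
  · refine tangent_core (X₀ := -X₀) hua hub huc (by rw [neg_sq]; exact h0) h
      (by rw [nrm_neg]; exact hcop) ?_ ?_ hy hy' ?_ ?_ hz' hτcop h3 h5 hs1 ?_
    · simp only [tangent, mul_neg, neg_mul, add_a, add_b, add_c, add_d, neg_a, neg_b, neg_c,
        neg_d] at hpar ⊢
      omega
    · simpa only [mul_neg, map_neg, neg_ne_zero] using hx
    · simpa only [mul_neg, map_neg, neg_mul, mul_one] using hsq.mul isSquare_neg_one_241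
    · simp only [mul_neg, map_neg, neg_mul]
      rw [hrel]
    · simp only [mul_neg, map_neg, neg_mul]
      rw [hs3, neg_neg]
  · refine tangent_core (Y₀ := -Y₀) hua hub huc (by rw [neg_sq]; exact h0) h
      (by rw [nrm_neg]; exact hcop) ?_ hx ?_ ?_ ?_ ?_ hz' hτcop h3 h5 ?_ hs3
    · simp only [tangent, mul_neg, neg_mul, add_a, add_b, add_c, add_d, neg_a, neg_b, neg_c,
        neg_d] at hpar ⊢
      omega
    · simpa only [mul_neg, map_neg, neg_ne_zero] using hy
    · simpa only [mul_neg, map_neg, neg_ne_zero] using hy'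
    · simpa only [mul_neg, map_neg, neg_mul, mul_one] using hsq.mul isSquare_neg_one_241
    · simp only [mul_neg, map_neg, neg_mul]
      rw [hrel]
    · simp only [mul_neg, map_neg, neg_mul]
      rw [hs1, neg_neg]
  · refine tangent_core (X₀ := -X₀) (Y₀ := -Y₀) hua hub huc (by rw [neg_sq, neg_sq]; exact h0) h
      (by rw [nrm_neg, nrm_neg]; exact hcop) ?_ ?_ ?_ ?_ ?_ ?_ hz' hτcop h3 h5 ?_ ?_
    · simp only [tangent, mul_neg, neg_mul, add_a, add_b, add_c, add_d, neg_a, neg_b, neg_c,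
        neg_d] at hpar ⊢
      omega
    · simpa only [mul_neg, map_neg, neg_ne_zero] using hx
    · simpa only [mul_neg, map_neg, neg_ne_zero] using hy
    · simpa only [mul_neg, map_neg, neg_ne_zero] using hy'
    · simpa only [mul_neg, map_neg, neg_mul, neg_neg] using hsq
    · simp only [mul_neg, map_neg, neg_mul, neg_neg]
      rw [hrel]
    · simp only [mul_neg, map_neg, neg_mul]
      rw [hs1, neg_neg]
    · simp only [mul_neg, map_neg, neg_mul]
      rw [hs3, neg_neg]

theorem not_neg_zeta {x y : ℤ} {τ : Z8}
    (h : (x : Z8) + ⟨0, -1, 0, 0⟩ * y = ⟨1, 0, 0, 0⟩ * W * τ ^ 2)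
    (hτ : (τ.a + τ.b + τ.c + τ.d) % 2 = 1) (hτcop : IsCoprime τ (s3 τ))
    (h3 : phi (s3 τ) ≠ 0) (h5 : phi (s5 τ) ≠ 0) : False := by
  have e3 := congrArg s3 h
  have e7 := congrArg s7 h
  simp only [map_add, map_mul, map_pow, map_intCast, s3_mk, s7_mk, neg_neg, neg_zero] at e3 e7
  refine tangent_impossible (τ := τ) (ua := ⟨0, 1, 2, 1⟩) (ub := ⟨-1, -1, -1, 0⟩)
    (uc := ⟨1, 0, -1, -1⟩) (X₀ := ⟨2, 0, -4, -2⟩) (Y₀ := ⟨-5, 0, -1, -2⟩) (Z₀ := ⟨4, 1, 2, 1⟩)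
    (m := -67) (n := 25)
    ⟨⟨0, 1, -2, 1⟩, by ext <;> simp⟩ ⟨⟨-2, 0, 2, -2⟩, by ext <;> simp⟩
    ⟨⟨2, -2, 2, 0⟩, by ext <;> simp⟩ (by decide) ?_ (by decide) ?_ (by decide) (by decide)
    (by decide) ⟨50, by decide⟩ (by decide) (by decide) hτcop h3 h5
  · have q1 : (⟨0, 1, 2, 1⟩ : Z8) = ⟨0, 1, 2, 1⟩ * ⟨1, 0, 0, 0⟩ := by decide
    have q2 : (⟨-1, -1, -1, 0⟩ : Z8) = ⟨-1, -1, -1, 0⟩ * ⟨1, 0, 0, 0⟩ := by decide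
    have q3 : (⟨1, 0, -1, -1⟩ : Z8) = ⟨1, 0, -1, -1⟩ * ⟨1, 0, 0, 0⟩ := by decide
    rw [q1, q2, q3]
    have r1 : (⟨0, 1, 2, 1⟩ + ⟨-1, -1, -1, 0⟩ + ⟨1, 0, -1, -1⟩ : Z8) = 0 := by decide
    have r2 : (⟨0, 1, 2, 1⟩ * ⟨0, -1, 0, 0⟩ + ⟨-1, -1, -1, 0⟩ * ⟨0, 0, 0, -1⟩ + ⟨1, 0, -1, -1⟩ * ⟨0, 0, 0, 1⟩ : Z8) = 0 := by
      decide
    linear_combination x * r1 + y * r2 - ⟨0, 1, 2, 1⟩ * h - ⟨-1, -1, -1, 0⟩ * e3 - ⟨1, 0, -1, -1⟩ * e7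
  · simp only [tangent, W]
    cases τ
    simp at hτ ⊢
    omega

theorem not_neg_zeta_cube {x y : ℤ} {τ : Z8}
    (h : (x : Z8) + ⟨0, 0, 0, -1⟩ * y = ⟨1, 0, 0, 0⟩ * W * τ ^ 2)
    (hτ : (τ.a + τ.b + τ.c + τ.d) % 2 = 1) (hτcop : IsCoprime τ (s3 τ))
    (h3 : phi (s3 τ) ≠ 0) (h5 : phi (s5 τ) ≠ 0) : False := by
  have e3 := congrArg s3 h
  have e7 := congrArg s7 h
  simp only [map_add, map_mul, map_pow, map_intCast, s3_mk, s7_mk, neg_neg, neg_zero] at e3 e7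
  refine tangent_impossible (τ := τ) (ua := ⟨0, 1, -2, 1⟩) (ub := ⟨-1, 0, 1, -1⟩)
    (uc := ⟨1, -1, 1, 0⟩) (X₀ := ⟨1, 3, 1, 3⟩) (Y₀ := ⟨5, -2, -1, 0⟩) (Z₀ := ⟨0, -1, 0, 3⟩)
    (m := -40) (n := 17)
    ⟨⟨0, 1, 2, 1⟩, by ext <;> simp⟩ ⟨⟨-2, -2, -2, 0⟩, by ext <;> simp⟩
    ⟨⟨2, 0, -2, -2⟩, by ext <;> simp⟩ (by decide) ?_ (by decide) ?_ (by decide) (by decide)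
    (by decide) ⟨68, by decide⟩ (by decide) (by decide) hτcop h3 h5
  · have q1 : (⟨0, 1, -2, 1⟩ : Z8) = ⟨0, 1, -2, 1⟩ * ⟨1, 0, 0, 0⟩ := by decide
    have q2 : (⟨-1, 0, 1, -1⟩ : Z8) = ⟨-1, 0, 1, -1⟩ * ⟨1, 0, 0, 0⟩ := by decide
    have q3 : (⟨1, -1, 1, 0⟩ : Z8) = ⟨1, -1, 1, 0⟩ * ⟨1, 0, 0, 0⟩ := by decide
    rw [q1, q2, q3]
    have r1 : (⟨0, 1, -2, 1⟩ + ⟨-1, 0, 1, -1⟩ + ⟨1, -1, 1, 0⟩ : Z8) = 0 := by decide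
    have r2 : (⟨0, 1, -2, 1⟩ * ⟨0, 0, 0, -1⟩ + ⟨-1, 0, 1, -1⟩ * ⟨0, -1, 0, 0⟩ + ⟨1, -1, 1, 0⟩ * ⟨0, 1, 0, 0⟩ : Z8) = 0 := by
      decide
    linear_combination x * r1 + y * r2 - ⟨0, 1, -2, 1⟩ * h - ⟨-1, 0, 1, -1⟩ * e3 - ⟨1, -1, 1, 0⟩ * e7
  · simp only [tangent, W]
    cases τ
    simp at hτ ⊢
    omega

theorem not_g {x y : ℤ} {τ : Z8}
    (h : (x : Z8) + ⟨0, 1, -2, 1⟩ * y = ⟨1, 1, 0, -1⟩ * W * τ ^ 2)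
    (hτ : (τ.a + τ.b + τ.c + τ.d) % 2 = 1) (hτcop : IsCoprime τ (s3 τ))
    (h3 : phi (s3 τ) ≠ 0) (h5 : phi (s5 τ) ≠ 0) : False := by
  have e3 := congrArg s3 h
  have e7 := congrArg s7 h
  simp only [map_add, map_mul, map_pow, map_intCast, s3_mk, s7_mk, neg_neg, neg_zero] at e3 e7
  refine tangent_impossible (τ := τ) (ua := ⟨-12, 0, 12, 17⟩) (ub := ⟨1, 0, -1, -1⟩)
    (uc := ⟨17, 0, -17, -24⟩) (X₀ := ⟨0, 0, 2, 3⟩) (Y₀ := ⟨1, 1, 3, 0⟩) (Z₀ := ⟨4, 1, 0, 2⟩)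
    (m := -44) (n := 48)
    ⟨⟨24, -34, 24, 0⟩, by ext <;> simp⟩ ⟨⟨2, -2, 2, 0⟩, by ext <;> simp⟩
    ⟨⟨17, -24, 17, 0⟩, by ext <;> simp⟩ (by decide) ?_ (by decide) ?_ (by decide) (by decide)
    (by decide) ⟨17, by decide⟩ (by decide) (by decide) hτcop h3 h5
  · have q1 : (⟨-12, 0, 12, 17⟩ : Z8) = ⟨-5, 0, 5, 7⟩ * ⟨1, 1, 0, -1⟩ := by decide
    have q2 : (⟨1, 0, -1, -1⟩ : Z8) = ⟨-2, 0, 2, 3⟩ * ⟨1, -1, 0, 1⟩ := by decide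
    have q3 : (⟨17, 0, -17, -24⟩ : Z8) = ⟨7, 0, -7, -10⟩ * ⟨1, 1, 0, -1⟩ := by decide
    rw [q1, q2, q3]
    have r1 : (⟨-5, 0, 5, 7⟩ + ⟨-2, 0, 2, 3⟩ + ⟨7, 0, -7, -10⟩ : Z8) = 0 := by decide
    have r2 : (⟨-5, 0, 5, 7⟩ * ⟨0, 1, -2, 1⟩ + ⟨-2, 0, 2, 3⟩ * ⟨0, 1, 2, 1⟩ + ⟨7, 0, -7, -10⟩ * ⟨0, -1, 2, -1⟩ : Z8) = 0 := by
      decide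
    linear_combination x * r1 + y * r2 - ⟨-5, 0, 5, 7⟩ * h - ⟨-2, 0, 2, 3⟩ * e3 - ⟨7, 0, -7, -10⟩ * e7
  · have hp := sq_emod_two τ
    have hc := congrArg Z8.c h
    generalize τ ^ 2 = T at hp hc
    simp [W] at hc
    have hac : (τ.a + τ.c) % 2 = 1 := by omega
    clear hp hc
    simp only [tangent, W]
    cases τ
    simp at hτ hac ⊢
    omega

theorem not_g_conj {x y : ℤ} {τ : Z8}
    (h : (x : Z8) + ⟨0, 1, 2, 1⟩ * y = ⟨1, -1, 0, 1⟩ * W * τ ^ 2)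
    (hτ : (τ.a + τ.b + τ.c + τ.d) % 2 = 1) (hτcop : IsCoprime τ (s3 τ))
    (h3 : phi (s3 τ) ≠ 0) (h5 : phi (s5 τ) ≠ 0) : False := by
  have e3 := congrArg s3 h
  have e7 := congrArg s7 h
  simp only [map_add, map_mul, map_pow, map_intCast, s3_mk, s7_mk, neg_neg, neg_zero] at e3 e7
  refine tangent_impossible (τ := τ) (ua := ⟨-12, 17, -12, 0⟩) (ub := ⟨1, -1, 1, 0⟩)
    (uc := ⟨17, -24, 17, 0⟩) (X₀ := ⟨1, -2, -2, -4⟩) (Y₀ := ⟨4, -3, 1, 3⟩) (Z₀ := ⟨0, 0, 1, 2⟩)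
    (m := -104) (n := 332)
    ⟨⟨24, 0, -24, -34⟩, by ext <;> simp⟩ ⟨⟨2, 0, -2, -2⟩, by ext <;> simp⟩
    ⟨⟨17, 0, -17, -24⟩, by ext <;> simp⟩ (by decide) ?_ (by decide) ?_ (by decide) (by decide)
    (by decide) ⟨24, by decide⟩ (by decide) (by decide) hτcop h3 h5
  · have q1 : (⟨-12, 17, -12, 0⟩ : Z8) = ⟨-5, 7, -5, 0⟩ * ⟨1, -1, 0, 1⟩ := by decide
    have q2 : (⟨1, -1, 1, 0⟩ : Z8) = ⟨-2, 3, -2, 0⟩ * ⟨1, 1, 0, -1⟩ := by decide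
    have q3 : (⟨17, -24, 17, 0⟩ : Z8) = ⟨7, -10, 7, 0⟩ * ⟨1, -1, 0, 1⟩ := by decide
    rw [q1, q2, q3]
    have r1 : (⟨-5, 7, -5, 0⟩ + ⟨-2, 3, -2, 0⟩ + ⟨7, -10, 7, 0⟩ : Z8) = 0 := by decide
    have r2 : (⟨-5, 7, -5, 0⟩ * ⟨0, 1, 2, 1⟩ + ⟨-2, 3, -2, 0⟩ * ⟨0, 1, -2, 1⟩ + ⟨7, -10, 7, 0⟩ * ⟨0, -1, -2, -1⟩ : Z8) = 0 := by
      decide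
    linear_combination x * r1 + y * r2 - ⟨-5, 7, -5, 0⟩ * h - ⟨-2, 3, -2, 0⟩ * e3 - ⟨7, -10, 7, 0⟩ * e7
  · have hp := sq_emod_two τ
    have hc := congrArg Z8.c h
    generalize τ ^ 2 = T at hp hc
    simp [W] at hc
    have hac : (τ.a + τ.c) % 2 = 1 := by omega
    clear hp hc
    simp only [tangent, W]
    cases τ
    simp at hτ hac ⊢
    omega

theorem exists_sq_of_nrm_one {e f : ℤ} (h : e ^ 2 - 2 * f ^ 2 = 1) :
    ∃ s k : Z8, (k = 1 ∨ k = -1) ∧ (⟨e, f, 0, -f⟩ : Z8) = k * s ^ 2 := by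
  rcases lt_trichotomy e 0 with he | he | he
  · obtain ⟨e₁, f₁, h1, h2, -⟩ := exists_of_sq_sub_two_mul_sq (A := -e) (S := -f) (by omega)
      (by rw [neg_sq, neg_sq]; exact h)
    refine ⟨⟨e₁, f₁, 0, -f₁⟩, -1, Or.inr rfl, ?_⟩
    ext <;> simp [pow_two] <;> linarith
  · subst he; nlinarith [sq_nonneg f]
  · obtain ⟨e₁, f₁, h1, h2, -⟩ := exists_of_sq_sub_two_mul_sq he h
    refine ⟨⟨e₁, f₁, 0, -f₁⟩, 1, Or.inl rfl, ?_⟩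
    ext <;> simp [pow_two] <;> linarith

theorem eq_of_sum_sq_eq_one {p q r s : ℤ} (h : p ^ 2 + q ^ 2 + r ^ 2 + s ^ 2 = 1) :
    ∃ k : Z8, (⟨p, q, r, s⟩ : Z8) = k ^ 2 ∨ (⟨p, q, r, s⟩ : Z8) = ⟨0, 1, 0, 0⟩ * k ^ 2 := by
  have bd : ∀ t : ℤ, t ^ 2 ≤ 1 → t = -1 ∨ t = 0 ∨ t = 1 := fun t ht => by
    have h1 : -1 ≤ t := by nlinarith
    have h2 : t ≤ 1 := by nlinarith
    omega
  have hp := sq_nonneg p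
  have hq := sq_nonneg q
  have hr := sq_nonneg r
  have hs := sq_nonneg s
  rcases bd p (by linarith) with rfl | rfl | rfl <;> rcases bd q (by linarith) with rfl | rfl | rfl <;>
    rcases bd r (by linarith) with rfl | rfl | rfl <;>
    rcases bd s (by linarith) with rfl | rfl | rfl <;> norm_num at h
  · exact ⟨⟨0, 0, 1, 0⟩, Or.inl (by decide)⟩
  · exact ⟨⟨0, 0, 1, 0⟩, Or.inr (by decide)⟩
  · exact ⟨⟨0, 0, 0, 1⟩, Or.inl (by decide)⟩
  · exact ⟨⟨0, 0, 0, 1⟩, Or.inr (by decide)⟩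
  · exact ⟨⟨0, 1, 0, 0⟩, Or.inr (by decide)⟩
  · exact ⟨⟨0, 1, 0, 0⟩, Or.inl (by decide)⟩
  · exact ⟨1, Or.inr (by decide)⟩
  · exact ⟨1, Or.inl (by decide)⟩

theorem unit_eq {u : Z8} (hu : IsUnit u) : ∃ i s : Z8,
    (i = 1 ∨ i = ⟨0, 1, 0, 0⟩ ∨ i = ⟨1, 1, 0, -1⟩ ∨ i = ⟨1, 1, 1, 0⟩) ∧ u = i * s ^ 2 := by
  rw [isUnit_iff, nrm_eq_sub] at hu
  have hm := mul_s7 u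
  obtain ⟨A, hA⟩ : ∃ A, u.a ^ 2 + u.b ^ 2 + u.c ^ 2 + u.d ^ 2 = A := ⟨_, rfl⟩
  obtain ⟨S, hS⟩ : ∃ S, u.a * u.b + u.b * u.c + u.c * u.d - u.d * u.a = S := ⟨_, rfl⟩
  rw [hA, hS] at hm hu
  have hA0 : 0 < A := by
    have : 0 ≤ A := by rw [← hA]; positivity
    rcases this.lt_or_eq with h | h
    · exact h
    · subst h; nlinarith [sq_nonneg S]
  obtain ⟨e, f, rfl, rfl, hef⟩ := exists_of_sq_sub_two_mul_sq hA0 hu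
  have hv : (u * ⟨e, -f, 0, f⟩) * s7 (u * ⟨e, -f, 0, f⟩) = 1 := by
    have : (u * ⟨e, -f, 0, f⟩) * s7 (u * ⟨e, -f, 0, f⟩) = (u * s7 u) * ⟨e, -f, 0, f⟩ ^ 2 := by
      rw [map_mul, s7_mk]; simp; ring
    rw [this, hm]
    have h1 : (e ^ 2 - 2 * f ^ 2) ^ 2 = 1 := by rcases hef with h | h <;> rw [h] <;> norm_num
    ext
    · simp [pow_two]; linear_combination h1
    all_goals simp [pow_two]; try ring
  have hv' := congrArg Z8.a ((mul_s7 _).symm.trans hv)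
  obtain ⟨k, hk⟩ := eq_of_sum_sq_eq_one hv'
  have hk' : u * ⟨e, -f, 0, f⟩ = k ^ 2 ∨ u * ⟨e, -f, 0, f⟩ = ⟨0, 1, 0, 0⟩ * k ^ 2 := hk
  have hz : (-1 : Z8) = ⟨0, 0, 1, 0⟩ ^ 2 := by decide
  rcases hef with hef | hef
  · obtain ⟨s, j, hj, hs⟩ := exists_sq_of_nrm_one hef
    have h1 : u = (u * ⟨e, -f, 0, f⟩) * (j * s ^ 2) := by
      rw [← hs]
      have : (⟨e, -f, 0, f⟩ : Z8) * ⟨e, f, 0, -f⟩ = 1 := by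
        ext
        · simp; linear_combination hef
        all_goals simp; try ring
      rw [mul_assoc, this, mul_one]
    rcases hk' with hk | hk <;> rw [hk] at h1 <;> rcases hj with rfl | rfl
    · exact ⟨1, k * s, by simp, by rw [h1]; ring⟩
    · exact ⟨1, k * s * ⟨0, 0, 1, 0⟩, by simp, by rw [h1, hz]; ring⟩
    · exact ⟨_, k * s, Or.inr (Or.inl rfl), by rw [h1]; ring⟩
    · exact ⟨_, k * s * ⟨0, 0, 1, 0⟩, Or.inr (Or.inl rfl), by rw [h1, hz]; ring⟩
  · obtain ⟨s, j, hj, hs⟩ := exists_sq_of_nrm_one (e := 2 * f - e) (f := e - f)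
      (by linear_combination -hef)
    have h1 : u = (u * ⟨e, -f, 0, f⟩) * (j * s ^ 2) * (-⟨1, 1, 0, -1⟩) := by
      rw [← hs]
      have : (⟨e, -f, 0, f⟩ : Z8) * (⟨2 * f - e, e - f, 0, -(e - f)⟩ * -⟨1, 1, 0, -1⟩) = 1 := by
        ext
        · simp; linear_combination -hef
        all_goals simp; try ring
      rw [mul_assoc, mul_assoc, this, mul_one]
    have hε : (⟨1, 1, 1, 0⟩ : Z8) = ⟨0, 1, 0, 0⟩ * ⟨1, 1, 0, -1⟩ := by decide
    rcases hk' with hk | hk <;> rw [hk] at h1 <;> rcases hj with rfl | rfl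
    · exact ⟨_, k * s * ⟨0, 0, 1, 0⟩, Or.inr (Or.inr (Or.inl rfl)), by
        rw [h1]; linear_combination k ^ 2 * s ^ 2 * ⟨1, 1, 0, -1⟩ * hz⟩
    · exact ⟨_, k * s, Or.inr (Or.inr (Or.inl rfl)), by rw [h1]; ring⟩
    · exact ⟨_, k * s * ⟨0, 0, 1, 0⟩, Or.inr (Or.inr (Or.inr rfl)), by
        rw [h1, hε]
        linear_combination k ^ 2 * s ^ 2 * ⟨1, 1, 0, -1⟩ * ⟨0, 1, 0, 0⟩ * hz⟩
    · exact ⟨_, k * s, Or.inr (Or.inr (Or.inr rfl)), by rw [h1, hε]; ring⟩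

theorem isCoprime_two_of_odd {F : Z8} (h : nrm F % 2 = 1) : IsCoprime F 2 := by
  refine ⟨cof F, -((nrm F / 2 : ℤ) : Z8), ?_⟩
  have h1 : nrm F = 2 * (nrm F / 2) + 1 := by omega
  have h2 : (nrm F : Z8) = 2 * ((nrm F / 2 : ℤ) : Z8) + 1 := by
    conv_lhs => rw [h1]
    push_cast; ring
  rw [mul_comm, mul_cof, h2]; ring

theorem isCoprime_conj {x y : ℤ} {κ κ' : Z8} {n : ℕ} (hxy : IsCoprime x y)
    (hodd : nrm (x + κ * y) % 2 = 1) (hκ : κ' - κ ∣ 2 ^ n) :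
    IsCoprime ((x : Z8) + κ * y) ((x : Z8) + κ' * y) := by
  have h1 : IsCoprime ((x : Z8) + κ * y) y :=
    (hxy.map (Int.castRingHom Z8)).add_mul_right_left κ
  have h2 : IsCoprime ((x : Z8) + κ * y) (κ' - κ) :=
    ((isCoprime_two_of_odd hodd).pow_right (n := n)).of_isCoprime_of_dvd_right hκ
  have h3 := (h2.mul_right h1).mul_add_left_right 1
  convert h3 using 1
  ring

theorem nrm_odd_iff {x : Z8} : nrm x % 2 = 1 ↔ (x.a + x.b + x.c + x.d) % 2 = 1 := by
  have key : nrm x % 2 = (x.a + x.b + x.c + x.d) % 2 := by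
    have k : ∀ t : ℤ, t ^ 2 % 2 = t % 2 := fun t => by
      rcases Int.emod_two_eq_zero_or_one t with h | h <;> simp [pow_two, Int.mul_emod, h]
    have ha := k x.a
    have hb := k x.b
    have hc := k x.c
    have hd := k x.d
    have h1 := k (x.a ^ 2 + x.c ^ 2 - x.b ^ 2 - x.d ^ 2)
    unfold nrm
    omega
  rw [key]

theorem exists_factor {x y z : ℤ} {κ : Z8} (hxy : IsCoprime x y)
    (hN : nrm (x + κ * y) = 241 * z ^ 2) (hodd : nrm (x + κ * y) % 2 = 1)
    (n : ℕ) (hκ3 : s3 κ - κ ∣ 2 ^ n) (hκ5 : s5 κ - κ ∣ 2 ^ n) (hκ7 : s7 κ - κ ∣ 2 ^ n)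
    (hφ : phi (x + κ * y) = 0) :
    ∃ i τ : Z8, (i = 1 ∨ i = ⟨0, 1, 0, 0⟩ ∨ i = ⟨1, 1, 0, -1⟩ ∨ i = ⟨1, 1, 1, 0⟩) ∧
      (x : Z8) + κ * y = i * W * τ ^ 2 ∧ (τ.a + τ.b + τ.c + τ.d) % 2 = 1 ∧
      IsCoprime τ (s3 τ) ∧ phi (s3 τ) ≠ 0 ∧ phi (s5 τ) ≠ 0 := by
  have c3 := isCoprime_conj hxy hodd hκ3
  have c5 := isCoprime_conj hxy hodd hκ5
  have c7 := isCoprime_conj hxy hodd hκ7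
  have e3 : (x : Z8) + s3 κ * y = s3 (x + κ * y) := by simp
  have e5 : (x : Z8) + s5 κ * y = s5 (x + κ * y) := by simp
  have e7 : (x : Z8) + s7 κ * y = s7 (x + κ * y) := by simp
  rw [e3] at c3
  rw [e5] at c5
  rw [e7] at c7
  generalize (x : Z8) + κ * y = F at *
  obtain ⟨G, rfl⟩ := W_dvd_iff.mpr hφ
  have hG : nrm G = z ^ 2 := by
    have : nrm W = 241 := by decide
    rw [nrm_mul, this] at hN
    linarith
  have hcop : IsCoprime G (cof G) := by
    refine ((IsCoprime.mul_right ?_ ?_).mul_right ?_)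
    · exact (c3.of_isCoprime_of_dvd_left (dvd_mul_left G W)).of_isCoprime_of_dvd_right
        (map_dvd s3 (dvd_mul_left G W))
    · exact (c5.of_isCoprime_of_dvd_left (dvd_mul_left G W)).of_isCoprime_of_dvd_right
        (map_dvd s5 (dvd_mul_left G W))
    · exact (c7.of_isCoprime_of_dvd_left (dvd_mul_left G W)).of_isCoprime_of_dvd_right
        (map_dvd s7 (dvd_mul_left G W))
  obtain ⟨t, v, hv⟩ := exists_associated_pow_of_mul_eq_pow' hcop
    (c := (z : Z8)) (k := 2) (by rw [mul_cof, hG]; push_cast; rfl)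
  obtain ⟨i, s, hi, hs⟩ := unit_eq v.isUnit
  have hF : W * G = i * W * (t * s) ^ 2 := by rw [← hv, hs]; ring
  have hdvd : t * s ∣ W * G := hF ▸ (dvd_pow_self _ two_ne_zero).mul_left _
  have hc : IsCoprime (t * s) (s3 (t * s)) :=
    (c3.of_isCoprime_of_dvd_left hdvd).of_isCoprime_of_dvd_right (map_dvd s3 hdvd)
  refine ⟨i, t * s, hi, hF, ?_, hc, fun h => ?_, fun h => ?_⟩
  · rw [← nrm_odd_iff]
    obtain ⟨k, hk⟩ := hdvd
    rw [hk, nrm_mul] at hodd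
    rcases Int.emod_two_eq_zero_or_one (nrm (t * s)) with h | h
    · simp [Int.mul_emod, h] at hodd
    · exact h
  · exact W_prime.not_isUnit (c3.isUnit_of_dvd' (dvd_mul_right W G)
      ((W_dvd_iff.mpr h).trans (map_dvd s3 hdvd)))
  · exact W_prime.not_isUnit (c5.isUnit_of_dvd' (dvd_mul_right W G)
      ((W_dvd_iff.mpr h).trans (map_dvd s5 hdvd)))

theorem phi_conj_eq_zero {F : Z8} {z : ℤ} (h : nrm F = 241 * z ^ 2) :
    phi F = 0 ∨ phi (s3 F) = 0 ∨ phi (s5 F) = 0 ∨ phi (s7 F) = 0 := by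
  have h1 := congrArg phi (nrm_eq F)
  rw [h] at h1
  simp only [map_intCast, map_mul] at h1
  push_cast at h1
  rw [eq_zero_241, zero_mul] at h1
  have h2 := h1.symm
  simp only [mul_eq_zero] at h2
  tauto

theorem fourth_aux {x y z : ℤ} (hxy : IsCoprime x y) (hx : x % 2 = 1) (hy : y % 2 = 0)
    (h : x ^ 4 + y ^ 4 = 241 * z ^ 2) {κ : Z8} (hκ : κ = ⟨0, -1, 0, 0⟩ ∨ κ = ⟨0, 0, 0, -1⟩)
    (hφ : phi (x + κ * y) = 0) : False := by
  have hN : nrm (x + κ * y) = 241 * z ^ 2 := by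
    rw [← h]
    rcases hκ with rfl | rfl <;> simp [nrm] <;> ring
  have hodd : nrm (x + κ * y) % 2 = 1 := by
    rw [nrm_odd_iff]
    rcases hκ with rfl | rfl <;> simp <;> omega
  have hd : s3 κ - κ ∣ 2 ^ 1 ∧ s5 κ - κ ∣ 2 ^ 1 ∧ s7 κ - κ ∣ 2 ^ 1 := by
    rcases hκ with rfl | rfl
    · exact ⟨⟨⟨0, 1, 0, -1⟩, by decide⟩, ⟨⟨0, 0, 0, -1⟩, by decide⟩,
        ⟨⟨0, -1, 0, -1⟩, by decide⟩⟩
    · exact ⟨⟨⟨0, -1, 0, 1⟩, by decide⟩, ⟨⟨0, -1, 0, 0⟩, by decide⟩,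
        ⟨⟨0, -1, 0, -1⟩, by decide⟩⟩
  obtain ⟨i, τ, hi, hF, hτ, hc, h3, h5⟩ := exists_factor hxy hN hodd 1 hd.1 hd.2.1 hd.2.2 hφ
  have hi1 : i = 1 := by
    have hp := sq_emod_two τ
    have ha := congrArg Z8.a hF
    have hb := congrArg Z8.b hF
    have hc := congrArg Z8.c hF
    have hd := congrArg Z8.d hF
    generalize τ ^ 2 = T at *
    rcases hi with hi | rfl | rfl | rfl
    · exact hi
    all_goals
      exfalso
      rcases hκ with rfl | rfl
      all_goals
        simp [W] at ha hb hc hd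
        omega
  subst hi1
  rcases hκ with rfl | rfl
  · exact not_neg_zeta hF hτ hc h3 h5
  · exact not_neg_zeta_cube hF hτ hc h3 h5

theorem fourth_add_fourth_aux {x y z : ℤ} (hxy : IsCoprime x y) (hx : x % 2 = 1) (hy : y % 2 = 0)
    (h : x ^ 4 + y ^ 4 = 241 * z ^ 2) : False := by
  have hN : nrm (x + ⟨0, -1, 0, 0⟩ * y) = 241 * z ^ 2 := by
    rw [← h]; simp [nrm]; ring
  have e : ∀ κ κ' : Z8, κ' = -κ → (x : Z8) + κ' * ((-y : ℤ) : Z8) = x + κ * y := by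
    rintro κ _ rfl; push_cast; ring
  have h' : x ^ 4 + (-y) ^ 4 = 241 * z ^ 2 := by rw [← h]; ring
  rcases phi_conj_eq_zero hN with h1 | h1 | h1 | h1 <;>
    try simp only [map_add s3, map_mul s3, map_add s5, map_mul s5, map_add s7, map_mul s7,
      map_intCast, s3_mk, s5_mk, s7_mk, neg_zero, neg_neg] at h1
  · exact fourth_aux hxy hx hy h (Or.inl rfl) h1
  · exact fourth_aux hxy hx hy h (Or.inr rfl) h1
  · refine fourth_aux hxy.neg_right hx (by omega) h' (Or.inl rfl) ?_
    rw [e ⟨0, 1, 0, 0⟩ _ (by decide)]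
    exact h1
  · refine fourth_aux hxy.neg_right hx (by omega) h' (Or.inr rfl) ?_
    rw [e ⟨0, 0, 0, 1⟩ _ (by decide)]
    exact h1

end Z8

theorem fourth_add_fourth_ne {x y z : ℤ} (hxy : IsCoprime x y)
    (h : x ^ 4 + y ^ 4 = 241 * z ^ 2) : False := by
  have p4 : ∀ t : ℤ, t % 2 = 1 → t ^ 4 % 4 = 1 := fun t ht => by
    have : t % 4 = 1 ∨ t % 4 = 3 := by omega
    rcases this with h | h <;> simp [pow_succ, Int.mul_emod, h]
  have q2 : ∀ t : ℤ, t ^ 2 % 4 = 0 ∨ t ^ 2 % 4 = 1 := fun t => by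
    have : t % 4 = 0 ∨ t % 4 = 1 ∨ t % 4 = 2 ∨ t % 4 = 3 := by omega
    rcases this with h | h | h | h <;> simp [pow_succ, Int.mul_emod, h]
  rcases Int.emod_two_eq_zero_or_one x with hx | hx <;>
    rcases Int.emod_two_eq_zero_or_one y with hy | hy
  · have := hxy.isUnit_of_dvd' (Int.dvd_of_emod_eq_zero hx) (Int.dvd_of_emod_eq_zero hy)
    rw [Int.isUnit_iff] at this
    omega
  · exact Z8.fourth_add_fourth_aux hxy.symm hy hx (by rw [← h]; ring)
  · exact Z8.fourth_add_fourth_aux hxy hx hy h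
  · have h1 := p4 x hx
    have h2 := p4 y hy
    have h3 := q2 z
    omega

namespace Z8

theorem sq_b_add_d {x : Z8} (h : (x.b + x.d) % 2 = 0) : ((x ^ 2).b + (x ^ 2).d) % 4 = 0 := by
  obtain ⟨k, hk⟩ := Int.dvd_of_emod_eq_zero h
  have h1 : (x ^ 2).b + (x ^ 2).d = 4 * ((x.a + x.c) * k - x.c * x.d) := by
    have : x.b = 2 * k - x.d := by omega
    rw [pow_two, mul_b, mul_d, this]; ring
  omega

theorem quartic_aux {x y z : ℤ} (hxy : IsCoprime x y) (hx : x % 2 = 1)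
    (h : x ^ 4 + 12 * x ^ 2 * y ^ 2 + 4 * y ^ 4 = 241 * z ^ 2) {κ : Z8}
    (hκ : κ = ⟨0, 1, -2, 1⟩ ∨ κ = ⟨0, 1, 2, 1⟩)
    (hφ : phi (x + κ * y) = 0) : False := by
  have hN : nrm (x + κ * y) = 241 * z ^ 2 := by
    rw [← h]
    rcases hκ with rfl | rfl <;> simp [nrm] <;> ring
  have hodd : nrm (x + κ * y) % 2 = 1 := by
    rw [nrm_odd_iff]
    rcases hκ with rfl | rfl <;> simp <;> omega
  have hd : s3 κ - κ ∣ 2 ^ 3 ∧ s5 κ - κ ∣ 2 ^ 3 ∧ s7 κ - κ ∣ 2 ^ 3 := by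
    rcases hκ with rfl | rfl
    · exact ⟨⟨⟨0, 0, -2, 0⟩, by decide⟩, ⟨⟨0, 2, 0, 2⟩, by decide⟩,
        ⟨⟨0, -2, -4, -2⟩, by decide⟩⟩
    · exact ⟨⟨⟨0, 0, 2, 0⟩, by decide⟩, ⟨⟨0, 2, 0, 2⟩, by decide⟩,
        ⟨⟨0, -2, 4, -2⟩, by decide⟩⟩
  obtain ⟨i, τ, hi, hF, hτ, hc, h3, h5⟩ := exists_factor hxy hN hodd 3 hd.1 hd.2.1 hd.2.2 hφ
  have hi1 : i = ⟨1, 1, 0, -1⟩ := by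
    have hp := sq_emod_two τ
    have hq := @sq_b_add_d τ
    have ha := congrArg Z8.a hF
    have hb := congrArg Z8.b hF
    have hc := congrArg Z8.c hF
    have hd := congrArg Z8.d hF
    generalize τ ^ 2 = T at *
    rcases hi with rfl | rfl | rfl | rfl
    on_goal 3 => rfl
    all_goals
      exfalso
      rcases hκ with rfl | rfl
      all_goals
        simp [W] at ha hb hc hd
        omega
  subst hi1
  rcases hκ with rfl | rfl
  · exact not_g hF hτ hc h3 h5
  · have he : (⟨1, 1, 0, -1⟩ : Z8) = ⟨1, -1, 0, 1⟩ * ⟨0, 1, 1, 1⟩ ^ 2 := by decide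
    have hu : IsUnit (⟨0, 1, 1, 1⟩ : Z8) := isUnit_iff.mpr (by decide)
    have hu3 : IsUnit (⟨0, 1, -1, 1⟩ : Z8) := isUnit_iff.mpr (by decide)
    refine not_g_conj (τ := ⟨0, 1, 1, 1⟩ * τ) (hF.trans (by rw [he]; ring)) (by simp; omega) ?_
      ?_ ?_
    · rw [map_mul, s3_mk]
      exact (isCoprime_mul_unit_left_left hu _ _).mpr
        ((isCoprime_mul_unit_left_right hu3 _ _).mpr hc)
    · rw [map_mul, map_mul]
      exact mul_ne_zero (by decide) h3
    · rw [map_mul, map_mul]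
      exact mul_ne_zero (by decide) h5

end Z8

theorem quartic_add_ne {x y z : ℤ} (hxy : IsCoprime x y) (hx : x % 2 = 1)
    (h : x ^ 4 + 12 * x ^ 2 * y ^ 2 + 4 * y ^ 4 = 241 * z ^ 2) : False := by
  have hN : Z8.nrm (x + ⟨0, 1, -2, 1⟩ * y) = 241 * z ^ 2 := by
    rw [← h]; simp [Z8.nrm]; ring
  have e : ∀ κ κ' : Z8, κ' = -κ → (x : Z8) + κ' * ((-y : ℤ) : Z8) = x + κ * y := by
    rintro κ _ rfl; push_cast; ring
  have h' : x ^ 4 + 12 * x ^ 2 * (-y) ^ 2 + 4 * (-y) ^ 4 = 241 * z ^ 2 := by rw [← h]; ring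
  rcases Z8.phi_conj_eq_zero hN with h1 | h1 | h1 | h1 <;>
    try simp only [map_add Z8.s3, map_mul Z8.s3, map_add Z8.s5, map_mul Z8.s5, map_add Z8.s7,
      map_mul Z8.s7, map_intCast, Z8.s3_mk, Z8.s5_mk, Z8.s7_mk, neg_neg] at h1
  · exact Z8.quartic_aux hxy hx h (Or.inl rfl) h1
  · exact Z8.quartic_aux hxy hx h (Or.inr rfl) h1
  · refine Z8.quartic_aux hxy.neg_right hx h' (Or.inr rfl) ?_
    rw [e ⟨0, -1, -2, -1⟩ _ (by decide)]
    exact h1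
  · refine Z8.quartic_aux hxy.neg_right hx h' (Or.inl rfl) ?_
    rw [e ⟨0, -1, 2, -1⟩ _ (by decide)]
    exact h1

namespace Sqrt2

theorem norm_ne_zero {y : Zsqrtd 2} (hy : y ≠ 0) : y.norm ≠ 0 := by
  intro h
  rw [Zsqrtd.norm_def] at h
  have h1 : y.re = 0 := Z8.eq_zero_of_sq_eq_two_mul_sq (n := y.im) (by linarith)
  apply hy
  ext
  · exact h1
  · rw [h1] at h
    simpa using h

/-- The quotient `x / y`, each coordinate rounded to a nearest integer. -/
noncomputable def quo (x y : Zsqrtd 2) : Zsqrtd 2 :=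
  ⟨round (((x * star y).re : ℚ) / y.norm), round (((x * star y).im : ℚ) / y.norm)⟩

theorem two_mul_abs_sub_round_le {n : ℤ} (hn : n ≠ 0) (t : ℤ) :
    2 * |t - n * round ((t : ℚ) / n)| ≤ |n| := by
  have h1 := abs_sub_round ((t : ℚ) / n)
  have hn' : (n : ℚ) ≠ 0 := by exact_mod_cast hn
  have h2 : ((t - n * round ((t : ℚ) / n) : ℤ) : ℚ) = n * ((t : ℚ) / n - round ((t : ℚ) / n)) := by
    push_cast; field_simp
  have h3 : ((2 * |t - n * round ((t : ℚ) / n)| : ℤ) : ℚ) ≤ ((|n| : ℤ) : ℚ) := by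
    push_cast
    push_cast at h2
    rw [h2, abs_mul]
    have := abs_nonneg (n : ℚ)
    nlinarith
  exact_mod_cast h3

theorem norm_mod_lt (x : Zsqrtd 2) {y : Zsqrtd 2} (hy : y ≠ 0) :
    |(x - y * quo x y).norm| < |y.norm| := by
  have hn := norm_ne_zero hy
  have key : (x - y * quo x y) * star y = x * star y - (y.norm : Zsqrtd 2) * quo x y := by
    rw [Zsqrtd.norm_eq_mul_conj]; ring
  have h1 := two_mul_abs_sub_round_le hn (x * star y).re
  have h2 := two_mul_abs_sub_round_le hn (x * star y).im
  have h3 : |((x - y * quo x y) * star y).norm| < |y.norm| * |y.norm| := by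
    rw [key, Zsqrtd.norm_def]
    have e1 : (x * star y - (y.norm : Zsqrtd 2) * quo x y).re =
      (x * star y).re - y.norm * round (((x * star y).re : ℚ) / y.norm) := by
      simp [quo]
    have e2 : (x * star y - (y.norm : Zsqrtd 2) * quo x y).im =
      (x * star y).im - y.norm * round (((x * star y).im : ℚ) / y.norm) := by
      simp [quo]
    rw [e1, e2]
    generalize (x * star y).re - y.norm * round (((x * star y).re : ℚ) / y.norm) = p at h1
    generalize (x * star y).im - y.norm * round (((x * star y).im : ℚ) / y.norm) = q at h2
    have hpos : 0 < |y.norm| := abs_pos.mpr hn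
    have hp := abs_nonneg p
    have hq := abs_nonneg q
    have sp := abs_mul_abs_self p
    have sq := abs_mul_abs_self q
    rw [abs_lt]
    constructor <;> nlinarith
  rw [Zsqrtd.norm_mul, Zsqrtd.norm_conj, abs_mul] at h3
  exact lt_of_mul_lt_mul_right h3 (abs_nonneg _)

noncomputable instance : EuclideanDomain (Zsqrtd 2) :=
  { (inferInstance : CommRing (Zsqrtd 2)), (inferInstance : Nontrivial (Zsqrtd 2)) with
    quotient := quo
    remainder := fun x y => x - y * quo x y
    quotient_zero := by
      intro x
      simp [quo]
      rfl
    quotient_mul_add_remainder_eq := fun x y => by ring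
    r := fun x y => |x.norm|.toNat < |y.norm|.toNat
    r_wellFounded := (measure fun x : Zsqrtd 2 => |x.norm|.toNat).wf
    remainder_lt := fun x y hy => by
      have h1 := norm_mod_lt x hy
      have h2 := abs_nonneg (x - y * quo x y).norm
      omega
    mul_left_not_lt := fun x y hy => by
      have h1 : 0 < |y.norm| := abs_pos.mpr (norm_ne_zero hy)
      have h2 := abs_nonneg x.norm
      rw [Zsqrtd.norm_mul, abs_mul]
      have h3 : |x.norm| ≤ |x.norm| * |y.norm| := le_mul_of_one_le_right h2 h1
      omega }

theorem isUnit_iff {x : Zsqrtd 2} : IsUnit x ↔ x.norm = 1 ∨ x.norm = -1 := by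
  rw [← Zsqrtd.norm_eq_one_iff]; omega

theorem unit_eq {u : Zsqrtd 2} (hu : IsUnit u) : ∃ i s : Zsqrtd 2,
    (i = 1 ∨ i = -1 ∨ i = ⟨1, 1⟩ ∨ i = ⟨-1, -1⟩) ∧ u = i * s ^ 2 := by
  have key : ∀ v : Zsqrtd 2, v.norm = 1 → ∃ s, v = s ^ 2 ∨ v = -s ^ 2 := by
    intro v hv
    rw [Zsqrtd.norm_def] at hv
    rcases lt_trichotomy v.re 0 with he | he | he
    · obtain ⟨e, f, h1, h2, -⟩ := exists_of_sq_sub_two_mul_sq (A := -v.re) (S := -v.im)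
        (by omega) (by linarith)
      refine ⟨⟨e, f⟩, Or.inr ?_⟩
      ext <;> simp [pow_two] <;> linarith
    · rw [he] at hv; nlinarith [mul_self_nonneg v.im]
    · obtain ⟨e, f, h1, h2, -⟩ := exists_of_sq_sub_two_mul_sq (S := v.im) he (by linarith)
      refine ⟨⟨e, f⟩, Or.inl ?_⟩
      ext <;> simp [pow_two] <;> linarith
  rcases isUnit_iff.mp hu with h | h
  · obtain ⟨s, hs | hs⟩ := key u h
    · exact ⟨1, s, by simp, by rw [hs, one_mul]⟩
    · exact ⟨-1, s, by simp, by rw [hs]; ring⟩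
  · obtain ⟨s, hs⟩ := key (u * ⟨1, 1⟩) (by rw [Zsqrtd.norm_mul, h]; rfl)
    have e1 : (⟨1, 1⟩ : Zsqrtd 2) * ⟨-1, 1⟩ = 1 := by decide
    have e3 : (⟨-1, -1⟩ : Zsqrtd 2) = -⟨1, 1⟩ := by decide
    have h2 : u = u * ⟨1, 1⟩ * (⟨1, 1⟩ * ⟨-1, 1⟩ ^ 2) := by
      linear_combination -(u + u * ⟨1, 1⟩ * ⟨-1, 1⟩) * e1
    rcases hs with hs | hs <;> rw [hs] at h2
    · exact ⟨_, s * ⟨-1, 1⟩, Or.inr (Or.inr (Or.inl rfl)), by rw [h2]; ring⟩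
    · exact ⟨_, s * ⟨-1, 1⟩, Or.inr (Or.inr (Or.inr rfl)), by rw [h2, e3]; ring⟩

/-- Reduction modulo a prime above `241`, sending `√2` to `22`. -/
def phi : Zsqrtd 2 →+* ZMod 241 := Zsqrtd.lift ⟨22, by decide⟩

theorem phi_apply (x : Zsqrtd 2) : phi x = x.re + x.im * 22 := rfl

/-- A prime above `241`. -/
def w : Zsqrtd 2 := ⟨21, 10⟩

theorem phi_w : phi w = 0 := by rw [phi_apply]; decide

theorem w_dvd_iff {x : Zsqrtd 2} : w ∣ x ↔ phi x = 0 := by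
  constructor
  · rintro ⟨y, rfl⟩
    rw [map_mul, phi_w, zero_mul]
  · intro h
    have h1 : ((x.re + x.im * 22 : ℤ) : ZMod 241) = 0 := by
      push_cast; exact h
    obtain ⟨m, hm⟩ := (ZMod.intCast_zmod_eq_zero_iff_dvd _ 241).mp h1
    push_cast at hm
    refine ⟨⟨21 * m - 2 * x.im, x.im - 10 * m⟩, ?_⟩
    ext
    · simp [w]; linarith
    · simp [w]; linarith

theorem w_prime : Prime w := by
  refine ⟨fun h => by simpa [w] using congrArg Zsqrtd.re h, fun h => ?_, fun x y h => ?_⟩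
  · rw [isUnit_iff] at h; revert h; decide
  · rw [w_dvd_iff, map_mul, mul_eq_zero] at h
    simpa only [w_dvd_iff] using h

theorem w_dvd_of_dvd {q : Zsqrtd 2} (hq : ¬ IsUnit q) (h : q ∣ w) : w ∣ q := by
  obtain ⟨k, hk⟩ := h
  rcases w_prime.irreducible.isUnit_or_isUnit hk with h1 | h1
  · exact absurd h1 hq
  · obtain ⟨v, rfl⟩ := h1
    exact ⟨↑v⁻¹, by rw [hk, mul_assoc, Units.mul_inv, mul_one]⟩

/-- The square root of two. -/
def root : Zsqrtd 2 := ⟨0, 1⟩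

theorem root_dvd_iff {x : Zsqrtd 2} : root ∣ x ↔ x.re % 2 = 0 := by
  constructor
  · rintro ⟨y, rfl⟩
    simp [root]
  · intro h
    obtain ⟨m, hm⟩ := Int.dvd_of_emod_eq_zero h
    refine ⟨⟨x.im, m⟩, ?_⟩
    ext <;> simp [root, hm]

theorem root_prime : Prime root := by
  refine ⟨fun h => by simpa [root] using congrArg Zsqrtd.im h, fun h => ?_, fun x y h => ?_⟩
  · rw [isUnit_iff] at h; revert h; decide
  · simp only [root_dvd_iff, Zsqrtd.re_mul] at h ⊢
    by_contra! hc
    have hx : x.re % 2 = 1 := by omega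
    have hy : y.re % 2 = 1 := by omega
    have h1 := Int.mul_emod x.re y.re 2
    rw [hx, hy] at h1
    rw [mul_assoc] at h
    omega

theorem two_eq_root_sq : (2 : Zsqrtd 2) = root ^ 2 := by decide

theorem star_dvd_star {x y : Zsqrtd 2} (h : x ∣ y) : star x ∣ star y :=
  map_dvd (starRingEnd (Zsqrtd 2)) h

theorem phi_mul_phi_star (x : Zsqrtd 2) : phi x * phi (star x) = x.norm := by
  rw [← map_mul, ← Zsqrtd.norm_eq_mul_conj, map_intCast]

theorem isSquare_two_241 : IsSquare (2 : ZMod 241) := ⟨22, by decide⟩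

theorem tangent_core {ua ub X₀ Y₀ Z₀ τ σ : Zsqrtd 2} {s : ZMod 241} (hua : ua ∣ 2) (hub : ub ∣ 2)
    (h0 : ua * w * X₀ ^ 2 + ub * star w * Y₀ ^ 2 + 1 * Z₀ ^ 2 = 0)
    (h : ua * w * τ ^ 2 + ub * star w * (star τ) ^ 2 + 1 * σ ^ 2 = 0)
    {m n : ℤ} (hcop : X₀.norm * m + Y₀.norm * n = 1)
    (hτ : IsCoprime τ (star τ)) (hZ : phi Z₀ ≠ 0) (hZ' : phi (star Z₀) ≠ 0)
    (hσ : phi σ ≠ 0) (hσ' : phi (star σ) ≠ 0)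
    (hrel : phi σ = s * phi (star σ)) (hs : ¬ IsSquare (phi Z₀ * phi (star Z₀) * s))
    (hs1 : phi (ub * star w * Y₀ * star τ) = phi (1 * Z₀ * σ))
    (hs2 : phi (star (ua * w * X₀ * τ)) = phi (star (1 * Z₀ * σ))) : False := by
  have e1 : phi (ua * w * X₀ * τ + ub * star w * Y₀ * star τ + 1 * Z₀ * σ) =
      2 * phi Z₀ * phi σ := by
    have : phi (ua * w * X₀ * τ) = 0 := by simp [phi_w]
    rw [map_add, map_add, this, hs1, one_mul, map_mul]; ring
  have e2 : phi (star (ua * w * X₀ * τ + ub * star w * Y₀ * star τ + 1 * Z₀ * σ)) =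
      2 * phi (star Z₀) * phi (star σ) := by
    have : phi (star (ub * star w * Y₀ * star τ)) = 0 := by simp [phi_w]
    rw [star_add, star_add, map_add, map_add, this, hs2, one_mul, star_mul', map_mul]; ring
  generalize hL : ua * w * X₀ * τ + ub * star w * Y₀ * star τ + 1 * Z₀ * σ = L at e1 e2
  have n1 : phi L ≠ 0 := by
    rw [e1]; exact mul_ne_zero (mul_ne_zero Z8.two_ne_zero_241 hZ) hσ
  have n2 : phi (star L) ≠ 0 := by
    rw [e2]; exact mul_ne_zero (mul_ne_zero Z8.two_ne_zero_241 hZ') hσ'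
  have hL0 : L ≠ 0 := fun h => n1 (by rw [h, map_zero])
  obtain ⟨d, t, hd, hdt⟩ := exists_squarefree_mul_sq hL0
  have hd0 : d ≠ 0 := fun h => hL0 (by rw [hdt, h, zero_mul])
  have ht0 : t ≠ 0 := by rintro rfl; exact hL0 (by rw [hdt]; ring)
  have hprimes : ∀ q, Prime q → q ∣ d → root ∣ q := by
    intro q hq hqd
    have hqL : q ∣ L := hdt ▸ hqd.mul_right _
    by_contra hnd
    have hq2 : ¬ q ∣ 2 := by
      intro h2
      rw [two_eq_root_sq] at h2
      obtain ⟨k, hk⟩ := hq.dvd_of_dvd_pow h2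
      rcases root_prime.irreducible.isUnit_or_isUnit hk with h5 | h5
      · exact hq.not_isUnit h5
      · obtain ⟨v, rfl⟩ := h5
        exact hnd ⟨↑v⁻¹, by rw [hk, mul_assoc, Units.mul_inv, mul_one]⟩
    obtain ⟨e, rfl⟩ := hqd
    have he := not_dvd_of_squarefree hq hd
    refine tangent_even hq hq2 (fun h1 => ?_) (fun h1 => ?_)
      (fun h1 => hq.not_isUnit (isUnit_of_dvd_one h1)) h0 h
      (fun p1 p2 _ => ?_) (fun p1 p2 => ?_) he ht0 (hL.trans hdt)
    · have h3 := (hq.dvd_or_dvd h1).resolve_left fun h2 => hq2 (h2.trans hua)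
      exact n1 (w_dvd_iff.mp ((w_dvd_of_dvd hq.not_isUnit h3).trans hqL))
    · have h3 := (hq.dvd_or_dvd h1).resolve_left fun h2 => hq2 (h2.trans hub)
      have h4 : star q ∣ w := by simpa using star_dvd_star h3
      have h5 : ¬ IsUnit (star q) := fun h6 => hq.not_isUnit (by simpa using h6.star)
      exact n2 (w_dvd_iff.mp ((w_dvd_of_dvd h5 h4).trans (star_dvd_star hqL)))
    · have h4 : q ∣ ((X₀.norm * m + Y₀.norm * n : ℤ) : Zsqrtd 2) := by
        push_cast
        rw [Zsqrtd.norm_eq_mul_conj, Zsqrtd.norm_eq_mul_conj]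
        exact dvd_add ((p1.mul_right _).mul_right _) ((p2.mul_right _).mul_right _)
      rw [hcop, Int.cast_one] at h4
      exact hq.not_isUnit (isUnit_of_dvd_one h4)
    · exact hq.not_isUnit (hτ.isUnit_of_dvd' p1 p2)
  have hunit : ∀ u : Zsqrtd 2, IsUnit u → IsSquare (phi u * phi (star u)) := by
    intro u hu
    rw [phi_mul_phi_star]
    rcases isUnit_iff.mp hu with h1 | h1 <;> rw [h1]
    · exact ⟨1, by simp⟩
    · simpa using Z8.isSquare_neg_one_241
  have hdsq : IsSquare (phi d * phi (star d)) := by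
    rcases eq_unit_or_unit_mul hd hd0 root_prime hprimes with hu | ⟨u, hu, rfl⟩
    · exact hunit d hu
    · have h1 : phi (root * u) * phi (star (root * u)) = -1 * 2 * (phi u * phi (star u)) := by
        have : phi root * phi (star root) = -1 * 2 := by rw [phi_mul_phi_star]; decide
        rw [star_mul', map_mul, map_mul]
        linear_combination phi u * phi (star u) * this
      rw [h1]
      exact (Z8.isSquare_neg_one_241.mul isSquare_two_241).mul (hunit u hu)
  apply hs
  obtain ⟨r, hr⟩ := hdsq
  have key : phi L * phi (star L) = (r * (phi t * phi (star t))) ^ 2 := by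
    rw [hdt, star_mul', star_pow, map_mul, map_mul, map_pow, map_pow]
    linear_combination (phi t * phi (star t)) ^ 2 * hr
  rw [e1, e2, hrel] at key
  have h2 : 2 * phi (star σ) ≠ 0 := mul_ne_zero Z8.two_ne_zero_241 hσ'
  refine ⟨r * (phi t * phi (star t)) / (2 * phi (star σ)), ?_⟩
  rw [div_mul_div_comm, eq_div_iff (mul_ne_zero h2 h2)]
  linear_combination key

theorem tangent_impossible {ua ub X₀ Y₀ Z₀ τ σ : Zsqrtd 2} {s : ZMod 241}
    (hua : ua ∣ 2) (hub : ub ∣ 2)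
    (h0 : ua * w * X₀ ^ 2 + ub * star w * Y₀ ^ 2 + 1 * Z₀ ^ 2 = 0)
    (h : ua * w * τ ^ 2 + ub * star w * (star τ) ^ 2 + 1 * σ ^ 2 = 0)
    {m n : ℤ} (hcop : X₀.norm * m + Y₀.norm * n = 1)
    (hτ : IsCoprime τ (star τ)) (hZ : phi Z₀ ≠ 0) (hZ' : phi (star Z₀) ≠ 0)
    (hσ : phi σ ≠ 0) (hσ' : phi (star σ) ≠ 0)
    (hrel : phi σ ^ 2 = (s * phi (star σ)) ^ 2)
    (hs : ¬ IsSquare (phi Z₀ * phi (star Z₀) * s)) : False := by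
  have hs1 : phi (ub * star w * Y₀ * star τ) = phi (1 * Z₀ * σ) ∨
      phi (ub * star w * Y₀ * star τ) = -phi (1 * Z₀ * σ) := by
    have i0 := congrArg phi h0
    have i1 := congrArg phi h
    simp only [map_add, map_mul, map_pow, map_one, phi_w, map_zero, mul_zero, zero_mul,
      zero_add] at i0 i1 ⊢
    rw [← sq_eq_sq_iff_eq_or_eq_neg]
    linear_combination phi ub * phi (star w) * phi (star τ) ^ 2 * i0 - phi Z₀ ^ 2 * i1
  have hs2 : phi (star (ua * w * X₀ * τ)) = phi (star (1 * Z₀ * σ)) ∨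
      phi (star (ua * w * X₀ * τ)) = -phi (star (1 * Z₀ * σ)) := by
    have i0 := congrArg (fun x => phi (star x)) h0
    have i1 := congrArg (fun x => phi (star x)) h
    simp only [star_add, star_mul', star_pow, star_star, star_one, star_zero, map_add, map_mul,
      map_pow, map_one, phi_w, map_zero, mul_zero, zero_mul, add_zero] at i0 i1 ⊢
    rw [← sq_eq_sq_iff_eq_or_eq_neg]
    linear_combination phi (star ua) * phi (star w) * phi (star τ) ^ 2 * i0 -
      phi (star Z₀) ^ 2 * i1
  have hsn : ¬ IsSquare (phi Z₀ * phi (star Z₀) * -s) := fun h1 => hs (by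
    simpa only [mul_neg, neg_mul, mul_one, neg_neg] using h1.mul Z8.isSquare_neg_one_241)
  have main : ∀ X Y : Zsqrtd 2, X ^ 2 = X₀ ^ 2 → Y ^ 2 = Y₀ ^ 2 → X.norm = X₀.norm →
      Y.norm = Y₀.norm → phi (ub * star w * Y * star τ) = phi (1 * Z₀ * σ) →
      phi (star (ua * w * X * τ)) = phi (star (1 * Z₀ * σ)) → False := by
    intro X Y hX hY hXn hYn h1 h2
    rw [← hX, ← hY] at h0
    rw [← hXn, ← hYn] at hcop
    rcases sq_eq_sq_iff_eq_or_eq_neg.mp hrel with h3 | h3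
    · exact tangent_core hua hub h0 h hcop hτ hZ hZ' hσ hσ' h3 hs h1 h2
    · exact tangent_core hua hub h0 h hcop hτ hZ hZ' hσ hσ' (h3.trans (neg_mul _ _).symm) hsn h1 h2
  have hn : ∀ x : Zsqrtd 2, (-x).norm = x.norm := fun x => by simp [Zsqrtd.norm_def]
  have h1 : phi (ub * star w * -Y₀ * star τ) = -phi (ub * star w * Y₀ * star τ) := by simp
  have h2 : phi (star (ua * w * -X₀ * τ)) = -phi (star (ua * w * X₀ * τ)) := by simp
  rcases hs1 with hs1 | hs1 <;> rcases hs2 with hs2 | hs2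
  · exact main X₀ Y₀ rfl rfl rfl rfl hs1 hs2
  · exact main (-X₀) Y₀ (neg_sq _) rfl (hn _) rfl hs1 (by rw [h2, hs2, neg_neg])
  · exact main X₀ (-Y₀) rfl (neg_sq _) rfl (hn _) (by rw [h1, hs1, neg_neg]) hs2
  · exact main (-X₀) (-Y₀) (neg_sq _) (neg_sq _) (hn _) (hn _) (by rw [h1, hs1, neg_neg])
      (by rw [h2, hs2, neg_neg])

theorem isCoprime_conj {x y : ℤ} {κ κ' : Zsqrtd 2} {n : ℕ} (hxy : IsCoprime x y)
    (hodd : (x + κ * y : Zsqrtd 2).norm % 2 = 1) (hκ : κ' - κ ∣ 2 ^ n) :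
    IsCoprime ((x : Zsqrtd 2) + κ * y) ((x : Zsqrtd 2) + κ' * y) := by
  have h0 : IsCoprime ((x : Zsqrtd 2) + κ * y) 2 := by
    generalize (x : Zsqrtd 2) + κ * y = F at *
    refine ⟨star F, -((F.norm / 2 : ℤ) : Zsqrtd 2), ?_⟩
    have h1 : F.norm = 2 * (F.norm / 2) + 1 := by omega
    have h2 : (F.norm : Zsqrtd 2) = 2 * ((F.norm / 2 : ℤ) : Zsqrtd 2) + 1 := by
      conv_lhs => rw [h1]
      push_cast; ring
    rw [mul_comm, ← Zsqrtd.norm_eq_mul_conj, h2]; ring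
  have h1 : IsCoprime ((x : Zsqrtd 2) + κ * y) y :=
    (hxy.map (Int.castRingHom (Zsqrtd 2))).add_mul_right_left κ
  have h2 : IsCoprime ((x : Zsqrtd 2) + κ * y) (κ' - κ) :=
    (h0.pow_right (n := n)).of_isCoprime_of_dvd_right hκ
  have h3 := (h2.mul_right h1).mul_add_left_right 1
  have e : (x : Zsqrtd 2) + κ' * y = (x + κ * y) * 1 + (κ' - κ) * y := by ring
  rw [e]
  exact h3

theorem exists_unit_mul_sq {G K c : Zsqrtd 2} (h : IsCoprime G K) (hc : G * K = c ^ 2) :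
    ∃ i τ : Zsqrtd 2, (i = 1 ∨ i = -1 ∨ i = ⟨1, 1⟩ ∨ i = ⟨-1, -1⟩) ∧ G = i * τ ^ 2 := by
  obtain ⟨t, v, hv⟩ := exists_associated_pow_of_mul_eq_pow' h hc
  obtain ⟨i, s, hi, hs⟩ := unit_eq v.isUnit
  exact ⟨i, t * s, hi, by rw [← hv, hs]; ring⟩

theorem exists_factor {x y d : ℤ} {κ : Zsqrtd 2} (hxy : IsCoprime x y)
    (hN : (x + κ * y : Zsqrtd 2).norm * (x + -κ * y : Zsqrtd 2).norm = 241 * d ^ 2)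
    (hF : (x + κ * y : Zsqrtd 2).norm % 2 = 1) (hH : (x + -κ * y : Zsqrtd 2).norm % 2 = 1)
    (h1 : star κ - κ ∣ 2 ^ 2) (h2 : -κ - κ ∣ 2 ^ 2) (h3 : -star κ - κ ∣ 2 ^ 2)
    (hφ : phi (x + κ * y) = 0) :
    ∃ i τ j σ : Zsqrtd 2, (i = 1 ∨ i = -1 ∨ i = ⟨1, 1⟩ ∨ i = ⟨-1, -1⟩) ∧
      (j = 1 ∨ j = -1 ∨ j = ⟨1, 1⟩ ∨ j = ⟨-1, -1⟩) ∧
      x + κ * y = i * w * τ ^ 2 ∧ x + -κ * y = j * σ ^ 2 ∧ IsCoprime τ (star τ) ∧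
      phi σ ≠ 0 ∧ phi (star σ) ≠ 0 := by
  have c1 := isCoprime_conj hxy hF h1
  have c2 := isCoprime_conj hxy hF h2
  have c3 := isCoprime_conj hxy hF h3
  have c4 := isCoprime_conj (κ' := -star κ) hxy hH (by
    have := star_dvd_star h1
    simpa [add_comm, sub_eq_add_neg] using this)
  have e1 : (x : Zsqrtd 2) + star κ * y = star (x + κ * y) := by simp [mul_comm]
  have e2 : (x : Zsqrtd 2) + -star κ * y = star (x + -κ * y) := by simp [mul_comm]
  rw [e1] at c1
  rw [e2] at c3 c4
  generalize (x : Zsqrtd 2) + κ * y = F at *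
  generalize (x : Zsqrtd 2) + -κ * y = H at *
  obtain ⟨G, rfl⟩ := w_dvd_iff.mpr hφ
  have c5 : IsCoprime H (star (w * G)) := by
    have := (c3.map (starRingEnd (Zsqrtd 2))).symm
    rwa [starRingEnd_apply, starRingEnd_apply, star_star] at this
  have hN' : G * star G * (H * star H) = (d : Zsqrtd 2) ^ 2 := by
    have hw : w.norm = 241 := by decide
    rw [Zsqrtd.norm_mul, hw] at hN
    have : G.norm * H.norm = d ^ 2 := by linarith
    rw [← Zsqrtd.norm_eq_mul_conj, ← Zsqrtd.norm_eq_mul_conj]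
    exact_mod_cast this
  have hGF : G ∣ w * G := dvd_mul_left G w
  obtain ⟨i, τ, hi, hτ⟩ := exists_unit_mul_sq (G := G) (K := star G * (H * star H))
    (((c1.of_isCoprime_of_dvd_left hGF).of_isCoprime_of_dvd_right (star_dvd_star hGF)).mul_right
      ((c2.of_isCoprime_of_dvd_left hGF).mul_right (c3.of_isCoprime_of_dvd_left hGF)))
    (by rw [← hN']; ring)
  obtain ⟨j, σ, hj, hσ⟩ := exists_unit_mul_sq (G := H) (K := G * star G * star H)
    (((c2.symm.of_isCoprime_of_dvd_right hGF).mul_right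
      (c5.of_isCoprime_of_dvd_right (star_dvd_star hGF))).mul_right c4)
    (by rw [← hN']; ring)
  have hdvd : τ ∣ w * G := (hτ ▸ (dvd_pow_self τ two_ne_zero).mul_left i : τ ∣ G).trans hGF
  have hσH : σ ∣ H := hσ ▸ (dvd_pow_self σ two_ne_zero).mul_left j
  refine ⟨i, τ, j, σ, hi, hj, by rw [hτ]; ring, hσ,
    (c1.of_isCoprime_of_dvd_left hdvd).of_isCoprime_of_dvd_right (star_dvd_star hdvd),
    fun h => ?_, fun h => ?_⟩
  · exact w_prime.not_isUnit (c2.isUnit_of_dvd' (dvd_mul_right w G)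
      ((w_dvd_iff.mpr h).trans hσH))
  · exact w_prime.not_isUnit (c3.isUnit_of_dvd' (dvd_mul_right w G)
      ((w_dvd_iff.mpr h).trans (star_dvd_star hσH)))

theorem sq_emod {x : Zsqrtd 2} (h : (x ^ 2).re % 2 = 1) :
    (x ^ 2).re % 8 = 1 ∧ (x ^ 2).im % 4 = 0 ∨ (x ^ 2).re % 8 = 3 ∧ (x ^ 2).im % 4 = 2 := by
  have e1 : (x ^ 2).re = x.re * x.re + 2 * (x.im * x.im) := by simp [pow_two]; ring
  have e2 : (x ^ 2).im = 2 * (x.re * x.im) := by simp [pow_two]; ring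
  have ho : x.re % 2 = 1 := by
    rcases Int.emod_two_eq_zero_or_one x.re with h1 | h1
    · have := Int.mul_emod x.re x.re 2
      rw [h1] at this
      omega
    · exact h1
  obtain ⟨k, hk⟩ : ∃ k, x.re = 2 * k + 1 := ⟨x.re / 2, by omega⟩
  obtain ⟨l, hl⟩ := Int.even_mul_succ_self k
  have e3 : x.re * x.re = 8 * l + 1 := by rw [hk]; linear_combination 4 * hl
  rcases Int.even_or_odd' x.im with ⟨m, hm | hm⟩
  · left
    have e4 : x.im * x.im = 4 * (m * m) := by rw [hm]; ring
    have e5 : x.re * x.im = 2 * (x.re * m) := by rw [hm]; ring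
    omega
  · right
    obtain ⟨l', hl'⟩ := Int.even_mul_succ_self m
    have e4 : x.im * x.im = 8 * l' + 1 := by rw [hm]; linear_combination 4 * hl'
    have e5 : x.re * x.im = 2 * (2 * k * m + k + m) + 1 := by rw [hk, hm]; ring
    omega

theorem not_isSquare_first : ¬ IsSquare (phi ⟨9, -14⟩ * phi (star ⟨9, -14⟩) * 58) := by
  simp only [phi_apply, Zsqrtd.star_mk]
  rintro ⟨r, hr⟩
  revert r
  set_option maxRecDepth 100000 in decide

theorem not_isSquare_second : ¬ IsSquare (phi ⟨7, -12⟩ * phi (star ⟨7, -12⟩) * 112) := by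
  simp only [phi_apply, Zsqrtd.star_mk]
  rintro ⟨r, hr⟩
  revert r
  set_option maxRecDepth 100000 in decide

set_option maxHeartbeats 1600000 in
theorem eq_neg_of_factor {x y : ℤ} (hx : x % 2 = 1) {κ i j τ σ : Zsqrtd 2}
    (hκ : κ = ⟨-2, 1⟩ ∨ κ = ⟨-2, -1⟩) (hi : i = 1 ∨ i = -1 ∨ i = ⟨1, 1⟩ ∨ i = ⟨-1, -1⟩)
    (hj : j = 1 ∨ j = -1 ∨ j = ⟨1, 1⟩ ∨ j = ⟨-1, -1⟩) (h1 : x + κ * y = i * w * τ ^ 2)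
    (h2 : x + -κ * y = j * σ ^ 2) : ∃ e : Zsqrtd 2, (e = 1 ∨ e = -1) ∧ i = -e ∧ j = e := by
  have p1 : (w * τ ^ 2).re % 2 = 1 → (w * τ ^ 2).re % 8 = 5 ∧ (w * τ ^ 2).im % 4 = 2 ∨
      (w * τ ^ 2).re % 8 = 7 ∧ (w * τ ^ 2).im % 4 = 0 := by
    have p := @sq_emod τ
    simp only [w, Zsqrtd.re_mul, Zsqrtd.im_mul]
    omega
  have p2 := @sq_emod σ
  rw [mul_assoc] at h1
  have a1 := congrArg Zsqrtd.re h1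
  have a2 := congrArg Zsqrtd.im h1
  have a3 := congrArg Zsqrtd.re h2
  have a4 := congrArg Zsqrtd.im h2
  clear h1 h2
  generalize w * τ ^ 2 = T at *
  generalize σ ^ 2 = S at *
  rcases hi with rfl | rfl | rfl | rfl <;> rcases hj with rfl | rfl | rfl | rfl
  on_goal 2 => exact ⟨-1, Or.inr rfl, by simp, rfl⟩
  on_goal 4 => exact ⟨1, Or.inl rfl, rfl, rfl⟩
  all_goals
    exfalso
    rcases hκ with rfl | rfl
    all_goals
      simp at a1 a2 a3 a4
      have o1 : T.re % 2 = 1 := by clear p1 p2 a2 a3 a4; omega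
      have o2 : S.re % 2 = 1 := by clear p1 p2 a1 a2 a4; omega
      rcases p1 o1 with p1 | p1 <;> rcases p2 o2 with p2 | p2 <;> clear o1 o2 <;> omega

theorem quartic_aux {x y d : ℤ} (hxy : IsCoprime x y) (hx : x % 2 = 1)
    (h : x ^ 4 - 12 * x ^ 2 * y ^ 2 + 4 * y ^ 4 = 241 * d ^ 2) {κ : Zsqrtd 2}
    (hκ : κ = ⟨-2, 1⟩ ∨ κ = ⟨-2, -1⟩) (hφ : phi (x + κ * y) = 0) : False := by
  have hN : (x + κ * y : Zsqrtd 2).norm * (x + -κ * y : Zsqrtd 2).norm = 241 * d ^ 2 := by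
    rw [← h]
    rcases hκ with rfl | rfl <;> simp [Zsqrtd.norm_def] <;> ring
  have hx2 : x * x % 2 = 1 := by rw [Int.mul_emod, hx]; rfl
  have hF : (x + κ * y : Zsqrtd 2).norm % 2 = 1 := by
    have : (x + κ * y : Zsqrtd 2).norm = x * x + 2 * (y * y - 2 * (x * y)) := by
      rcases hκ with rfl | rfl <;> simp [Zsqrtd.norm_def] <;> ring
    omega
  have hH : (x + -κ * y : Zsqrtd 2).norm % 2 = 1 := by
    have : (x + -κ * y : Zsqrtd 2).norm = x * x + 2 * (y * y + 2 * (x * y)) := by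
      rcases hκ with rfl | rfl <;> simp [Zsqrtd.norm_def] <;> ring
    omega
  have hd : star κ - κ ∣ 2 ^ 2 ∧ -κ - κ ∣ 2 ^ 2 ∧ -star κ - κ ∣ 2 ^ 2 := by
    rcases hκ with rfl | rfl
    · exact ⟨⟨⟨0, -1⟩, by decide⟩, ⟨⟨2, 1⟩, by decide⟩, ⟨1, by decide⟩⟩
    · exact ⟨⟨⟨0, 1⟩, by decide⟩, ⟨⟨2, -1⟩, by decide⟩, ⟨1, by decide⟩⟩
  obtain ⟨i, τ, j, σ, hi, hj, h1, h2, hc, hσ, hσ'⟩ :=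
    exists_factor hxy hN hF hH hd.1 hd.2.1 hd.2.2 hφ
  have hij := eq_neg_of_factor hx hκ hi hj h1 h2
  obtain ⟨e, he, rfl, rfl⟩ := hij
  have he2 : j * j = 1 := by rcases he with rfl | rfl <;> simp
  have hs1 : w * τ ^ 2 = -j * (x + κ * y) := by rw [h1]; linear_combination -w * τ ^ 2 * he2
  have hs3 : σ ^ 2 = j * (x + -κ * y) := by rw [h2]; linear_combination -σ ^ 2 * he2
  have hs2 : star w * star τ ^ 2 = -j * (x + star κ * y) := by
    have := congrArg star hs1
    have hj : star j = j := by rcases he with rfl | rfl <;> simp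
    simpa [hj, mul_comm] using this
  have r1 : phi σ ^ 2 = phi j * (x + -phi κ * y) := by rw [← map_pow, hs3]; simp
  have r2 : phi (star σ) ^ 2 = phi j * (x + -phi (star κ) * y) := by
    have := congrArg (fun t => phi (star t)) hs3
    have hj : star j = j := by rcases he with rfl | rfl <;> simp
    simpa [hj, mul_comm] using this
  have r3 : (x : ZMod 241) + phi κ * y = 0 := by simpa using hφ
  rcases hκ with rfl | rfl
  · refine tangent_impossible (ua := ⟨0, 1⟩) (ub := ⟨1, -1⟩) (X₀ := ⟨7, -5⟩) (Y₀ := ⟨5, 1⟩)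
      (Z₀ := ⟨9, -14⟩) (s := 58) (m := -1) (n := 0) ⟨⟨0, 1⟩, by decide⟩ ⟨⟨-2, -2⟩, by decide⟩
      (by decide) ?_ (by decide) hc (by decide) (by decide) hσ hσ' ?_ not_isSquare_first
    · rw [mul_assoc, mul_assoc, hs1, hs2, hs3]
      have k1 : (⟨0, 1⟩ + ⟨1, -1⟩ : Zsqrtd 2) = 1 := by decide
      have k2 : (⟨0, 1⟩ * ⟨-2, 1⟩ + ⟨1, -1⟩ * star ⟨-2, 1⟩ : Zsqrtd 2) = -⟨-2, 1⟩ := by decide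
      linear_combination -j * x * k1 - j * y * k2
    · rw [mul_pow, r1, r2]
      have k1 : phi ⟨-2, 1⟩ = 20 := by decide
      have k2 : phi (star ⟨-2, 1⟩) = -24 := by decide
      rw [k1] at r3 ⊢
      rw [k2]
      linear_combination (-3363 : ZMod 241) * phi j * r3 - 56 * phi j * y * eq_zero_241
  · refine tangent_impossible (ua := ⟨0, -1⟩) (ub := ⟨1, 1⟩) (X₀ := ⟨3, -1⟩) (Y₀ := ⟨3, -3⟩)
      (Z₀ := ⟨7, -12⟩) (s := 112) (m := 4) (n := 3) ⟨⟨0, -1⟩, by decide⟩ ⟨⟨-2, 2⟩, by decide⟩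
      (by decide) ?_ (by decide) hc (by decide) (by decide) hσ hσ' ?_ not_isSquare_second
    · rw [mul_assoc, mul_assoc, hs1, hs2, hs3]
      have k1 : (⟨0, -1⟩ + ⟨1, 1⟩ : Zsqrtd 2) = 1 := by decide
      have k2 : (⟨0, -1⟩ * ⟨-2, -1⟩ + ⟨1, 1⟩ * star ⟨-2, -1⟩ : Zsqrtd 2) = -⟨-2, -1⟩ := by decide
      linear_combination -j * x * k1 - j * y * k2
    · rw [mul_pow, r1, r2]
      have k1 : phi ⟨-2, -1⟩ = -24 := by decide
      have k2 : phi (star ⟨-2, -1⟩) = 20 := by decide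
      rw [k1] at r3 ⊢
      rw [k2]
      linear_combination (-12543 : ZMod 241) * phi j * r3 - 208 * phi j * y * eq_zero_241

end Sqrt2

theorem quartic_sub_ne {x y d : ℤ} (hxy : IsCoprime x y) (hx : x % 2 = 1)
    (h : x ^ 4 - 12 * x ^ 2 * y ^ 2 + 4 * y ^ 4 = 241 * d ^ 2) : False := by
  have h' : x ^ 4 - 12 * x ^ 2 * (-y) ^ 2 + 4 * (-y) ^ 4 = 241 * d ^ 2 := by rw [← h]; ring
  have e : ∀ a b y : ℤ, (x : ZMod 241) + (a + b * 22) * y =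
      Sqrt2.phi (x + ⟨a, b⟩ * y) := fun a b y => by simp [Sqrt2.phi_apply]; ring
  have hN : ((x : ZMod 241) + 20 * y) * (x - 20 * y) * ((x - 24 * y) * (x + 24 * y)) = 0 := by
    have h1 := congrArg (Int.cast : ℤ → ZMod 241) h
    push_cast at h1
    linear_combination h1 + (d ^ 2 - 4 * x ^ 2 * y ^ 2 + 956 * y ^ 4 : ZMod 241) * eq_zero_241
  simp only [mul_eq_zero] at hN
  rcases hN with (h1 | h1) | h1 | h1
  · refine Sqrt2.quartic_aux hxy hx h (Or.inl rfl) ?_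
    rw [← e]; push_cast; linear_combination h1
  · refine Sqrt2.quartic_aux hxy.neg_right hx h' (Or.inl rfl) ?_
    rw [← e]; push_cast; linear_combination h1
  · refine Sqrt2.quartic_aux hxy hx h (Or.inr rfl) ?_
    rw [← e]; push_cast; linear_combination h1
  · refine Sqrt2.quartic_aux hxy.neg_right hx h' (Or.inr rfl) ?_
    rw [← e]; push_cast; linear_combination h1

theorem exists_eq_sq_of_coprime {A B w : ℕ} (h : A.Coprime B) (hAB : A * B = w ^ 2) :
    ∃ a, A = a ^ 2 :=
  exists_eq_pow_of_mul_eq_pow (Nat.isUnit_iff.mpr h) hAB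

theorem exists_mul_sq_of_coprime {A B k w : ℕ} (hk : k ≠ 0) (h : A.Coprime B)
    (hAB : A * B = k * w ^ 2) :
    ∃ k₁ k₂ a b : ℕ, k₁ * k₂ = k ∧ A = k₁ * a ^ 2 ∧ B = k₂ * b ^ 2 ∧ a * b = w := by
  have hk' : k.gcd A * k.gcd B = k := by
    rw [← Nat.Coprime.gcd_mul k h, hAB, Nat.gcd_mul_right_right]
  obtain ⟨A', hA⟩ := Nat.gcd_dvd_right k A
  obtain ⟨B', hB⟩ := Nat.gcd_dvd_right k B
  have h1 : A' * B' = w ^ 2 := by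
    apply Nat.eq_of_mul_eq_mul_left (Nat.pos_of_ne_zero hk)
    rw [← hAB]
    conv_rhs => rw [hA, hB]
    conv_lhs => rw [← hk']
    ring
  have h2 : A'.Coprime B' :=
    (h.coprime_dvd_left (Dvd.intro_left _ hA.symm)).coprime_dvd_right (Dvd.intro_left _ hB.symm)
  obtain ⟨a, ha⟩ := exists_eq_sq_of_coprime h2 h1
  obtain ⟨b, hb⟩ := exists_eq_sq_of_coprime h2.symm (by rw [mul_comm]; exact h1)
  refine ⟨k.gcd A, k.gcd B, a, b, hk', ha ▸ hA, hb ▸ hB, ?_⟩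
  rw [ha, hb, ← mul_pow] at h1
  exact Nat.pow_left_injective two_ne_zero h1

/-- The difference of two coprime odd squares, factored. -/
theorem exists_half_sub {A C : ℕ} (hC : C % 2 = 1) (hA : A % 2 = 1) (h : C < A)
    (hAC : A.Coprime C) : ∃ t, 0 < t ∧ A = C + 2 * t ∧ t.Coprime (t + C) := by
  refine ⟨(A - C) / 2, by omega, by omega, ?_⟩
  obtain ⟨t, rfl⟩ : ∃ t, A = C + 2 * t := ⟨(A - C) / 2, by omega⟩
  have e : (C + 2 * t - C) / 2 = t := by omega
  rw [e]
  have h1 : (2 * t).Coprime C := by simpa using hAC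
  simpa using h1.coprime_dvd_left (Dvd.intro_left 2 rfl)

theorem exists_param {C t b : ℕ} (h : t.Coprime (t + C)) (hb : 2 * (t * (t + C)) = b ^ 2) :
    ∃ u v : ℤ, IsCoprime u v ∧ (C : ℤ) ^ 2 = (u ^ 2 - 2 * v ^ 2) ^ 2 ∧
      (C + 2 * t : ℤ) = u ^ 2 + 2 * v ^ 2 ∧ (b : ℤ) = 2 * (u * v) := by
  obtain ⟨β, rfl⟩ : ∃ β, b = 2 * β :=
    (Nat.prime_two.dvd_of_dvd_pow (hb ▸ Dvd.intro _ rfl : 2 ∣ b ^ 2))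
  have h1 : t * (t + C) = 2 * β ^ 2 := by
    have : 2 * (t * (t + C)) = 2 * (2 * β ^ 2) := by rw [hb]; ring
    omega
  obtain ⟨k₁, k₂, u, v, hk, hu, hv, huv⟩ := exists_mul_sq_of_coprime two_ne_zero h h1
  have huv' : IsCoprime (u : ℤ) v := by
    rw [Nat.isCoprime_iff_coprime]
    exact (h.coprime_dvd_left (hu ▸ (dvd_pow_self u two_ne_zero).mul_left k₁)).coprime_dvd_right
      (hv ▸ (dvd_pow_self v two_ne_zero).mul_left k₂)
  have hu' : (t : ℤ) = k₁ * u ^ 2 := by exact_mod_cast hu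
  have hv' : (t : ℤ) + C = k₂ * v ^ 2 := by exact_mod_cast hv
  have huv2 : (u : ℤ) * v = β := by exact_mod_cast huv
  have hC : (C : ℤ) = k₂ * v ^ 2 - k₁ * u ^ 2 := by linarith
  rcases (Nat.dvd_prime Nat.prime_two).mp (Dvd.intro k₂ hk) with rfl | rfl
  · obtain rfl : k₂ = 2 := by omega
    refine ⟨u, v, huv', ?_, ?_, ?_⟩
    · rw [hC]; push_cast; ring
    · rw [hu', hC]; push_cast; ring
    · push_cast; rw [huv2]
  · obtain rfl : k₂ = 1 := by omega
    refine ⟨v, u, huv'.symm, ?_, ?_, ?_⟩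
    · rw [hC]; push_cast; ring
    · rw [hu', hC]; push_cast; ring
    · push_cast; rw [mul_comm (v : ℤ), huv2]

theorem dvd_482 {k : ℕ} (h : k ∣ 482) : k = 1 ∨ k = 2 ∨ k = 241 ∨ k = 482 := by
  obtain ⟨i, j, hi, hj, rfl⟩ := Nat.dvd_mul.mp (show k ∣ 2 * 241 from h)
  rcases (Nat.dvd_prime Nat.prime_two).mp hi with rfl | rfl <;>
    rcases (Nat.dvd_prime (by norm_num)).mp hj with rfl | rfl <;> simp

theorem factors_482 {i j k l : ℕ} (h : i * (j * (k * l)) = 482) (hj : j % 2 = 1)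
    (hk : k % 2 = 1) (hl : l % 2 = 1) :
    i = 482 ∧ j = 1 ∧ k = 1 ∧ l = 1 ∨ i = 2 ∧ j = 241 ∧ k = 1 ∧ l = 1 ∨
      i = 2 ∧ j = 1 ∧ k = 241 ∧ l = 1 ∨ i = 2 ∧ j = 1 ∧ k = 1 ∧ l = 241 := by
  have d2 := dvd_482 (Dvd.intro (i * (k * l)) (by rw [← h]; ring) : j ∣ 482)
  have d3 := dvd_482 (Dvd.intro (i * (j * l)) (by rw [← h]; ring) : k ∣ 482)
  have d4 := dvd_482 (Dvd.intro (i * (j * k)) (by rw [← h]; ring) : l ∣ 482)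
  replace d2 : j = 1 ∨ j = 241 := by omega
  replace d3 : k = 1 ∨ k = 241 := by omega
  replace d4 : l = 1 ∨ l = 241 := by omega
  rcases d2 with rfl | rfl <;> rcases d3 with rfl | rfl <;> rcases d4 with rfl | rfl <;> omega

theorem sq_emod_four {a : ℕ} (h : a % 2 = 1) : a ^ 2 % 4 = 1 := by
  have : a % 4 = 1 ∨ a % 4 = 3 := by omega
  rcases this with h | h <;> simp [pow_two, Nat.mul_mod, h]

theorem odd_of_sq_odd {k a : ℕ} (h : (k * a ^ 2) % 2 = 1) : a % 2 = 1 := by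
  rcases Nat.mod_two_eq_zero_or_one a with h1 | h1
  · simp [pow_two, Nat.mul_mod, h1] at h
  · exact h1

theorem odd_coeff_of_odd {k a : ℕ} (h : (k * a ^ 2) % 2 = 1) : k % 2 = 1 := by
  rcases Nat.mod_two_eq_zero_or_one k with h1 | h1
  · simp [Nat.mul_mod, h1] at h
  · exact h1

/-- The descent step through a primitive Pythagorean triple. -/
theorem exists_smaller {X Y a b : ℕ} (hX : 0 < X) (hY : 0 < Y) (ha : 0 < a) (h : X.Coprime Y)
    (hXY : X * Y = 241 * b ^ 2) (hs : X ^ 2 + Y ^ 2 = a ^ 2) :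
    ∃ n r w : ℕ, 0 < n ∧ 0 < r ∧ n + r < a ∧ n.Coprime r ∧
      (n + r) * n * r * (n + r + n) = 482 * w ^ 2 := by
  wlog hodd : X % 2 = 1 generalizing X Y
  · refine this hY hX h.symm (by rw [mul_comm]; exact hXY) (by rw [add_comm]; exact hs) ?_
    by_contra h1
    have := Nat.dvd_gcd (Nat.dvd_of_mod_eq_zero (by omega : X % 2 = 0))
      (Nat.dvd_of_mod_eq_zero (by omega : Y % 2 = 0))
    rw [h] at this
    omega
  have ht : PythagoreanTriple (X : ℤ) Y a := by
    have : ((X : ℤ) ^ 2 + Y ^ 2) = a ^ 2 := by exact_mod_cast hs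
    unfold PythagoreanTriple
    linarith
  obtain ⟨M, N, h1, h2, h3, h4, -, h6⟩ := ht.coprime_classification' (by simpa using h)
    (by omega) (by exact_mod_cast ha)
  have hMN : 0 < M * N := by
    have : (0 : ℤ) < Y := by exact_mod_cast hY
    linarith
  have hM : 0 < M := lt_of_le_of_ne h6 (by rintro rfl; simp at hMN)
  have hN : 0 < N := by
    by_contra! h7
    nlinarith
  have hNM : N < M := by
    by_contra! h7
    have : (0 : ℤ) < X := by exact_mod_cast hX
    nlinarith
  lift N to ℕ using hN.le
  obtain ⟨r, rfl⟩ : ∃ r : ℕ, M = N + r := ⟨(M - N).toNat, by omega⟩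
  have e : 2 * ((N + r) * N * r * (N + r + N)) = 241 * b ^ 2 := by
    rw [← hXY]
    have : (2 * ((N + r) * N * r * (N + r + N)) : ℤ) = X * Y := by rw [h1, h2]; ring
    exact_mod_cast this
  have hb : 2 ∣ b := by
    have h7 : 2 ∣ 241 * b ^ 2 := e ▸ Dvd.intro _ rfl
    exact Nat.prime_two.dvd_of_dvd_pow
      ((Nat.Coprime.dvd_mul_left (by norm_num : Nat.Coprime 2 241)).mp h7)
  obtain ⟨β, rfl⟩ := hb
  refine ⟨N, r, β, by omega, by omega, ?_, ?_, ?_⟩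
  · zify
    nlinarith
  · have : (N + r).Coprime N := by
      rw [← Nat.isCoprime_iff_coprime, Int.isCoprime_iff_gcd_eq_one]
      push_cast
      exact h4
    have h7 : r.Coprime N := by simpa using this
    exact h7.symm
  · have : 2 * ((N + r) * N * r * (N + r + N)) = 2 * (482 * β ^ 2) := by rw [e]; ring
    omega

set_option maxHeartbeats 1600000 in
theorem no_solution (m : ℕ) : ∀ n r w : ℕ, m = n + r → 0 < n → 0 < r → n.Coprime r →
    m * n * r * (m + n) = 482 * w ^ 2 → False := by
  induction m using Nat.strong_induction_on with
  | _ m ih =>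
  intro n r w hm hn hr hnr h
  have hmn : m.Coprime n := by rw [hm]; simpa using hnr.symm
  have hmr : m.Coprime r := by rw [hm]; simpa using hnr
  by_cases hpar : r % 2 = 0
  · have hno : n % 2 = 1 := by
      by_contra h1
      have := Nat.dvd_gcd (Nat.dvd_of_mod_eq_zero (by omega : n % 2 = 0))
        (Nat.dvd_of_mod_eq_zero hpar)
      rw [hnr] at this
      omega
    obtain ⟨r', rfl⟩ := Nat.dvd_of_mod_eq_zero hpar
    have hw : 2 ∣ w := by
      have h1 : 2 * (2 * (m * n * r' * (n + r'))) = 2 * (241 * w ^ 2) := by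
        rw [hm] at h ⊢
        linarith
      have h2 : 2 ∣ 241 * w ^ 2 := Dvd.intro _ (Nat.eq_of_mul_eq_mul_left two_pos h1)
      exact Nat.prime_two.dvd_of_dvd_pow
        ((Nat.Coprime.dvd_mul_left (by norm_num : Nat.Coprime 2 241)).mp h2)
    obtain ⟨w', rfl⟩ := hw
    refine ih (n + r') (by omega) r' n w' (by omega) (by omega) hn
      (hnr.coprime_dvd_right (Dvd.intro_left 2 rfl)).symm ?_
    have : 4 * ((n + r') * r' * n * (n + r' + r')) = 4 * (482 * w' ^ 2) := by
      rw [hm] at h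
      linarith
    omega
  · have hr1 : r % 2 = 1 := by omega
    have hrs : r.Coprime (m + n) := by
      have h1 : (2 * n).Coprime r :=
        Nat.Coprime.mul_left ((Nat.coprime_two_left).mpr (Nat.odd_iff.mpr hr1)) hnr
      have h2 : m + n = 2 * n + r := by omega
      rw [h2]
      simpa using h1.symm
    have hns : n.Coprime (m + n) := by simpa using hmn.symm
    have hms : m.Coprime (m + n) := by simpa using hmn
    obtain ⟨k₁, l₁, a, w₁, hk1, ha, h1, -⟩ := exists_mul_sq_of_coprime (k := 482)
      (by norm_num)
      (hmn.mul_right (hmr.mul_right hms)) (by rw [← h]; ring : m * (n * (r * (m + n))) = _)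
    have hl1 : l₁ ≠ 0 := by rintro rfl; omega
    obtain ⟨k₂, l₂, b, w₂, hk2, hb, h2, -⟩ := exists_mul_sq_of_coprime hl1
      (hnr.mul_right hns) h1
    have hl2 : l₂ ≠ 0 := by rintro rfl; omega
    obtain ⟨k₃, k₄, c, d, hk3, hc, hd, -⟩ := exists_mul_sq_of_coprime hl2 hrs h2
    subst hk3 hk2
    have hc1 : c % 2 = 1 := odd_of_sq_odd (hc ▸ hr1)
    have hd1 : d % 2 = 1 := odd_of_sq_odd (k := k₄) (by omega)
    have ok3 : k₃ % 2 = 1 := odd_coeff_of_odd (hc ▸ hr1)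
    have ok4 : k₄ % 2 = 1 := odd_coeff_of_odd (a := d) (by omega)
    have hc4 := sq_emod_four hc1
    have hd4 := sq_emod_four hd1
    have cop : ∀ {A B C D k l : ℕ}, A.Coprime B → A = k * C ^ 2 → B = l * D ^ 2 →
        C.Coprime D := fun h h1 h2 =>
      (h.coprime_dvd_left (h1 ▸ (dvd_pow_self _ two_ne_zero).mul_left _)).coprime_dvd_right
        (h2 ▸ (dvd_pow_self _ two_ne_zero).mul_left _)
    have hdc := cop hrs.symm hd hc
    have hac := cop hmr ha hc
    have hda := cop hms.symm hd ha
    by_cases hno : n % 2 = 1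
    · have hb4 := sq_emod_four (odd_of_sq_odd (hb ▸ hno))
      have ok2 := odd_coeff_of_odd (hb ▸ hno)
      clear h h1 h2
      rcases factors_482 hk1 ok2 ok3 ok4 with ⟨rfl, rfl, rfl, rfl⟩ | ⟨rfl, rfl, rfl, rfl⟩ |
        ⟨rfl, rfl, rfl, rfl⟩ | ⟨rfl, rfl, rfl, rfl⟩ <;> omega
    · have hao : a % 2 = 1 := odd_of_sq_odd (k := k₁) (by omega)
      have ok1 : k₁ % 2 = 1 := odd_coeff_of_odd (a := a) (by omega)
      clear h h1 h2
      rcases factors_482 (by rw [← hk1]; ring : k₂ * (k₁ * (k₃ * k₄)) = 482) ok1 ok3 ok4 with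
        ⟨rfl, rfl, rfl, rfl⟩ | ⟨rfl, rfl, rfl, rfl⟩ | ⟨rfl, rfl, rfl, rfl⟩ | ⟨rfl, rfl, rfl, rfl⟩
      · obtain ⟨t, ht, rfl, htc⟩ := exists_half_sub hc1 hd1
          (lt_of_pow_lt_pow_left₀ 2 (by omega) (by omega)) hdc
        obtain ⟨n', r', w', hn', hr', hlt, hcop', he⟩ := exists_smaller (a := a) (b := b)
          (X := t) (Y := t + c) ht (by omega) (by omega) htc (by linarith) (by linarith)
        have : a ≤ m := by
          have := Nat.le_self_pow two_ne_zero a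
          omega
        exact ih (n' + r') (by omega) n' r' w' rfl hn' hr' hcop' he
      · obtain ⟨t, ht, rfl, htc⟩ := exists_half_sub hc1 hd1
          (lt_of_pow_lt_pow_left₀ 2 (by omega) (by omega)) hdc
        have hb2 : t * (t + c) = b ^ 2 := by linarith
        obtain ⟨x, hx⟩ := exists_eq_sq_of_coprime htc hb2
        obtain ⟨y, hy⟩ := exists_eq_sq_of_coprime htc.symm (by rw [mul_comm]; exact hb2)
        refine fourth_add_fourth_ne (x := x) (y := y) (z := a) ?_ ?_
        · rw [Nat.isCoprime_iff_coprime]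
          exact cop htc ((one_mul _).trans hx.symm).symm ((one_mul _).trans hy.symm).symm
        · have : t ^ 2 + (t + c) ^ 2 = 241 * a ^ 2 := by linarith
          rw [hy, hx] at this
          zify at this
          linarith
      · obtain ⟨t, ht, rfl, htc⟩ := exists_half_sub hao hd1
          (lt_of_pow_lt_pow_left₀ 2 (by omega) (by omega)) hda
        obtain ⟨u, v, huv, h3, h4, h5⟩ := exists_param (b := b) htc (by linarith)
        refine quartic_sub_ne (x := u) (y := v) (d := c) huv ?_ ?_
        · have : u ^ 2 % 2 = 1 := by omega
          rcases Int.emod_two_eq_zero_or_one u with h6 | h6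
          · simp [pow_two, Int.mul_emod, h6] at this
          · exact h6
        · have : (a : ℤ) ^ 2 - 2 * b ^ 2 = 241 * c ^ 2 := by
            have : a ^ 2 = 241 * c ^ 2 + 2 * b ^ 2 := by omega
            have : (a : ℤ) ^ 2 = 241 * c ^ 2 + 2 * b ^ 2 := by exact_mod_cast this
            linarith
          rw [h3, h5] at this
          linarith
      · obtain ⟨t, ht, rfl, htc⟩ := exists_half_sub hc1 hao
          (lt_of_pow_lt_pow_left₀ 2 (by omega) (by omega)) hac
        obtain ⟨u, v, huv, h3, h4, h5⟩ := exists_param (b := b) htc (by linarith)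
        refine quartic_add_ne (x := u) (y := v) (z := d) huv ?_ ?_
        · have : u ^ 2 % 2 = 1 := by omega
          rcases Int.emod_two_eq_zero_or_one u with h6 | h6
          · simp [pow_two, Int.mul_emod, h6] at this
          · exact h6
        · have : ((c : ℤ) + 2 * t) ^ 2 + 2 * b ^ 2 = 241 * d ^ 2 := by
            have : (c + 2 * t) ^ 2 + 2 * b ^ 2 = 241 * d ^ 2 := by omega
            exact_mod_cast this
          rw [h4, h5] at this
          linarith

theorem isInt_of_mul_sq {q : ℚ} {N : ℤ} (h : 482 * q ^ 2 = N) : ∃ w : ℤ, q = w := by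
  have hsq : Squarefree (482 : ℤ) := by
    rw [← Int.squarefree_natAbs]
    have : (482 : ℤ).natAbs = 2 * 241 := rfl
    rw [this, Nat.squarefree_mul (by norm_num)]
    exact ⟨Nat.prime_two.squarefree, (by norm_num : Nat.Prime 241).squarefree⟩
  have h1 : (482 * q.num ^ 2 : ℤ) = N * q.den ^ 2 := by
    have h2 : (q.den : ℚ) ≠ 0 := by exact_mod_cast q.den_nz
    rw [← Rat.num_div_den q] at h
    field_simp at h
    rw [mul_comm (N : ℤ)]
    exact_mod_cast h
  have hc : IsCoprime ((q.den : ℤ) ^ 2) (q.num ^ 2) :=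
    (Int.isCoprime_iff_gcd_eq_one.mpr (by simpa [Int.gcd] using q.reduced.symm)).pow
  have h3 : (q.den : ℤ) * q.den ∣ 482 := by
    rw [← pow_two]
    exact hc.dvd_of_dvd_mul_right (h1 ▸ Dvd.intro_left _ rfl)
  have h4 : q.den = 1 := by
    have := Int.isUnit_iff.mp (hsq _ h3)
    omega
  exact ⟨q.num, (Rat.den_eq_one_iff q).mp h4 |>.symm⟩

theorem no_int_solution {m n w : ℤ} (hmn : IsCoprime m n) (hn : 0 < n)
    (hw : w ≠ 0) (h : m * n * (m ^ 2 - n ^ 2) = 482 * w ^ 2) : False := by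
  have key : ∀ m n : ℤ, IsCoprime m n → 0 < n → n < m →
      m * n * (m ^ 2 - n ^ 2) = 482 * w ^ 2 → False := by
    intro m n hmn hn hlt h
    lift m to ℕ using by omega
    lift n to ℕ using hn.le
    obtain ⟨r, rfl⟩ : ∃ r, m = n + r := ⟨m - n, by omega⟩
    refine no_solution (n + r) n r w.natAbs rfl (by omega) (by omega) ?_ ?_
    · rw [Nat.isCoprime_iff_coprime] at hmn
      have : r.Coprime n := by simpa using hmn
      exact this.symm
    · zify
      rw [sq_abs, ← h]
      push_cast
      ring
  have hpos : 0 < m * n * (m ^ 2 - n ^ 2) := by rw [h]; positivity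
  rcases lt_trichotomy m 0 with h0 | rfl | h0
  · refine key n (-m) hmn.symm.neg_right (by omega) ?_ (by rw [← h]; ring)
    by_contra! h1
    have h2 : 0 ≤ m ^ 2 - n ^ 2 := by nlinarith
    nlinarith [mul_neg_of_neg_of_pos h0 hn]
  · simp at hpos
  · refine key m n hmn hn ?_ h
    by_contra! h1
    have h2 : m ^ 2 - n ^ 2 ≤ 0 := by nlinarith
    nlinarith [mul_pos h0 hn]

end RationalPointsE4

/-- Every rational point on the genus 1 curve `E₄ : 2y² = x(x + 241)(x + 482)` has `y = 0`;
i.e. the only rational points of `E₄` are its points of order at most 2. -/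
theorem rational_points_E4 (x y : ℚ) (h : 2 * y ^ 2 = x * (x + 241) * (x + 482)) : y = 0 := by
  by_contra hy
  obtain ⟨s, rfl⟩ : ∃ s : ℚ, x = 241 * s - 241 := ⟨(x + 241) / 241, by ring⟩
  have hd : (s.den : ℚ) ≠ 0 := by exact_mod_cast s.den_nz
  have e : 482 * (y * s.den ^ 2 / 241 ^ 2) ^ 2 =
      ((s.num * s.den * (s.num ^ 2 - s.den ^ 2) : ℤ) : ℚ) := by
    have h1 : (s.num : ℚ) = s * s.den := (Rat.mul_den_eq_num s).symm
    push_cast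
    rw [h1]
    field_simp
    linear_combination 241 * h
  obtain ⟨w, hw⟩ := RationalPointsE4.isInt_of_mul_sq e
  have hw0 : w ≠ 0 := by
    rintro rfl
    simp [hy] at hw
  rw [hw] at e
  refine RationalPointsE4.no_int_solution (m := s.num) (n := s.den) ?_ (by exact_mod_cast s.den_pos) hw0 ?_
  · exact Int.isCoprime_iff_gcd_eq_one.mpr s.reduced
  · exact_mod_cast e.symm
end

section
/- Every rational solution (x, y) ∈ ℚ × ℚ of the equation 2y² = (x + 482)(x + 241)(x − 482) satisfies y = 0; equivalently, the only rational points of the genus 1 curve E₆ : 2y² = (x + 482)(x + 241)(x − 482) are its points of order at most 2. -/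
instance fact_prime_two_hundred_forty_one : Fact (Nat.Prime 241) := ⟨by norm_num⟩

theorem prime_two_hundred_forty_one : Prime (241 : ℤ) := by
  have := Nat.prime_iff_prime_int.1 (Fact.out : Nat.Prime 241)
  exact_mod_cast this

theorem Int.exists_squarefree_mul_sq {z : ℤ} (hz : z ≠ 0) :
    ∃ s k : ℤ, Squarefree s ∧ k ≠ 0 ∧ z = s * k ^ 2 := by
  obtain ⟨a, b, hab, ha⟩ := Nat.sq_mul_squarefree z.natAbs
  have hb : b ≠ 0 := by
    rintro rfl
    apply hz
    simpa using hab.symm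
  have habz : ((b : ℤ) ^ 2 * a) = |z| := by
    rw [Int.abs_eq_natAbs, ← hab]
    push_cast
    ring
  have hasq : Squarefree (a : ℤ) := Int.squarefree_natCast.2 ha
  rcases abs_choice z with h | h
  · exact ⟨a, b, hasq, by exact_mod_cast hb, by rw [← h, ← habz]; ring⟩
  · refine ⟨-a, b, ?_, by exact_mod_cast hb, by linear_combination h + habz⟩
    rw [← Int.squarefree_natAbs] at hasq ⊢
    simpa using hasq

/-- The descent by the 2-isogeny with kernel generated by `(0, 0)`: a rational point on
`y² = x (x² + a x + b)` with `x ≠ 0` gives a point on a torsor `N² = s m⁴ + a m² g² + c g⁴`. -/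
theorem exists_two_isogeny_torsor {a b : ℤ} {x y : ℚ} (hx : x ≠ 0)
    (h : y ^ 2 = x * (x ^ 2 + a * x + b)) :
    ∃ s c m g N : ℤ, Squarefree s ∧ s * c = b ∧ IsCoprime m g ∧ m ≠ 0 ∧ g ≠ 0 ∧
      x = s * ((m : ℚ) / g) ^ 2 ∧ N ^ 2 = s * m ^ 4 + a * m ^ 2 * g ^ 2 + c * g ^ 4 := by
  have hd : (x.den : ℚ) ≠ 0 := by exact_mod_cast x.den_nz
  obtain ⟨s, k, hs, hk, hsk⟩ := Int.exists_squarefree_mul_sq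
    (mul_ne_zero (Rat.num_ne_zero.2 hx) (Int.natCast_ne_zero.2 x.den_nz))
  have hs0 : s ≠ 0 := hs.ne_zero
  obtain ⟨r, hr⟩ : ∃ r : ℚ, r = k / x.den := ⟨_, rfl⟩
  have hr0 : r ≠ 0 := by
    rw [hr]
    exact div_ne_zero (by exact_mod_cast hk) hd
  have hxr : x = s * r ^ 2 := by
    have h1 : (x.num : ℚ) * x.den = s * k ^ 2 := by exact_mod_cast hsk
    have h2 : x * x.den = x.num := Rat.mul_den_eq_num x
    rw [hr]
    field_simp
    rw [← h1, ← h2]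
    ring
  obtain ⟨m, hm⟩ : ∃ m : ℤ, m = r.num := ⟨_, rfl⟩
  obtain ⟨g, hg⟩ : ∃ g : ℤ, g = r.den := ⟨_, rfl⟩
  have hm0 : m ≠ 0 := by rw [hm]; exact Rat.num_ne_zero.2 hr0
  have hg0 : g ≠ 0 := by rw [hg]; exact_mod_cast r.den_nz
  have hgq : (g : ℚ) ≠ 0 := by exact_mod_cast hg0
  have hmq : (m : ℚ) ≠ 0 := by exact_mod_cast hm0
  have hcop : IsCoprime m g := by
    rw [Int.isCoprime_iff_nat_coprime, hm, hg]
    simpa using r.reduced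
  have hrmg : r = m / g := by
    rw [hm, hg]
    simpa using (Rat.num_div_den r).symm
  have hW : IsSquare (s * (s ^ 2 * m ^ 4 + a * s * m ^ 2 * g ^ 2 + b * g ^ 4)) := by
    rw [← Rat.isSquare_intCast_iff]
    refine ⟨y * g ^ 2 / r, ?_⟩
    have : y * g ^ 2 / r * (y * g ^ 2 / r) = y ^ 2 * g ^ 4 / r ^ 2 := by ring
    rw [this, h, hxr, hrmg]
    push_cast
    field_simp
  obtain ⟨W, hW⟩ := hW
  obtain ⟨N, rfl⟩ : s ∣ W := by
    rw [← hs.dvd_pow_iff_dvd two_ne_zero, sq, ← hW]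
    exact dvd_mul_right _ _
  have hN : s * N ^ 2 = s ^ 2 * m ^ 4 + a * s * m ^ 2 * g ^ 2 + b * g ^ 4 := by
    apply mul_left_cancel₀ hs0
    rw [hW]
    ring
  have hsg : IsCoprime s g := by
    refine isCoprime_of_prime_dvd (fun h0 => hg0 h0.2) fun q hq hqs hqg => ?_
    obtain ⟨t, rfl⟩ := hqs
    obtain ⟨u, rfl⟩ := hqg
    have hqt : ¬ q ∣ t := fun ⟨v, hv⟩ =>
      hq.not_isUnit (hs q ⟨v, by rw [hv]; ring⟩)
    have hqm : ¬ q ∣ m := fun hqm =>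
      hq.not_isUnit (hcop.isUnit_of_dvd' hqm (dvd_mul_right _ _))
    have hq0 : q ≠ 0 := hq.ne_zero
    have h1 : t * N ^ 2 =
        q * (t ^ 2 * m ^ 4 + a * q * t * m ^ 2 * u ^ 2 + b * q ^ 2 * u ^ 4) := by
      apply mul_left_cancel₀ hq0
      linear_combination hN
    have h2 : q ∣ N := by
      have : q ∣ t * N ^ 2 := ⟨_, h1⟩
      exact hq.dvd_of_dvd_pow ((hq.dvd_or_dvd this).resolve_left hqt)
    obtain ⟨v, rfl⟩ := h2
    have h3 : t ^ 2 * m ^ 4 =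
        q * (t * v ^ 2 - a * t * m ^ 2 * u ^ 2 - b * q * u ^ 4) := by
      apply mul_left_cancel₀ hq0
      linear_combination -h1
    rcases hq.dvd_or_dvd (Dvd.intro _ h3.symm) with h4 | h4
    · exact hqt (hq.dvd_of_dvd_pow h4)
    · exact hqm (hq.dvd_of_dvd_pow h4)
  obtain ⟨c, rfl⟩ : s ∣ b := by
    have : s ∣ b * g ^ 4 :=
      ⟨N ^ 2 - s * m ^ 4 - a * m ^ 2 * g ^ 2, by linear_combination -hN⟩
    exact (hsg.pow_right).dvd_of_dvd_mul_right this
  refine ⟨s, c, m, g, N, hs, rfl, hcop, hm0, hg0, by rw [← hrmg, hxr], ?_⟩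
  apply mul_left_cancel₀ hs0
  linear_combination hN

theorem eq_or_eq_neg_of_dvd_six {s : ℤ} (h : s ∣ 6) :
    s = 1 ∨ s = -1 ∨ s = 2 ∨ s = -2 ∨ s = 3 ∨ s = -3 ∨ s = 6 ∨ s = -6 := by
  have h2 : s.natAbs ∈ Nat.divisors 6 :=
    Nat.mem_divisors.2 ⟨Int.natAbs_dvd_natAbs.2 h, by norm_num⟩
  rw [show Nat.divisors 6 = {1, 2, 3, 6} by decide +kernel] at h2
  simp only [Finset.mem_insert, Finset.mem_singleton] at h2
  omega

/-- If `L L' = 2 D²` and the common factors of `L`, `2 L'`, `2 D` are supported on `2`, `3`, `241`,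
then `L` is a square modulo 241, since `-1`, `2` and `3` are. -/
theorem isSquare_zmod_of_mul_eq_two_mul_sq {L L' D : ℤ} (hL : (L : ZMod 241) ≠ 0)
    (h : L * L' = 2 * D ^ 2)
    (hdvd : ∀ s : ℤ, s ∣ L → s ∣ 2 * L' → s ∣ 2 * D → s ∣ 48 * 241) :
    IsSquare (L : ZMod 241) := by
  have hL0 : L ≠ 0 := by
    rintro rfl
    simp at hL
  obtain ⟨s, k, hs, hk, rfl⟩ := Int.exists_squarefree_mul_sq hL0
  have hs0 : s ≠ 0 := hs.ne_zero
  have h1 : s ∣ 2 * D := by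
    rw [← hs.dvd_pow_iff_dvd two_ne_zero]
    exact ⟨2 * k ^ 2 * L', by linear_combination -2 * h⟩
  have h2 : k ∣ 2 * D := by
    rw [← Int.pow_dvd_pow_iff two_ne_zero]
    exact ⟨2 * s * L', by linear_combination -2 * h⟩
  obtain ⟨t, ht⟩ := h2
  have h3 : 2 * s * L' = t ^ 2 := by
    apply mul_left_cancel₀ (pow_ne_zero 2 hk)
    linear_combination 2 * h + (2 * D + k * t) * ht
  have h4 : s ∣ t := by
    rw [← hs.dvd_pow_iff_dvd two_ne_zero]
    exact ⟨2 * L', by linear_combination -h3⟩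
  obtain ⟨u, rfl⟩ := h4
  have h5 : s ∣ 2 * L' := by
    refine ⟨u ^ 2, ?_⟩
    apply mul_left_cancel₀ hs0
    linear_combination h3
  have h6 := hdvd s (dvd_mul_right _ _) h5 h1
  have h7 : ¬ (241 : ℤ) ∣ s := by
    rintro ⟨v, rfl⟩
    apply hL
    have : ((241 : ℤ) : ZMod 241) = 0 := by decide
    push_cast at this ⊢
    rw [this]
    ring
  have h8 : IsCoprime s 241 := ((prime_two_hundred_forty_one.irreducible.coprime_iff_not_dvd).2 h7).symm
  have h9 : s ∣ 6 := by
    rw [← hs.dvd_pow_iff_dvd (n := 4) (by norm_num)]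
    exact (h8.dvd_of_dvd_mul_right h6).trans (by norm_num)
  have h10 : IsSquare (s : ZMod 241) := by
    rcases eq_or_eq_neg_of_dvd_six h9 with rfl | rfl | rfl | rfl | rfl | rfl | rfl | rfl <;>
      decide +kernel
  push_cast
  exact h10.mul (IsSquare.sq _)

theorem zmod_ne_zero_of_isCoprime {m e : ℤ} (h : IsCoprime m e) {c : ZMod 241}
    (hm : (m : ZMod 241) = c * e) : (e : ZMod 241) ≠ 0 := by
  intro he
  obtain ⟨u, v, huv⟩ := h
  have : ((u * m + v * e : ℤ) : ZMod 241) = 1 := by rw [huv]; simp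
  push_cast at this
  rw [hm, he] at this
  simp at this

theorem not_isSquare_mul_sq {c z : ZMod 241} (hz : z ≠ 0) (hc : ∀ x, c ≠ x * x) :
    ¬ IsSquare (c * z ^ 2) := by
  rintro ⟨w, hw⟩
  apply hc (w / z)
  field_simp
  linear_combination hw

/-- A torsor without rational points, although it has points everywhere locally: the tangent form
`21 Y - 20 Z - 241 N` of the conic `Y² - 2 Z² = 241 N²`, with `Y = m² - 4 e²` and `Z = m e`, would
have to be both a square and a non-square modulo 241. -/
theorem sq_sub_two_mul_sq_mul_ne {m e N : ℤ} (hcop : IsCoprime m e) :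
    241 * N ^ 2 ≠ (m ^ 2 - 2 * e ^ 2) * (m ^ 2 - 8 * e ^ 2) := by
  intro h
  have h0 : (241 : ZMod 241) = 0 := by decide
  have key : ∀ m : ℤ, IsCoprime m e →
      241 * N ^ 2 = (m ^ 2 - 2 * e ^ 2) * (m ^ 2 - 8 * e ^ 2) → ∀ c d : ZMod 241,
      (∀ x, d ≠ x * x) → 21 * (c ^ 2 - 4) - 20 * c = d → (m : ZMod 241) ≠ c * e := by
    intro m hcop h c d hd hcd hm
    have he := zmod_ne_zero_of_isCoprime hcop hm
    have hL : ((21 * (m ^ 2 - 4 * e ^ 2) - 20 * (m * e) - 241 * N : ℤ) : ZMod 241) =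
        d * (e : ZMod 241) ^ 2 := by
      push_cast
      rw [hm, ← hcd, h0]
      ring
    refine not_isSquare_mul_sq he hd (hL ▸ isSquare_zmod_of_mul_eq_two_mul_sq
      (L' := 21 * (m ^ 2 - 4 * e ^ 2) - 20 * (m * e) + 241 * N)
      (D := 21 * (m * e) - 10 * (m ^ 2 - 4 * e ^ 2)) ?_ ?_ ?_)
    · rw [hL]
      refine mul_ne_zero ?_ (pow_ne_zero 2 he)
      have := hd 0
      simpa using this
    · linear_combination (-241) * h
    · rintro s ⟨a, ha⟩ ⟨b, hb⟩ ⟨f, hf⟩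
      have h1 : s ∣ 4 * 241 * (m ^ 2 - 4 * e ^ 2) :=
        ⟨21 * (2 * a + b) + 40 * f, by linear_combination 42 * ha + 21 * hb + 40 * hf⟩
      have h2 : s ∣ 4 * 241 * (m * e) :=
        ⟨10 * (2 * a + b) + 42 * f, by linear_combination 20 * ha + 10 * hb + 42 * hf⟩
      have h3 : s ∣ 48 * 241 * m ^ 3 := by
        obtain ⟨w, hw⟩ := (h1.mul_left (12 * m)).add (h2.mul_left (48 * e))
        exact ⟨w, by linear_combination hw⟩
      have h4 : s ∣ 48 * 241 * e ^ 3 := by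
        obtain ⟨w, hw⟩ := (h2.mul_left (3 * m)).sub (h1.mul_left (3 * e))
        exact ⟨w, by linear_combination hw⟩
      obtain ⟨u, v, huv⟩ := (hcop.pow (m := 3) (n := 3))
      obtain ⟨w, hw⟩ := (h3.mul_left u).add (h4.mul_left v)
      exact ⟨w, by linear_combination hw - 48 * 241 * huv⟩
  have h5 : ((m : ZMod 241) - 219 * e) * (m - (-219) * e) *
      ((m - 438 * e) * (m - (-438) * e)) = 0 := by
    have := congrArg (Int.cast : ℤ → ZMod 241) h
    push_cast at this
    have h8 : (219 : ZMod 241) ^ 2 = 2 := by decide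
    linear_combination -this + N ^ 2 * h0 + (-(m : ZMod 241) ^ 2 * e ^ 2 * 5
      + 4 * e ^ 4 * (219 ^ 2 + 2)) * h8
  have key' := fun c d hd hcd hm => key (-m) hcop.neg_left (by rw [h]; ring) c d hd hcd hm
  push_cast at key'
  rcases mul_eq_zero.1 h5 with h6 | h6 <;> rcases mul_eq_zero.1 h6 with h7 | h7
  · exact key m hcop h 219 (-84) (by decide +kernel) (by decide) (by linear_combination h7)
  · exact key' 219 (-84) (by decide +kernel) (by decide) (by linear_combination -h7)
  · exact key' (-438) 168 (by decide +kernel) (by decide) (by linear_combination -h7)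
  · exact key m hcop h (-438) 168 (by decide +kernel) (by decide) (by linear_combination h7)

/-- The analogue of `sq_sub_two_mul_sq_mul_ne` for the conic `Y² + 2 Z² = 241 N²`, with
`Y = m² + 6 e²` and `Z = 2 m e`. -/
theorem sq_add_two_mul_sq_mul_ne {m e N : ℤ} (hcop : IsCoprime m e) :
    241 * N ^ 2 ≠ (m ^ 2 + 2 * e ^ 2) * (m ^ 2 + 18 * e ^ 2) := by
  intro h
  have h0 : (241 : ZMod 241) = 0 := by decide
  have key : ∀ m : ℤ, IsCoprime m e →
      241 * N ^ 2 = (m ^ 2 + 2 * e ^ 2) * (m ^ 2 + 18 * e ^ 2) → ∀ c d : ZMod 241,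
      (∀ x, d ≠ x * x) → -(13 * (c ^ 2 + 6) + 24 * c) = d → (m : ZMod 241) ≠ c * e := by
    intro m hcop h c d hd hcd hm
    have he := zmod_ne_zero_of_isCoprime hcop hm
    have hL : ((241 * N - (13 * (m ^ 2 + 6 * e ^ 2) + 24 * (m * e)) : ℤ) : ZMod 241) =
        d * (e : ZMod 241) ^ 2 := by
      push_cast
      rw [hm, ← hcd, h0]
      ring
    refine not_isSquare_mul_sq he hd (hL ▸ isSquare_zmod_of_mul_eq_two_mul_sq
      (L' := 241 * N + (13 * (m ^ 2 + 6 * e ^ 2) + 24 * (m * e)))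
      (D := 26 * (m * e) - 6 * (m ^ 2 + 6 * e ^ 2)) ?_ ?_ ?_)
    · rw [hL]
      refine mul_ne_zero ?_ (pow_ne_zero 2 he)
      have := hd 0
      simpa using this
    · linear_combination 241 * h
    · rintro s ⟨a, ha⟩ ⟨b, hb⟩ ⟨f, hf⟩
      have h1 : s ∣ 4 * 241 * (m ^ 2 + 6 * e ^ 2) :=
        ⟨13 * (b - 2 * a) - 24 * f, by linear_combination -26 * ha + 13 * hb - 24 * hf⟩
      have h2 : s ∣ 8 * 241 * (m * e) :=
        ⟨6 * (b - 2 * a) + 26 * f, by linear_combination -12 * ha + 6 * hb + 26 * hf⟩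
      have h3 : s ∣ 48 * 241 * m ^ 3 := by
        obtain ⟨w, hw⟩ := (h1.mul_left (12 * m)).sub (h2.mul_left (36 * e))
        exact ⟨w, by linear_combination hw⟩
      have h4 : s ∣ 48 * 241 * e ^ 3 := by
        obtain ⟨w, hw⟩ := (h1.mul_left (2 * e)).sub (h2.mul_left m)
        exact ⟨w, by linear_combination hw⟩
      obtain ⟨u, v, huv⟩ := (hcop.pow (m := 3) (n := 3))
      obtain ⟨w, hw⟩ := (h3.mul_left u).add (h4.mul_left v)
      exact ⟨w, by linear_combination hw - 48 * 241 * huv⟩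
  have h5 : ((m : ZMod 241) - 203 * e) * (m - (-203) * e) *
      ((m - 609 * e) * (m - (-609) * e)) = 0 := by
    have := congrArg (Int.cast : ℤ → ZMod 241) h
    push_cast at this
    have h8 : (203 : ZMod 241) ^ 2 = -2 := by decide
    linear_combination -this + N ^ 2 * h0 + (-(m : ZMod 241) ^ 2 * e ^ 2 * 10
      + 9 * e ^ 4 * (203 ^ 2 - 2)) * h8
  have key' := fun c d hd hcd hm => key (-m) hcop.neg_left (by rw [h]; ring) c d hd hcd hm
  push_cast at key'
  rcases mul_eq_zero.1 h5 with h6 | h6 <;> rcases mul_eq_zero.1 h6 with h7 | h7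
  · exact key m hcop h 203 (-104) (by decide +kernel) (by decide) (by linear_combination h7)
  · exact key' 203 (-104) (by decide +kernel) (by decide) (by linear_combination -h7)
  · exact key' (-609) 312 (by decide +kernel) (by decide) (by linear_combination -h7)
  · exact key m hcop h (-609) 312 (by decide +kernel) (by decide) (by linear_combination h7)

theorem isSquare_mul_of_mul_sq_eq {V s u v : ℤ} (hu : u ≠ 0) (h : V * u ^ 2 = s * v ^ 2) :
    IsSquare (V * s) := by
  have h1 : u ∣ s * v := by
    rw [← Int.pow_dvd_pow_iff two_ne_zero]
    exact ⟨V * s, by linear_combination -s * h⟩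
  obtain ⟨t, ht⟩ := h1
  refine ⟨t, ?_⟩
  apply mul_left_cancel₀ (pow_ne_zero 2 hu)
  linear_combination s * h + (s * v + u * t) * ht

theorem odd_of_isSquare_mul {V s : ℤ} (hV : Odd V) (hs : Squarefree s) (h : IsSquare (V * s)) :
    Odd s := by
  by_contra hodd
  rw [Int.not_odd_iff_even, even_iff_two_dvd] at hodd
  obtain ⟨t, ht⟩ := h
  have h2 : (2 : ℤ) ∣ t := by
    apply Int.prime_two.dvd_of_dvd_pow (n := 2)
    rw [sq, ← ht]
    exact hodd.mul_left V
  obtain ⟨w, rfl⟩ := h2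
  have hcop : IsCoprime (2 * 2) V := by
    have : IsCoprime (2 : ℤ) V := Int.isCoprime_two_left.2 hV
    exact this.mul_left this
  have : (2 * 2 : ℤ) ∣ s := hcop.dvd_of_dvd_mul_left ⟨w * w, by rw [ht]; ring⟩
  exact Int.prime_two.not_isUnit (hs 2 this)

/-- Square classes of the `x`-coordinates on `y² = x (x - 482) (x - 1928)`. -/
theorem eq_mul_sq_of_sub {x y : ℚ} (hx : x ≠ 0)
    (h : y ^ 2 = x * (x ^ 2 - 2410 * x + 929296)) :
    ∃ s m g : ℤ, (s = 1 ∨ s = 2 ∨ s = 482) ∧ Squarefree s ∧ g ≠ 0 ∧ m ≠ 0 ∧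
      x = s * ((m : ℚ) / g) ^ 2 := by
  obtain ⟨s, c, m, g, N, hs, hsc, hcop, hm, hg, hxr, hN⟩ :=
    exists_two_isogeny_torsor (a := -2410) (b := 929296) hx (by rw [h]; push_cast; ring)
  refine ⟨s, m, g, ?_, hs, hg, hm, hxr⟩
  have hpos : 0 < s := by
    by_contra hneg
    have h1 : x < 0 := by
      refine lt_of_le_of_ne ?_ hx
      rw [hxr]
      refine mul_nonpos_of_nonpos_of_nonneg ?_ (sq_nonneg _)
      exact_mod_cast not_lt.1 hneg
    have h2 : 0 < x ^ 2 - 2410 * x + 929296 := by nlinarith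
    have := mul_neg_of_neg_of_pos h1 h2
    nlinarith [sq_nonneg y]
  have h1 : s ∣ 964 := by
    rw [← hs.dvd_pow_iff_dvd two_ne_zero]
    exact ⟨c, by rw [hsc]; norm_num⟩
  have h2 : s.natAbs ∈ Nat.divisors 964 :=
    Nat.mem_divisors.2 ⟨Int.natAbs_dvd_natAbs.2 h1, by norm_num⟩
  rw [show Nat.divisors 964 = {1, 2, 4, 241, 482, 964} by decide +kernel] at h2
  simp only [Finset.mem_insert, Finset.mem_singleton] at h2
  have h4 : ¬ (2 * 2 : ℤ) ∣ s := fun h => Int.prime_two.not_isUnit (hs 2 h)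
  have h5 : s ≠ 241 := by
    rintro rfl
    obtain rfl : c = 3856 := by omega
    obtain ⟨K, rfl⟩ : (241 : ℤ) ∣ N := prime_two_hundred_forty_one.dvd_of_dvd_pow (n := 2)
      ⟨m ^ 4 - 10 * m ^ 2 * g ^ 2 + 16 * g ^ 4, by linear_combination hN⟩
    exact sq_sub_two_mul_sq_mul_ne hcop (N := K) (by linarith)
  omega

theorem eq_sq_of_odd_sub {V g Y : ℤ} (hV : Odd V) (hg : g ≠ 0)
    (h : Y ^ 2 = V * (V ^ 2 - 2410 * V * g ^ 2 + 929296 * g ^ 4)) : ∃ t, V = t ^ 2 := by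
  have hV0 : V ≠ 0 := by
    rintro rfl
    simp at hV
  have hgq : (g : ℚ) ≠ 0 := by exact_mod_cast hg
  obtain ⟨s, m, e, hs, hsq, he, -, hxr⟩ := eq_mul_sq_of_sub (x := V / g ^ 2) (y := Y / g ^ 3)
    (div_ne_zero (by exact_mod_cast hV0) (pow_ne_zero 2 hgq)) (by
      have : (Y : ℚ) ^ 2 = V * (V ^ 2 - 2410 * V * g ^ 2 + 929296 * g ^ 4) := by exact_mod_cast h
      field_simp
      linear_combination this)
  have heq : (e : ℚ) ≠ 0 := by exact_mod_cast he
  have h1 : V * e ^ 2 = s * (m * g) ^ 2 := by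
    field_simp at hxr
    have : (V * e ^ 2 : ℚ) = s * (m * g) ^ 2 := by linear_combination hxr
    exact_mod_cast this
  have h2 := isSquare_mul_of_mul_sq_eq he h1
  have h3 := odd_of_isSquare_mul hV hsq h2
  obtain rfl : s = 1 := by
    obtain ⟨w, hw⟩ := h3
    omega
  obtain ⟨t, ht⟩ := h2
  exact ⟨t, by linear_combination ht⟩

theorem exists_sq_eq_of_odd {a : ℤ} (h : Odd a) : ∃ k, a ^ 2 = 8 * k + 1 := by
  obtain ⟨k, hk⟩ := Int.eight_dvd_sq_sub_one_of_odd h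
  exact ⟨k, by linarith⟩

theorem emod_eight_eq_one_of_torsor {s c m g N : ℤ} (hs : Odd s) (hc : c % 32 = 4 * s % 32)
    (hcop : IsCoprime m g) (h : N ^ 2 = s * m ^ 4 + 4820 * m ^ 2 * g ^ 2 + c * g ^ 4) :
    s % 8 = 1 := by
  obtain ⟨a, ha⟩ := hs
  obtain ⟨d, hd⟩ : ∃ d, c = 4 * s + 32 * d := ⟨(c - 4 * s) / 32, by omega⟩
  suffices ∃ q, s = 8 * q + 1 by
    obtain ⟨q, hq⟩ := this
    omega
  rcases Int.even_or_odd m with hm | hm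
  · have hg : Odd g := by
      rw [← Int.isCoprime_two_left]
      exact hcop.of_isCoprime_of_dvd_left (even_iff_two_dvd.1 hm)
    obtain ⟨w, rfl⟩ := even_iff_two_dvd.1 hm
    obtain ⟨n, rfl⟩ : (2 : ℤ) ∣ N := by
      apply Int.prime_two.dvd_of_dvd_pow (n := 2)
      exact ⟨8 * s * w ^ 4 + 9640 * w ^ 2 * g ^ 2 + (2 * s + 16 * d) * g ^ 4, by
        rw [h, hd]; ring⟩
    obtain ⟨r, hr⟩ : Even (w ^ 2 * (s * w ^ 2 + 1205 * g ^ 2)) := by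
      have hs : Odd s := ⟨a, ha⟩
      rcases Int.even_or_odd w with hw | hw
      · exact (hw.pow_of_ne_zero two_ne_zero).mul_right _
      · exact ((hs.mul hw.pow).add_odd ((by decide : Odd (1205 : ℤ)).mul hg.pow)).mul_left _
    have hn : n ^ 2 = 8 * r + (s + 8 * d) * g ^ 4 := by
      rw [hd] at h
      linarith
    have hno : Odd n := by
      rw [← Int.odd_pow' two_ne_zero, hn]
      have h1 : Even (8 * r) := (by decide : Even (8 : ℤ)).mul_right _
      have h2 : Odd (s + 8 * d) := ⟨a + 4 * d, by rw [ha]; ring⟩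
      exact h1.add_odd (h2.mul hg.pow)
    obtain ⟨l, hl⟩ := exists_sq_eq_of_odd hno
    obtain ⟨i, hi⟩ := exists_sq_eq_of_odd hg
    refine ⟨l - r - s * (8 * i ^ 2 + 2 * i) - d * (8 * i + 1) ^ 2, ?_⟩
    linear_combination hl - hn - (s + 8 * d) * (g ^ 2 + 8 * i + 1) * hi
  · obtain ⟨j, hj⟩ := exists_sq_eq_of_odd hm
    have hno : Odd N := by
      rw [← Int.odd_pow' two_ne_zero, h]
      have h1 : Even (4820 * m ^ 2 * g ^ 2) := ⟨2410 * m ^ 2 * g ^ 2, by ring⟩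
      have h2 : Even (c * g ^ 4) := ⟨(2 * s + 16 * d) * g ^ 4, by rw [hd]; ring⟩
      have hs : Odd s := ⟨a, ha⟩
      exact ((hs.mul hm.pow).add_even h1).add_even h2
    obtain ⟨l, hl⟩ := exists_sq_eq_of_odd hno
    have hm4 : m ^ 4 = (8 * j + 1) ^ 2 := by rw [← hj]; ring
    rcases Int.even_or_odd g with hg | hg
    · obtain ⟨w, rfl⟩ := even_iff_two_dvd.1 hg
      refine ⟨l - s * (8 * j ^ 2 + 2 * j) - 2410 * m ^ 2 * w ^ 2 - 2 * c * w ^ 4, ?_⟩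
      linear_combination hl - h - s * hm4
    · obtain ⟨i, hi⟩ := exists_sq_eq_of_odd hg
      have hg4 : g ^ 4 = (8 * i + 1) ^ 2 := by rw [← hi]; ring
      rw [hm4, hg4, hj, hi, hl, hd] at h
      refine ⟨l - s * (8 * j ^ 2 + 2 * j) - 4820 * (8 * i * j + i + j) - (603 + a)
        - 4 * s * (8 * i ^ 2 + 2 * i) - 4 * d * (8 * i + 1) ^ 2, ?_⟩
      linear_combination -h - 4 * ha

theorem eq_sq_of_odd_add {V g Y : ℤ} (hV : Odd V) (hg : g ≠ 0)
    (h : Y ^ 2 = V * (V ^ 2 + 4820 * V * g ^ 2 + 2090916 * g ^ 4)) : ∃ t, V = t ^ 2 := by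
  have hV0 : V ≠ 0 := by
    rintro rfl
    simp at hV
  have hgq : (g : ℚ) ≠ 0 := by exact_mod_cast hg
  obtain ⟨s, c, m, e, N, hsq, hsc, hcop, hm, he, hxr, hN⟩ :=
    exists_two_isogeny_torsor (a := 4820) (b := 2090916) (x := V / g ^ 2) (y := Y / g ^ 3)
    (div_ne_zero (by exact_mod_cast hV0) (pow_ne_zero 2 hgq)) (by
      have : (Y : ℚ) ^ 2 = V * (V ^ 2 + 4820 * V * g ^ 2 + 2090916 * g ^ 4) := by exact_mod_cast h
      field_simp
      push_cast
      linear_combination this)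
  have heq : (e : ℚ) ≠ 0 := by exact_mod_cast he
  have h1 : V * e ^ 2 = s * (m * g) ^ 2 := by
    field_simp at hxr
    have : (V * e ^ 2 : ℚ) = s * (m * g) ^ 2 := by linear_combination hxr
    exact_mod_cast this
  have h2 := isSquare_mul_of_mul_sq_eq he h1
  have h3 := odd_of_isSquare_mul hV hsq h2
  have h4 : s ∣ 1446 := by
    rw [← hsq.dvd_pow_iff_dvd two_ne_zero]
    exact ⟨c, by rw [hsc]; norm_num⟩
  have h5 : s.natAbs ∈ Nat.divisors 1446 :=
    Nat.mem_divisors.2 ⟨Int.natAbs_dvd_natAbs.2 h4, by norm_num⟩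
  rw [show Nat.divisors 1446 = {1, 2, 3, 6, 241, 482, 723, 1446} by decide +kernel] at h5
  simp only [Finset.mem_insert, Finset.mem_singleton] at h5
  have h6 : s = 1 ∨ s = -1 ∨ s = 3 ∨ s = -3 ∨ s = 241 ∨ s = -241 ∨ s = 723 ∨ s = -723 := by
    obtain ⟨w, hw⟩ := h3
    omega
  have h7 : c % 32 = 4 * s % 32 := by
    rcases h6 with rfl | rfl | rfl | rfl | rfl | rfl | rfl | rfl <;> omega
  have h8 := emod_eight_eq_one_of_torsor h3 h7 hcop hN
  have h9 : s ≠ 241 := by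
    rintro rfl
    obtain rfl : c = 8676 := by omega
    obtain ⟨K, rfl⟩ : (241 : ℤ) ∣ N := prime_two_hundred_forty_one.dvd_of_dvd_pow (n := 2)
      ⟨m ^ 4 + 20 * m ^ 2 * e ^ 2 + 36 * e ^ 4, by linear_combination hN⟩
    exact sq_add_two_mul_sq_mul_ne hcop (N := K) (by linarith)
  obtain rfl : s = 1 := by omega
  obtain ⟨t, ht⟩ := h2
  exact ⟨t, by linear_combination ht⟩

/-- The two roots of `z² - A z + c` have odd sum and difference, so one of them is odd. -/
theorem exists_odd_root {A N c : ℤ} (hA : Odd A) (hN : Odd N) (h : A ^ 2 - N ^ 2 = 4 * c) :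
    ∃ V, Odd V ∧ V ^ 2 - A * V + c = 0 := by
  obtain ⟨a, rfl⟩ := hA
  obtain ⟨b, rfl⟩ := hN
  rcases Int.even_or_odd (a + b) with hab | hab
  · exact ⟨a + b + 1, hab.add_one, by linarith⟩
  · exact ⟨a - b, by rw [Int.odd_sub]; rw [Int.odd_add] at hab; exact hab, by linarith⟩

/-- Infinite descent along the 2-isogenies between `y² = x (x - 482) (x - 1928)` and
`y² = x (x + 482) (x + 4338)`: each round trip halves `e`. -/
theorem quartic_ne_sq (e : ℤ) (he : e ≠ 0) {M N : ℤ} (hM : Odd M) :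
    N ^ 2 ≠ M ^ 4 - 2410 * M ^ 2 * e ^ 2 + 929296 * e ^ 4 := by
  induction hk : e.natAbs using Nat.strong_induction_on generalizing e M N with
  | _ k ih =>
  intro h
  have hN : Odd N := by
    rw [← Int.odd_pow' two_ne_zero, h]
    have h1 : Even (2410 * M ^ 2 * e ^ 2) := ⟨1205 * M ^ 2 * e ^ 2, by ring⟩
    have h2 : Even (929296 * e ^ 4) := ⟨464648 * e ^ 4, by ring⟩
    exact (hM.pow.sub_even h1).add_even h2
  rcases Int.even_or_odd e with hev | hodd
  · obtain ⟨f, rfl⟩ := even_iff_two_dvd.1 hev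
    have hf : f ≠ 0 := by
      rintro rfl
      simp at he
    obtain ⟨V, hV, hVf⟩ : ∃ V, Odd V ∧
        V ^ 2 - (M ^ 2 - 4820 * f ^ 2) * V + 2090916 * f ^ 4 = 0 :=
      exists_odd_root (hM.pow.sub_even ⟨2410 * f ^ 2, by ring⟩) hN
        (by linear_combination -h)
    obtain ⟨t, rfl⟩ := eq_sq_of_odd_add (Y := M * V) hV hf (by linear_combination -V * hVf)
    have ht : Odd t := (Int.odd_pow' two_ne_zero).1 hV
    obtain ⟨U, hU, hUf⟩ : ∃ U, Odd U ∧
        U ^ 2 - (t ^ 2 + 2410 * f ^ 2) * U + 929296 * f ^ 4 = 0 :=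
      exists_odd_root (ht.pow.add_even ⟨1205 * f ^ 2, by ring⟩) (hM.mul ht)
        (by linear_combination hVf)
    obtain ⟨w, rfl⟩ := eq_sq_of_odd_sub (Y := t * U) hU hf (by linear_combination -U * hUf)
    have hw : Odd w := (Int.odd_pow' two_ne_zero).1 hU
    exact ih f.natAbs (by omega) f hf (N := t * w) hw rfl (by linear_combination -hUf)
  · obtain ⟨j, hj⟩ := exists_sq_eq_of_odd hM
    obtain ⟨i, hi⟩ := exists_sq_eq_of_odd hodd
    obtain ⟨l, hl⟩ := exists_sq_eq_of_odd hN
    have hM4 : M ^ 4 = (8 * j + 1) ^ 2 := by rw [← hj]; ring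
    have he4 : e ^ 4 = (8 * i + 1) ^ 2 := by rw [← hi]; ring
    rw [hM4, he4, hj, hi, hl] at h
    have : (2410 : ℤ) = 8 * (8 * j ^ 2 + 2 * j - 2410 * (8 * i * j + i + j)
        + 116162 * (8 * i + 1) ^ 2 - l) := by linear_combination h
    omega

theorem ne_sq_of_sub {x y r : ℚ} (hx : x ≠ 0)
    (h : y ^ 2 = x * (x ^ 2 - 2410 * x + 929296)) : x ≠ r ^ 2 := by
  rintro rfl
  have hr : r ≠ 0 := by
    rintro rfl
    simp at hx
  have hm : r.num ≠ 0 := Rat.num_ne_zero.2 hr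
  have hg : (r.den : ℤ) ≠ 0 := by exact_mod_cast r.den_nz
  have hcop : IsCoprime r.num r.den := by
    rw [Int.isCoprime_iff_nat_coprime]
    simpa using r.reduced
  have hsq : IsSquare (r.num ^ 4 - 2410 * r.num ^ 2 * r.den ^ 2 + 929296 * r.den ^ 4 : ℤ) := by
    rw [← Rat.isSquare_intCast_iff]
    refine ⟨y / r * r.den ^ 2, ?_⟩
    push_cast
    rw [← Rat.mul_den_eq_num r]
    field_simp
    linear_combination -h
  generalize r.num = m at *
  generalize (r.den : ℤ) = g at *
  obtain ⟨N, hN⟩ := hsq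
  rcases Int.even_or_odd m with hev | hodd
  · have hgo : Odd g := by
      rw [← Int.isCoprime_two_left]
      exact hcop.of_isCoprime_of_dvd_left (even_iff_two_dvd.1 hev)
    obtain ⟨v, rfl⟩ := even_iff_two_dvd.1 hev
    obtain ⟨N, rfl⟩ : (2 : ℤ) ∣ N := by
      apply Int.prime_two.dvd_of_dvd_pow (n := 2)
      exact ⟨8 * v ^ 4 - 4820 * v ^ 2 * g ^ 2 + 464648 * g ^ 4, by linear_combination -hN⟩
    obtain ⟨N, rfl⟩ : (2 : ℤ) ∣ N := by
      apply Int.prime_two.dvd_of_dvd_pow (n := 2)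
      exact ⟨2 * v ^ 4 - 1205 * v ^ 2 * g ^ 2 + 116162 * g ^ 4, by linarith⟩
    have hv : Even v := by
      by_contra hv
      rw [Int.not_even_iff_odd] at hv
      have h1 : Odd (1205 * v ^ 2 * g ^ 2) :=
        ((by decide : Odd (1205 : ℤ)).mul hv.pow).mul hgo.pow
      have h2 : Even (1205 * v ^ 2 * g ^ 2) := ⟨v ^ 4 + 58081 * g ^ 4 - N ^ 2, by linarith⟩
      exact Int.not_even_iff_odd.2 h1 h2
    obtain ⟨w, rfl⟩ := even_iff_two_dvd.1 hv
    have hw : w ≠ 0 := by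
      rintro rfl
      simp at hm
    refine quartic_ne_sq w hw (M := 241 * g) (N := 241 * N)
      ((by decide : Odd (241 : ℤ)).mul hgo) ?_
    apply mul_left_cancel₀ (by norm_num : (16 : ℤ) ≠ 0)
    linear_combination (-241 ^ 2) * hN
  · exact quartic_ne_sq g hg (N := N) hodd (by rw [hN]; ring)

/-- Translation by `(482, 0)` on `y² = x (x - 482) (x - 1928)`. -/
theorem translate_eq {x y : ℚ} (hx : x ≠ 482)
    (h : y ^ 2 = x * (x ^ 2 - 2410 * x + 929296)) :
    (482 * 1446 * y / (x - 482) ^ 2) ^ 2 =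
      482 * (x - 1928) / (x - 482) * ((482 * (x - 1928) / (x - 482)) ^ 2 -
        2410 * (482 * (x - 1928) / (x - 482)) + 929296) := by
  have : x - 482 ≠ 0 := sub_ne_zero.2 hx
  field_simp
  linear_combination 482 * 1446 ^ 2 * h

theorem y_eq_zero_of_sub {x y : ℚ} (h : y ^ 2 = x * (x ^ 2 - 2410 * x + 929296)) : y = 0 := by
  by_contra hy
  have hfac : y ^ 2 = x * (x - 482) * (x - 1928) := by rw [h]; ring
  have hne : x * (x - 482) * (x - 1928) ≠ 0 := hfac ▸ pow_ne_zero 2 hy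
  have h3 : x - 1928 ≠ 0 := right_ne_zero_of_mul hne
  have h2 : x - 482 ≠ 0 := right_ne_zero_of_mul (left_ne_zero_of_mul hne)
  have h1 : x ≠ 0 := left_ne_zero_of_mul (left_ne_zero_of_mul hne)
  obtain ⟨z, hz⟩ : ∃ z, z = 482 * (x - 1928) / (x - 482) := ⟨_, rfl⟩
  have hz0 : z ≠ 0 := by
    rw [hz]
    exact div_ne_zero (mul_ne_zero (by norm_num) h3) h2
  have hzE := translate_eq (sub_ne_zero.1 h2) h
  rw [← hz] at hzE
  have hzx : z = 482 * x * (y / (x * (x - 482))) ^ 2 := by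
    rw [hz, div_pow, hfac]
    field_simp
  obtain ⟨s, m, g, hs, -, hg, hm, hxs⟩ := eq_mul_sq_of_sub h1 h
  rcases hs with rfl | rfl | rfl
  · exact ne_sq_of_sub h1 h (r := m / g) (by rw [hxs]; simp)
  · obtain ⟨t, u, v, ht, -, hv, hu, hzt⟩ := eq_mul_sq_of_sub hz0 hzE
    have hvq : (v : ℚ) ≠ 0 := by exact_mod_cast hv
    have huq : (u : ℚ) ≠ 0 := by exact_mod_cast hu
    have hsq : IsSquare ((t * 241 : ℤ) : ℚ) := by
      refine ⟨482 * (m / g) * (y / (x * (x - 482))) / (u / v), ?_⟩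
      have h4 : (t : ℚ) * (u / v) ^ 2 = 964 * (m / g) ^ 2 * (y / (x * (x - 482))) ^ 2 := by
        rw [← hzt, hzx, mul_assoc 482 x]
        nth_rewrite 1 [hxs]
        push_cast
        ring
      have h5 : (u / v : ℚ) ≠ 0 := div_ne_zero huq hvq
      generalize (u / v : ℚ) = ρ at *
      generalize y / (x * (x - 482)) = σ at *
      generalize (m / g : ℚ) = τ at *
      push_cast
      field_simp
      linear_combination 241 * h4
    rw [Rat.isSquare_intCast_iff] at hsq
    rcases ht with rfl | rfl | rfl <;> revert hsq <;> decide +kernel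
  · refine ne_sq_of_sub hz0 hzE (r := 482 * (m / g) * (y / (x * (x - 482)))) ?_
    rw [hzx, mul_assoc 482 x]
    nth_rewrite 1 [hxs]
    push_cast
    ring

/-- Every rational point on the genus 1 curve `E₆ : 2y² = (x + 482)(x + 241)(x − 482)` has
`y = 0`; i.e. the only rational points of `E₆` are its points of order at most 2. -/
theorem rational_points_E6 (x y : ℚ) (h : 2 * y ^ 2 = (x + 482) * (x + 241) * (x - 482)) :
    y = 0 := by
  have := y_eq_zero_of_sub (x := 2 * x + 964) (y := 4 * y) (by linear_combination 8 * h)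
  simpa using this
end
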